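/- Let p be an odd prime, r ≥ 3, and let M, M' ∈ M_r(ℤ) be symmetric, even, hyperbolic, p-elementary Gram matrices of the same length a. Then M and M' are ℤ-congruent, i.e. there exists P ∈ GL_r(ℤ) with PᵀMP = M'. -/

import Mathlib

open Matrix

/-- `M` is the Gram matrix of a hyperbolic lattice, i.e. of signature `(1, r-1)`: over `ℝ`
it is congruent to `diag(1, -1, …, -1)`. -/
def IsHyperbolicGram {r : ℕ} (M : Matrix (Fin r) (Fin r) ℤ) : Prop :=
  ∃ P : Matrix (Fin r) (Fin r) ℝ, IsUnit P.det ∧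
    Pᵀ * (M.map (Int.cast : ℤ → ℝ)) * P =
      Matrix.diagonal (fun i : Fin r => if (i : ℕ) = 0 then (1 : ℝ) else -1)

/-- `M` is `q`-elementary of length `a`: the cokernel of `M : ℤ^r → ℤ^r` is isomorphic to
`(ℤ/qℤ)^a`. -/
def ElemOfLength {r : ℕ} (q a : ℕ) (M : Matrix (Fin r) (Fin r) ℤ) : Prop :=
  Nonempty (((Fin r → ℤ) ⧸ LinearMap.range M.mulVecLin) ≃ₗ[ℤ] (Fin a → ZMod q))

/-- `δ(M) = 0`, i.e. `zᵀ M⁻¹ z ∈ ℤ` for every integer vector `z`. -/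
def DeltaZero {r : ℕ} (M : Matrix (Fin r) (Fin r) ℤ) : Prop :=
  ∀ z : Fin r → ℤ, ∃ n : ℤ,
    (fun i => (z i : ℚ)) ⬝ᵥ ((M.map (Int.cast : ℤ → ℚ))⁻¹ *ᵥ fun i => (z i : ℚ)) = (n : ℚ)

namespace WittLattice

set_option linter.unusedSectionVars false

section Neutral

variable {R : Type*} [CommRing R] {ι κ μ ν : Type*} [Fintype ι] [Fintype κ] [Fintype μ] [Fintype ν]
  [DecidableEq ι] [DecidableEq κ] [DecidableEq μ] [DecidableEq ν]

/-- The Gram matrix `G` admits a split totally isotropic submodule of at least half the rank. -/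
def Neutral (G : Matrix ι ι R) : Prop :=
  ∃ (d : ℕ) (P : Matrix ι (Fin d) R) (S : Matrix (Fin d) ι R),
    S * P = 1 ∧ Pᵀ * G * P = 0 ∧ Fintype.card ι ≤ 2 * d

/-- Congruence of Gram matrices, allowing different index types. -/
def Cong (G : Matrix ι ι R) (H : Matrix κ κ R) : Prop :=
  ∃ (P : Matrix ι κ R) (S : Matrix κ ι R), P * S = 1 ∧ S * P = 1 ∧ Pᵀ * G * P = H

/-- Orthogonal sum of Gram matrices. -/
def orthSum (G : Matrix ι ι R) (H : Matrix κ κ R) : Matrix (ι ⊕ κ) (ι ⊕ κ) R :=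
  fromBlocks G 0 0 H

theorem Neutral.of_fintype {G : Matrix ι ι R} (P : Matrix ι κ R) (S : Matrix κ ι R)
    (h1 : S * P = 1) (h2 : Pᵀ * G * P = 0) (h3 : Fintype.card ι ≤ 2 * Fintype.card κ) :
    Neutral G := by
  let e := (Fintype.equivFin κ).symm
  refine ⟨Fintype.card κ, P.submatrix id e, S.submatrix e id, ?_, ?_, h3⟩
  · rw [← submatrix_mul S P e id e Function.bijective_id, h1, submatrix_one_equiv]
  · have := congrArg (fun M => M.submatrix e e) h2
    rw [transpose_submatrix]
    rw [submatrix_mul _ _ _ id e Function.bijective_id,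
      submatrix_mul _ _ _ id id Function.bijective_id] at this
    simpa using this

theorem Neutral.map {S : Type*} [CommRing S] (f : R →+* S) {G : Matrix ι ι R} (h : Neutral G) :
    Neutral (G.map f) := by
  obtain ⟨d, P, T, h1, h2, h3⟩ := h
  refine ⟨d, P.map f, T.map f, ?_, ?_, h3⟩
  · rw [← Matrix.map_mul, h1]; simp
  · rw [← Matrix.transpose_map, ← Matrix.map_mul, ← Matrix.map_mul, h2]; simp

theorem Cong.refl (G : Matrix ι ι R) : Cong G G := ⟨1, 1, by simp, by simp, by simp⟩

theorem Cong.symm {G : Matrix ι ι R} {H : Matrix κ κ R} (h : Cong G H) : Cong H G := by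
  obtain ⟨P, S, h1, h2, rfl⟩ := h
  refine ⟨S, P, h2, h1, ?_⟩
  calc Sᵀ * (Pᵀ * G * P) * S = (P * S)ᵀ * G * (P * S) := by
        simp only [transpose_mul, Matrix.mul_assoc]
    _ = G := by rw [h1]; simp

theorem Cong.trans {G : Matrix ι ι R} {H : Matrix κ κ R} {K : Matrix μ μ R}
    (h : Cong G H) (h' : Cong H K) : Cong G K := by
  obtain ⟨P, S, h1, h2, rfl⟩ := h
  obtain ⟨P', S', h1', h2', rfl⟩ := h'
  refine ⟨P * P', S' * S, ?_, ?_, ?_⟩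
  · calc P * P' * (S' * S) = P * (P' * S') * S := by simp only [Matrix.mul_assoc]
      _ = 1 := by rw [h1']; simpa using h1
  · calc S' * S * (P * P') = S' * (S * P) * P' := by simp only [Matrix.mul_assoc]
      _ = 1 := by rw [h2]; simpa using h2'
  · simp only [transpose_mul, Matrix.mul_assoc]

theorem Cong.card_eq [Nontrivial R] {G : Matrix ι ι R} {H : Matrix κ κ R} (h : Cong G H) :
    Fintype.card ι = Fintype.card κ := by
  obtain ⟨P, S, h1, h2, -⟩ := h
  have := LinearEquiv.finrank_eq (Matrix.toLin'OfInv h1 h2)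
  simpa using this

theorem Cong.map {S : Type*} [CommRing S] (f : R →+* S) {G : Matrix ι ι R} {H : Matrix κ κ R}
    (h : Cong G H) : Cong (G.map f) (H.map f) := by
  obtain ⟨P, T, h1, h2, rfl⟩ := h
  refine ⟨P.map f, T.map f, ?_, ?_, ?_⟩
  · rw [← Matrix.map_mul, h1]; simp
  · rw [← Matrix.map_mul, h2]; simp
  · rw [← Matrix.transpose_map, ← Matrix.map_mul, ← Matrix.map_mul]

theorem Cong.neg {G : Matrix ι ι R} {H : Matrix κ κ R} (h : Cong G H) : Cong (-G) (-H) := by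
  obtain ⟨P, T, h1, h2, rfl⟩ := h
  exact ⟨P, T, h1, h2, by simp⟩

theorem Cong.add {G : Matrix ι ι R} {H : Matrix κ κ R} {G' : Matrix μ μ R} {H' : Matrix ν ν R}
    (h : Cong G H) (h' : Cong G' H') : Cong (orthSum G G') (orthSum H H') := by
  obtain ⟨P, S, h1, h2, rfl⟩ := h
  obtain ⟨P', S', h1', h2', rfl⟩ := h'
  refine ⟨fromBlocks P 0 0 P', fromBlocks S 0 0 S', ?_, ?_, ?_⟩ <;>
    simp [orthSum, fromBlocks_multiply, fromBlocks_transpose, h1, h2, h1', h2']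

theorem Cong.of_equiv (e : κ ≃ ι) (G : Matrix ι ι R) : Cong G (G.submatrix e e) := by
  refine ⟨(1 : Matrix ι ι R).submatrix id e, (1 : Matrix ι ι R).submatrix e id, ?_, ?_, ?_⟩
  · rw [submatrix_mul_equiv _ _ id e id]; simp
  · have := submatrix_mul_equiv (1 : Matrix ι ι R) (1 : Matrix ι ι R) e (Equiv.refl ι) e
    simp only [Equiv.coe_refl] at this
    rw [this]; simp
  · ext i j
    simp [Matrix.mul_apply, Matrix.one_apply]

theorem Neutral.cong {G : Matrix ι ι R} {H : Matrix κ κ R} [Nontrivial R] (hG : Neutral G)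
    (h : Cong G H) : Neutral H := by
  have hc := h.card_eq
  obtain ⟨P, S, h1, h2, rfl⟩ := h
  obtain ⟨d, Q, T, h3, h4, h5⟩ := hG
  refine ⟨d, S * Q, T * P, ?_, ?_, by omega⟩
  · calc T * P * (S * Q) = T * (P * S) * Q := by simp only [Matrix.mul_assoc]
      _ = 1 := by rw [h1]; simpa using h3
  · calc (S * Q)ᵀ * (Pᵀ * G * P) * (S * Q) = Qᵀ * ((P * S)ᵀ * G * (P * S)) * Q := by
          simp only [transpose_mul, Matrix.mul_assoc]
      _ = 0 := by rw [h1]; simpa using h4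

theorem Neutral.add {G : Matrix ι ι R} {H : Matrix κ κ R} (hG : Neutral G) (hH : Neutral H) :
    Neutral (orthSum G H) := by
  obtain ⟨d, P, S, h1, h2, h3⟩ := hG
  obtain ⟨d', P', S', h1', h2', h3'⟩ := hH
  refine Neutral.of_fintype (fromBlocks P 0 0 P') (fromBlocks S 0 0 S') ?_ ?_ ?_
  · simp [fromBlocks_multiply, h1, h1']
  · simp [orthSum, fromBlocks_multiply, fromBlocks_transpose, h2, h2']
  · simp; omega

theorem Neutral.neg {G : Matrix ι ι R} (h : Neutral G) : Neutral (-G) := by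
  obtain ⟨d, P, S, h1, h2, h3⟩ := h
  exact ⟨d, P, S, h1, by simp [h2], h3⟩

theorem neutral_orthSum_neg (G : Matrix ι ι R) : Neutral (orthSum G (-G)) := by
  refine Neutral.of_fintype (κ := ι) (fromRows 1 1) (fromCols 1 0) ?_ ?_ ?_
  · rw [fromCols_mul_fromRows]; simp
  · rw [orthSum, transpose_fromRows, fromCols_mul_fromBlocks, fromCols_mul_fromRows]; simp
  · simp; omega

theorem cong_orthSum_comm (G : Matrix ι ι R) (H : Matrix κ κ R) :
    Cong (orthSum G H) (orthSum H G) := by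
  have := Cong.of_equiv (Equiv.sumComm κ ι) (orthSum G H)
  convert this using 1
  ext (i | i) (j | j) <;> simp [orthSum]

theorem cong_orthSum_assoc (G : Matrix ι ι R) (H : Matrix κ κ R) (K : Matrix μ μ R) :
    Cong (orthSum (orthSum G H) K) (orthSum G (orthSum H K)) := by
  have := Cong.of_equiv (Equiv.sumAssoc ι κ μ).symm (orthSum (orthSum G H) K)
  convert this using 1
  ext (i | i | i) (j | j | j) <;> simp [orthSum]

theorem orthSum_map {S : Type*} [CommRing S] (f : R →+* S) (G : Matrix ι ι R) (H : Matrix κ κ R) :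
    (orthSum G H).map f = orthSum (G.map f) (H.map f) := by
  ext (i | i) (j | j) <;> simp [orthSum]

theorem orthSum_det (G : Matrix ι ι R) (H : Matrix κ κ R) : (orthSum G H).det = G.det * H.det := by
  simp [orthSum]

theorem orthSum_isSymm {G : Matrix ι ι R} {H : Matrix κ κ R} (hG : G.IsSymm) (hH : H.IsSymm) :
    (orthSum G H).IsSymm := by
  unfold Matrix.IsSymm at *
  simp [orthSum, fromBlocks_transpose, hG, hH]

theorem Cong.isUnit_det [Nontrivial R] {G : Matrix ι ι R} {H : Matrix κ κ R} (h : Cong G H)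
    (hG : IsUnit G.det) : IsUnit H.det := by
  obtain ⟨P, S, h1, h2, rfl⟩ := h
  have hi : G⁻¹ * G = 1 := nonsing_inv_mul _ hG
  refine isUnit_det_of_left_inverse (B := S * G⁻¹ * Sᵀ) ?_
  calc S * G⁻¹ * Sᵀ * (Pᵀ * G * P) = S * (G⁻¹ * ((P * S)ᵀ * G)) * P := by
        simp only [transpose_mul, Matrix.mul_assoc]
    _ = 1 := by rw [h1]; simp [hi, h2]

end Neutral

section Field

variable {K : Type*} [Field K] {ι κ : Type*} [Fintype ι] [Fintype κ] [DecidableEq ι] [DecidableEq κ]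

theorem neutral_of_submodule {G : Matrix ι ι K} (W : Submodule K (ι → K))
    (h : ∀ x ∈ W, ∀ y ∈ W, x ⬝ᵥ G *ᵥ y = 0) (hd : Fintype.card ι ≤ 2 * Module.finrank K W) :
    Neutral G := by
  let b := Module.finBasis K W
  obtain ⟨g, hg⟩ := LinearMap.exists_leftInverse_of_injective
    (Fintype.linearCombination K (fun i => (b i : ι → K))) (by
      rw [Fintype.linearCombination, LinearMap.ker_eq_bot']
      intro m hm
      have := (Fintype.linearIndependent_iff (R := K) (v := fun i => (b i : ι → K))).1
        (b.linearIndependent.map' W.subtype (by simp)) m (by simpa using hm)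
      ext i; exact this i)
  refine ⟨_, Matrix.of (fun i j => (b j : ι → K) i), LinearMap.toMatrix' g, ?_, ?_, hd⟩
  · have : (Matrix.of (fun i j => (b j : ι → K) i)) =
        LinearMap.toMatrix' (Fintype.linearCombination K (fun i => (b i : ι → K))) := by
      ext i j
      simp only [LinearMap.toMatrix'_apply, Fintype.linearCombination_apply, Pi.single_apply,
        ite_smul, one_smul, zero_smul, Finset.sum_ite_eq', Finset.mem_univ, if_true, of_apply]
    rw [this, ← LinearMap.toMatrix'_comp, hg]; simp
  · ext i j
    have := h _ (b i).2 _ (b j).2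
    simp only [Matrix.zero_apply]
    rw [← this, Matrix.mul_assoc]
    simp [Matrix.mul_apply, dotProduct, Matrix.mulVec]

theorem Neutral.exists_submodule {G : Matrix ι ι K} (h : Neutral G) :
    ∃ W : Submodule K (ι → K), (∀ x ∈ W, ∀ y ∈ W, x ⬝ᵥ G *ᵥ y = 0) ∧
      Fintype.card ι ≤ 2 * Module.finrank K W := by
  obtain ⟨d, P, S, h1, h2, h3⟩ := h
  refine ⟨LinearMap.range P.mulVecLin, ?_, ?_⟩
  · rintro _ ⟨x, rfl⟩ _ ⟨y, rfl⟩
    have : (P *ᵥ x) ⬝ᵥ G *ᵥ P *ᵥ y = x ⬝ᵥ (Pᵀ * G * P) *ᵥ y := by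
      rw [← vecMul_transpose, ← dotProduct_mulVec, mulVec_mulVec, mulVec_mulVec]
    rw [mulVecLin_apply, mulVecLin_apply, this, h2]
    simp
  · rw [LinearMap.finrank_range_of_inj]
    · simpa using h3
    · refine Function.LeftInverse.injective (g := S.mulVecLin) fun x => ?_
      simp [mulVec_mulVec, h1]

theorem two_mul_finrank_le {G : Matrix ι ι K} (hdet : G.det ≠ 0) {W : Submodule K (ι → K)}
    (h : ∀ x ∈ W, ∀ y ∈ W, x ⬝ᵥ G *ᵥ y = 0) : 2 * Module.finrank K W ≤ Fintype.card ι := by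
  have hnd := (LinearMap.BilinForm.nondegenerate_toBilin'_iff_det_ne_zero (M := G)).2 hdet
  have h1 := LinearMap.BilinForm.finrank_orthogonal hnd W
  have h2 : W ≤ (Matrix.toBilin' G).orthogonal W := by
    intro y hy
    rw [LinearMap.BilinForm.mem_orthogonal_iff]
    intro x hx
    simpa [Matrix.toBilin'_apply'] using h x hx y hy
  have h3 := Submodule.finrank_mono h2
  have h4 := Submodule.finrank_le W
  rw [Module.finrank_pi] at h1 h4
  omega

/-- Witt cancellation for neutral forms. -/
theorem Neutral.cancel {A : Matrix ι ι K} {B : Matrix κ κ K} (hA : A.IsSymm) (hB : B.IsSymm)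
    (hdA : A.det ≠ 0) (hdB : B.det ≠ 0) (hAB : Neutral (orthSum A B)) (hNB : Neutral B) :
    Neutral A := by
  obtain ⟨W, hW, hWd⟩ := hAB.exists_submodule
  obtain ⟨I, hI, hId⟩ := hNB.exists_submodule
  have hdet : (orthSum A B).det ≠ 0 := by rw [orthSum_det]; exact mul_ne_zero hdA hdB
  have hW2 := two_mul_finrank_le hdet hW
  have hI2 := two_mul_finrank_le hdB hI
  set F := Matrix.toBilin' (orthSum A B) with hF
  have hsymm : F.IsSymm := by
    refine ⟨fun x y => ?_⟩
    have h := (orthSum_isSymm hA hB)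
    rw [hF, Matrix.toBilin'_apply', Matrix.toBilin'_apply']
    rw [dotProduct_mulVec, dotProduct_comm, ← mulVec_transpose, h.eq]
  have hnd : F.Nondegenerate := LinearMap.BilinForm.nondegenerate_toBilin'_iff_det_ne_zero.2 hdet
  have hFapp : ∀ x y, F x y = (x ∘ Sum.inl) ⬝ᵥ A *ᵥ (y ∘ Sum.inl) +
      (x ∘ Sum.inr) ⬝ᵥ B *ᵥ (y ∘ Sum.inr) := by
    intro x y
    rw [hF, Matrix.toBilin'_apply', orthSum, fromBlocks_mulVec]
    simp [dotProduct, Fintype.sum_sum_type]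
  let inr : (κ → K) →ₗ[K] (ι ⊕ κ → K) :=
    { toFun := fun y => Sum.elim 0 y
      map_add' := by intro x y; ext (i | i) <;> simp
      map_smul' := by intro x y; ext (i | i) <;> simp }
  have hinr : Function.Injective inr := by
    intro x y h
    ext i
    exact congrFun h (Sum.inr i)
  let pr : (ι ⊕ κ → K) →ₗ[K] (ι → K) := LinearMap.funLeft K K Sum.inl
  set I' := I.map inr with hI'
  have hI'd : Module.finrank K I' = Module.finrank K I :=
    (Submodule.equivMapOfInjective inr hinr I).finrank_eq.symm
  set J0 := W ⊓ F.orthogonal I' with hJ0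
  have hBorth : ∀ b : κ → K, (∀ y ∈ I, y ⬝ᵥ B *ᵥ b = 0) → b ∈ I := by
    intro b hb
    have hndB := (LinearMap.BilinForm.nondegenerate_toBilin'_iff_det_ne_zero (M := B)).2 hdB
    have h1 := LinearMap.BilinForm.finrank_orthogonal hndB I
    have h2 : I ≤ (Matrix.toBilin' B).orthogonal I := by
      intro y hy
      rw [LinearMap.BilinForm.mem_orthogonal_iff]
      intro x hx
      simpa [Matrix.toBilin'_apply'] using hI x hx y hy
    rw [Module.finrank_pi] at h1
    have h3 := Submodule.eq_of_le_of_finrank_le h2 (by omega)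
    rw [h3, LinearMap.BilinForm.mem_orthogonal_iff]
    intro x hx
    simpa [Matrix.toBilin'_apply'] using hb x hx
  have hJ0mem : ∀ x ∈ J0, x ∘ Sum.inr ∈ I := by
    rintro x ⟨-, hx⟩
    refine hBorth _ fun y hy => ?_
    have := (LinearMap.BilinForm.mem_orthogonal_iff.1 hx) (inr y) ⟨y, hy, rfl⟩
    rw [hFapp] at this
    have e1 : (inr y) ∘ Sum.inl = 0 := by ext i; simp [inr]
    have e2 : (inr y) ∘ Sum.inr = y := by ext i; simp [inr]
    simpa [e1, e2] using this
  refine neutral_of_submodule (J0.map pr) ?_ ?_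
  · rintro _ ⟨x, hx, rfl⟩ _ ⟨y, hy, rfl⟩
    have h1 : F x y = 0 := by rw [hF, Matrix.toBilin'_apply']; exact hW x hx.1 y hy.1
    rw [hFapp, hI _ (hJ0mem x hx) _ (hJ0mem y hy), add_zero] at h1
    exact h1
  · have hWo : W ≤ F.orthogonal W := by
      intro y hy
      rw [LinearMap.BilinForm.mem_orthogonal_iff]
      intro x hx
      rw [hF, Matrix.toBilin'_apply']
      exact hW x hx y hy
    have h1 := LinearMap.BilinForm.finrank_orthogonal hnd W
    have hWe : W = F.orthogonal W := Submodule.eq_of_le_of_finrank_le hWo (by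
      rw [Module.finrank_pi] at h1; omega)
    have h2 : F.orthogonal (W ⊔ I') ≤ J0 := by
      refine le_inf ?_ (LinearMap.BilinForm.orthogonal_le le_sup_right)
      conv_rhs => rw [hWe]
      exact LinearMap.BilinForm.orthogonal_le le_sup_left
    have h3 := Submodule.finrank_mono h2
    rw [LinearMap.BilinForm.finrank_orthogonal hnd, Module.finrank_pi] at h3
    have h4 := Submodule.finrank_sup_add_finrank_inf_eq W I'
    have h5 := LinearMap.finrank_range_add_finrank_ker (pr.domRestrict J0)
    have h6 : Module.finrank K (LinearMap.ker (pr.domRestrict J0)) ≤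
        Module.finrank K ↥(W ⊓ I') := by
      rw [(Submodule.equivMapOfInjective J0.subtype (Submodule.subtype_injective _) _).finrank_eq]
      apply Submodule.finrank_mono
      rintro _ ⟨⟨x, hx⟩, hx0, rfl⟩
      refine ⟨hx.1, x ∘ Sum.inr, hJ0mem x hx, ?_⟩
      have hx0' : pr x = 0 := hx0
      ext (i | i)
      · exact (congrFun hx0' i).symm
      · rfl
    have h7 : LinearMap.range (pr.domRestrict J0) = J0.map pr := LinearMap.range_domRestrict J0 pr
    rw [h7] at h5
    have h8 := Submodule.finrank_le (W ⊔ I')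
    rw [Module.finrank_pi] at h8
    rw [Fintype.card_sum] at *
    omega

end Field

section WittGroup

variable {K : Type*} [Field K]

theorem exists_equiv_of_map_univ_eq {ι κ α : Type*} [Fintype ι] [Fintype κ] {a : ι → α} {b : κ → α}
    (h : Finset.univ.val.map a = Finset.univ.val.map b) : ∃ e : ι ≃ κ, ∀ i, b (e i) = a i := by
  classical
  have hc : ∀ k, Nonempty ({i // a i = k} ≃ {j // b j = k}) := by
    intro k
    refine ⟨Fintype.equivOfCardEq ?_⟩
    have := congrArg (Multiset.count k) h
    rw [Multiset.count_map, Multiset.count_map] at this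
    rw [Fintype.card_subtype, Fintype.card_subtype]
    simp only [Finset.card, Finset.filter_val]
    simpa only [eq_comm (a := k)] using this
  let e := fun k => (hc k).some
  refine ⟨(Equiv.sigmaFiberEquiv a).symm.trans
    ((Equiv.sigmaCongrRight e).trans (Equiv.sigmaFiberEquiv b)), fun i => ?_⟩
  exact (e (a i) ⟨i, rfl⟩).2

/-- A multiset of units whose diagonal form is neutral. -/
def NeutM (s : Multiset Kˣ) : Prop :=
  ∃ (n : ℕ) (a : Fin n → Kˣ), Finset.univ.val.map a = s ∧
    Neutral (diagonal fun i => (a i : K))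

theorem neutM_iff {ι : Type*} [Fintype ι] [DecidableEq ι] (a : ι → Kˣ) :
    NeutM (Finset.univ.val.map a) ↔ Neutral (diagonal fun i => (a i : K)) := by
  constructor
  · rintro ⟨n, b, hb, hN⟩
    obtain ⟨e, he⟩ := exists_equiv_of_map_univ_eq hb
    have := hN.cong (Cong.of_equiv e.symm _)
    rw [submatrix_diagonal_equiv] at this
    convert this using 2
    ext i
    simp [← he]
  · intro hN
    refine ⟨Fintype.card ι, a ∘ (Fintype.equivFin ι).symm, ?_, ?_⟩
    · rw [← Multiset.map_map, Multiset.map_univ_val_equiv]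
    · have := hN.cong (Cong.of_equiv (Fintype.equivFin ι).symm _)
      rw [submatrix_diagonal_equiv] at this
      exact this

theorem exists_map_univ (s : Multiset Kˣ) :
    ∃ (n : ℕ) (a : Fin n → Kˣ), Finset.univ.val.map a = s := by
  induction s using Quotient.inductionOn with
  | h l => exact ⟨l.length, l.get, by
      rw [Fin.univ_val_map, List.ofFn_get]; rfl⟩

theorem map_univ_sumElim {α : Type*} {n m : ℕ} (a : Fin n → α) (b : Fin m → α) :
    (Finset.univ : Finset (Fin n ⊕ Fin m)).val.map (Sum.elim a b) =
      Finset.univ.val.map a + Finset.univ.val.map b := by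
  rw [← Finset.univ_disjSum_univ, Finset.val_disjSum, Multiset.disjSum, Multiset.map_add,
    Multiset.map_map, Multiset.map_map]
  rfl

theorem orthSum_diagonal {ι κ : Type*} [DecidableEq ι] [DecidableEq κ] [Fintype ι] [Fintype κ]
    (a : ι → K) (b : κ → K) :
    orthSum (diagonal a) (diagonal b) = diagonal (Sum.elim a b) :=
  fromBlocks_diagonal a b

theorem neutM_add_iff {n m : ℕ} (a : Fin n → Kˣ) (b : Fin m → Kˣ) :
    NeutM (Finset.univ.val.map a + Finset.univ.val.map b) ↔
      Neutral (orthSum (diagonal fun i => (a i : K)) (diagonal fun i => (b i : K))) := by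
  rw [← map_univ_sumElim, neutM_iff, orthSum_diagonal]
  have : (fun i => ((Sum.elim a b i : Kˣ) : K)) =
      Sum.elim (fun i => (a i : K)) (fun i => (b i : K)) := by
    ext (i | i) <;> rfl
  rw [this]

theorem NeutM.add {s t : Multiset Kˣ} (hs : NeutM s) (ht : NeutM t) : NeutM (s + t) := by
  obtain ⟨n, a, rfl, ha⟩ := hs
  obtain ⟨m, b, rfl, hb⟩ := ht
  exact (neutM_add_iff a b).2 (Neutral.add ha hb)

theorem det_diagonal_units_ne_zero {n : ℕ} (a : Fin n → Kˣ) :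
    (diagonal fun i => (a i : K)).det ≠ 0 := by
  rw [det_diagonal]
  exact Finset.prod_ne_zero_iff.2 fun i _ => (a i).ne_zero

theorem NeutM.cancel {s t : Multiset Kˣ} (hst : NeutM (s + t)) (ht : NeutM t) : NeutM s := by
  obtain ⟨n, a, rfl⟩ := exists_map_univ s
  obtain ⟨m, b, rfl⟩ := exists_map_univ t
  rw [neutM_add_iff] at hst
  rw [neutM_iff] at ht ⊢
  exact Neutral.cancel (isSymm_diagonal _) (isSymm_diagonal _) (det_diagonal_units_ne_zero a)
    (det_diagonal_units_ne_zero b) hst ht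

theorem NeutM.neg {s : Multiset Kˣ} (hs : NeutM s) : NeutM (s.map Neg.neg) := by
  obtain ⟨n, a, rfl, ha⟩ := hs
  rw [Multiset.map_map, neutM_iff]
  have := ha.neg
  rw [diagonal_neg] at this
  exact this

theorem neutM_add_neg (s : Multiset Kˣ) : NeutM (s + s.map Neg.neg) := by
  obtain ⟨n, a, rfl⟩ := exists_map_univ s
  rw [Multiset.map_map, neutM_add_iff]
  have := neutral_orthSum_neg (diagonal fun i => (a i : K))
  rw [diagonal_neg] at this
  exact this

theorem map_neg_neg (s : Multiset Kˣ) : (s.map Neg.neg).map Neg.neg = s := by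
  rw [Multiset.map_map]
  simp

variable (K) in
/-- Witt equivalence of diagonal forms. -/
def wittCon : AddCon (Multiset Kˣ) where
  r s t := NeutM (s + t.map Neg.neg)
  iseqv :=
    { refl := neutM_add_neg
      symm := by
        intro s t h
        have := h.neg
        rw [Multiset.map_add, map_neg_neg, add_comm] at this
        exact this
      trans := by
        intro s t u h h'
        refine NeutM.cancel (t := t + t.map Neg.neg) ?_ (neutM_add_neg t)
        convert h.add h' using 1
        abel }
  add' := by
    intro s t u v h h'
    have := NeutM.add h h'
    rw [Multiset.map_add]
    convert this using 1
    abel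

variable (K) in
/-- The Witt group of diagonal forms over `K`. -/
def WittGroup := (wittCon K).Quotient

instance : AddCommMonoid (WittGroup K) := inferInstanceAs (AddCommMonoid (wittCon K).Quotient)

/-- The class of a multiset of units. -/
def wittMk : Multiset Kˣ →+ WittGroup K := (wittCon K).mk'

theorem wittMk_eq_iff {s t : Multiset Kˣ} : wittMk s = wittMk t ↔ NeutM (s + t.map Neg.neg) :=
  (wittCon K).eq

theorem wittMk_surjective : Function.Surjective (wittMk (K := K)) :=
  AddCon.mk'_surjective

instance : Neg (WittGroup K) where
  neg := Quotient.map' (fun s => s.map Neg.neg) (by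
    intro s t h
    have := NeutM.neg h
    rw [Multiset.map_add] at this
    exact this)

theorem wittMk_neg (s : Multiset Kˣ) : -wittMk s = wittMk (s.map Neg.neg) := rfl

instance : AddCommGroup (WittGroup K) :=
  { (inferInstance : AddCommMonoid (WittGroup K)),
    (inferInstance : Neg (WittGroup K)) with
    zsmul := zsmulRec
    neg_add_cancel := by
      intro w
      obtain ⟨s, rfl⟩ := wittMk_surjective w
      rw [wittMk_neg, ← map_add, ← map_zero wittMk, wittMk_eq_iff]
      simpa [add_comm] using neutM_add_neg s }

open Classical in
/-- The class of a rank one form; zero for the degenerate form. -/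
noncomputable def wcl (a : K) : WittGroup K :=
  if h : a = 0 then 0 else wittMk {Units.mk0 a h}

@[simp] theorem wcl_zero : wcl (0 : K) = 0 := by simp [wcl]

theorem sum_wcl_eq_zero_iff {ι : Type*} [Fintype ι] [DecidableEq ι] {a : ι → K}
    (ha : ∀ i, a i ≠ 0) : ∑ i, wcl (a i) = 0 ↔ Neutral (diagonal a) := by
  have h1 : ∀ i, wcl (a i) = wittMk {Units.mk0 (a i) (ha i)} := fun i => by simp [wcl, ha i]
  simp_rw [h1]
  rw [← map_sum, ← map_zero wittMk, wittMk_eq_iff]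
  have h2 : (∑ i, {Units.mk0 (a i) (ha i)} : Multiset Kˣ) =
      Finset.univ.val.map fun i => Units.mk0 (a i) (ha i) := by
    rw [Finset.sum, ← Multiset.sum_map_singleton
      (Finset.univ.val.map fun i => Units.mk0 (a i) (ha i)),
      Multiset.map_map]
    rfl
  rw [h2, Multiset.map_zero, add_zero, neutM_iff]
  rfl

theorem wcl_add_neg (a : K) : wcl a + wcl (-a) = 0 := by
  by_cases ha : a = 0
  · simp [ha]
  have := (sum_wcl_eq_zero_iff (a := ![a, -a]) (by
    intro i; fin_cases i <;> simp [ha])).2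
    ⟨1, !![1; 1], !![1, 0], by ext i j; fin_cases i; fin_cases j; simp [Matrix.mul_apply], by
      ext i j; fin_cases i; fin_cases j
      simp [Matrix.mul_apply, Fin.sum_univ_two, diagonal], by simp⟩
  simpa using this

theorem wcl_neg (a : K) : wcl (-a) = -wcl a :=
  eq_neg_of_add_eq_zero_right (wcl_add_neg a)

/-- The relations satisfied by the classes of rank one forms in the Witt group. -/
structure IsWittFun {G : Type*} [AddCommGroup G] (ψ : K → G) : Prop where
  zero : ψ 0 = 0
  sq : ∀ a b, b ≠ 0 → ψ (a * b ^ 2) = ψ a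
  add : ∀ a b, ψ a + ψ b = ψ (a + b) + ψ (a * b * (a + b))

theorem IsWittFun.neg {G : Type*} [AddCommGroup G] {ψ : K → G} (h : IsWittFun ψ) (a : K) :
    ψ (-a) = -ψ a := by
  have := h.add a (-a)
  simp only [add_neg_cancel, mul_zero, h.zero, add_zero] at this
  exact eq_neg_of_add_eq_zero_right this

theorem isWittFun_wcl : IsWittFun (wcl (K := K)) where
  zero := wcl_zero
  sq a b hb := by
    by_cases ha : a = 0
    · simp [ha]
    have := (sum_wcl_eq_zero_iff (a := ![a * b ^ 2, -a]) (by
      intro i; fin_cases i <;> simp [ha, hb])).2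
      ⟨1, !![1; b], !![1, 0], by ext i j; fin_cases i; fin_cases j; simp [Matrix.mul_apply], by
        ext i j; fin_cases i; fin_cases j
        simp [Matrix.mul_apply, Fin.sum_univ_two, diagonal]; ring, by simp⟩
    simp only [Fin.sum_univ_two, Matrix.cons_val_zero, Matrix.cons_val_one, wcl_neg] at this
    exact add_neg_eq_zero.1 this
  add a b := by
    by_cases ha : a = 0
    · simp [ha]
    by_cases hb : b = 0
    · simp [hb]
    by_cases hab : a + b = 0
    · rw [eq_neg_of_add_eq_zero_right hab]
      simp [wcl_add_neg]
    have := (sum_wcl_eq_zero_iff (a := ![a, b, -(a + b), -(a * b * (a + b))]) (by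
      intro i; fin_cases i
      · simpa using ha
      · simpa using hb
      · simpa [-neg_add_rev] using hab
      · simp [ha, hb, hab])).2
      ⟨2, !![1, b; 1, -a; 1, 0; 0, 1], !![0, 0, 1, 0; 0, 0, 0, 1], by
        ext i j; fin_cases i <;> fin_cases j <;> simp [Matrix.mul_apply, Fin.sum_univ_four], by
        ext i j; fin_cases i <;> fin_cases j <;>
          simp [Matrix.mul_apply, Fin.sum_univ_four, diagonal] <;> ring, by simp⟩
    simp only [Fin.sum_univ_four, Matrix.cons_val_zero, Matrix.cons_val_one, Matrix.cons_val,
      wcl_neg] at this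
    rw [← sub_eq_zero, ← this]
    abel

/-- Every symmetric matrix is congruent to a diagonal one. -/
theorem exists_cong_diagonal [Invertible (2 : K)] {ι : Type*} [Fintype ι] [DecidableEq ι]
    {G : Matrix ι ι K} (hG : G.IsSymm) : ∃ a : ι → K, Cong G (diagonal a) := by
  have hsymm : LinearMap.IsSymm (Matrix.toBilin' G) := by
    refine ⟨fun x y => ?_⟩
    rw [Matrix.toBilin'_apply', Matrix.toBilin'_apply']
    rw [dotProduct_mulVec, dotProduct_comm, ← mulVec_transpose, hG.eq, RingHom.id_apply]
  obtain ⟨v, hv⟩ := LinearMap.BilinForm.exists_orthogonal_basis hsymm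
  have e : Fin (Module.finrank K (ι → K)) ≃ ι := Fintype.equivOfCardEq (by simp)
  let w := v.reindex e
  refine ⟨fun i => (Matrix.toBilin' G) (w i) (w i), (Pi.basisFun K ι).toMatrix w,
    w.toMatrix (Pi.basisFun K ι), ?_, ?_, ?_⟩
  · exact Module.Basis.toMatrix_mul_toMatrix_flip _ _
  · exact Module.Basis.toMatrix_mul_toMatrix_flip _ _
  · have h := LinearMap.BilinForm.toMatrix_mul_basis_toMatrix (b := Pi.basisFun K ι) w
      (Matrix.toBilin' G)
    have h2 : LinearMap.BilinForm.toMatrix (Pi.basisFun K ι) (Matrix.toBilin' G) = G := by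
      rw [LinearMap.BilinForm.toMatrix_basisFun, LinearMap.BilinForm.toMatrix'_toBilin']
    rw [h2] at h
    rw [h]
    ext i j
    rw [LinearMap.BilinForm.toMatrix_apply, diagonal_apply]
    split_ifs with hij
    · rw [hij]
    · have := hv (i := e.symm i) (j := e.symm j) (by simpa using hij)
      simpa [w] using this

/-- `w` is the Witt class of the Gram matrix `G`. -/
def HasClass {ι : Type*} [Fintype ι] [DecidableEq ι] (G : Matrix ι ι K) (w : WittGroup K) : Prop :=
  ∃ a : ι → K, (∀ i, a i ≠ 0) ∧ Cong G (diagonal a) ∧ ∑ i, wcl (a i) = w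

theorem exists_hasClass [Invertible (2 : K)] {ι : Type*} [Fintype ι] [DecidableEq ι]
    {G : Matrix ι ι K} (hG : G.IsSymm) (hd : G.det ≠ 0) : ∃ w, HasClass G w := by
  obtain ⟨a, ha⟩ := exists_cong_diagonal hG
  have := ha.isUnit_det (isUnit_iff_ne_zero.2 hd)
  rw [det_diagonal, isUnit_iff_ne_zero, Finset.prod_ne_zero_iff] at this
  exact ⟨_, a, fun i => this i (Finset.mem_univ i), ha, rfl⟩

theorem hasClass_diagonal {ι : Type*} [Fintype ι] [DecidableEq ι] {a : ι → K}
    (ha : ∀ i, a i ≠ 0) : HasClass (diagonal a) (∑ i, wcl (a i)) :=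
  ⟨a, ha, Cong.refl _, rfl⟩

section

variable {ι κ : Type*} [Fintype ι] [DecidableEq ι] [Fintype κ] [DecidableEq κ]
  {G : Matrix ι ι K} {H : Matrix κ κ K} {w w' : WittGroup K}

theorem HasClass.neg (h : HasClass G w) : HasClass (-G) (-w) := by
  obtain ⟨a, ha, hc, rfl⟩ := h
  refine ⟨fun i => -a i, fun i => neg_ne_zero.2 (ha i), ?_, ?_⟩
  · have := hc.neg
    rwa [diagonal_neg] at this
  · simp [wcl_neg]

theorem HasClass.add (h : HasClass G w) (h' : HasClass H w') :
    HasClass (orthSum G H) (w + w') := by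
  obtain ⟨a, ha, hc, rfl⟩ := h
  obtain ⟨b, hb, hc', rfl⟩ := h'
  refine ⟨Sum.elim a b, ?_, ?_, ?_⟩
  · rintro (i | i)
    · exact ha i
    · exact hb i
  · have := Cong.add hc hc'
    rwa [orthSum_diagonal] at this
  · simp

theorem HasClass.eq_zero_iff (h : HasClass G w) : w = 0 ↔ Neutral G := by
  obtain ⟨a, ha, hc, rfl⟩ := h
  rw [sum_wcl_eq_zero_iff ha]
  exact ⟨fun h => h.cong hc.symm, fun h => h.cong hc⟩

theorem HasClass.eq_iff (h : HasClass G w) (h' : HasClass H w') :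
    w = w' ↔ Neutral (orthSum G (-H)) := by
  rw [← (h.add h'.neg).eq_zero_iff, ← sub_eq_add_neg, sub_eq_zero]

end

end WittGroup

section

variable {K : Type*} [Field K] {ι : Type*} [Fintype ι] [DecidableEq ι]

theorem Neutral.exists_card_eq {G : Matrix ι ι K} (h : Neutral G) (hd : G.det ≠ 0) :
    ∃ n, Fintype.card ι = 2 * n := by
  obtain ⟨W, hW, hc⟩ := h.exists_submodule
  exact ⟨_, le_antisymm hc (two_mul_finrank_le hd hW)⟩

theorem Neutral.exists_isotropic {G : Matrix ι ι K} (h : Neutral G) (hι : 0 < Fintype.card ι) :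
    ∃ x ≠ 0, x ⬝ᵥ G *ᵥ x = 0 := by
  obtain ⟨W, hW, hc⟩ := h.exists_submodule
  have : 0 < Module.finrank K W := by omega
  obtain ⟨x, hx⟩ := Module.finrank_pos_iff_exists_ne_zero.1 this
  exact ⟨x, by simpa using hx, hW x x.2 x x.2⟩

theorem multiset_sum_wcl_eq_zero_iff (s : Multiset K) (hs : (0 : K) ∉ s) :
    ∃ (n : ℕ) (a : Fin n → K), (∀ i, a i ≠ 0) ∧ Finset.univ.val.map a = s ∧
      ((s.map wcl).sum = 0 ↔ Neutral (diagonal a)) := by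
  obtain ⟨l, rfl⟩ := Quot.exists_rep s
  have hl : Finset.univ.val.map l.get = (l : Multiset K) := by
    rw [Fin.univ_val_map, List.ofFn_get]
  have h0 : ∀ i, l.get i ≠ 0 := fun i h => hs (by
    rw [← h]; exact List.get_mem l i)
  refine ⟨l.length, l.get, h0, hl, ?_⟩
  rw [← sum_wcl_eq_zero_iff h0]
  change ((l : Multiset K).map wcl).sum = 0 ↔ _
  rw [← hl, Multiset.map_map]
  rfl

end

section FiniteField

variable {F : Type} [Field F] [Fintype F]

theorem exists_sq_add_sq_eq (u v w : F) (hu : u ≠ 0) (hv : v ≠ 0) :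
    ∃ x y : F, u * x ^ 2 + v * y ^ 2 = w := by
  by_cases h2 : ringChar F = 2
  · obtain ⟨x, hx⟩ := FiniteField.isSquare_of_char_two h2 (w / u)
    refine ⟨x, 0, ?_⟩
    rw [sq, ← hx]
    field_simp
    ring
  · have hodd := FiniteField.odd_card_of_char_ne_two h2
    open Polynomial in
    obtain ⟨x, y, h⟩ := FiniteField.exists_root_sum_quadratic
      (f := (C u * X ^ 2 + C 0 * X + C (-w) : F[X])) (g := (C v * X ^ 2 + C 0 * X + C 0 : F[X]))
      (Polynomial.degree_quadratic hu) (Polynomial.degree_quadratic hv) hodd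
    refine ⟨x, y, ?_⟩
    simp at h
    linear_combination h

theorem exists_ternary_reduction {u v w : F} (hu : u ≠ 0) (hv : v ≠ 0) (hw : w ≠ 0) :
    ∃ t c : F, t ≠ 0 ∧ c ≠ 0 ∧ u * v * w = -t * c ^ 2 ∧
      ∀ {G : Type} [AddCommGroup G] (ψ : F → G), IsWittFun ψ → ψ u + ψ v + ψ w = ψ t := by
  obtain ⟨x, y, h⟩ := exists_sq_add_sq_eq u v (-w) hu hv
  by_cases hx : x = 0
  · have hy : y ≠ 0 := by
      rintro rfl
      apply hw; simpa [hx] using h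
    refine ⟨u, v * y, hu, mul_ne_zero hv hy, ?_, fun ψ hψ => ?_⟩
    · rw [hx] at h; linear_combination (u * v) * h
    · have : ψ (-w) = ψ v := by rw [← hψ.sq v y hy, ← h, hx]; simp
      rw [hψ.neg] at this
      rw [← this]; abel
  by_cases hy : y = 0
  · refine ⟨v, u * x, hv, mul_ne_zero hu hx, ?_, fun ψ hψ => ?_⟩
    · rw [hy] at h; linear_combination (u * v) * h
    · have : ψ (-w) = ψ u := by rw [← hψ.sq u x hx, ← h, hy]; simp
      rw [hψ.neg] at this
      rw [← this]; abel
  refine ⟨-(u * x ^ 2) * (v * y ^ 2) * w, (x * y)⁻¹, by simp [hu, hv, hw, hx, hy],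
    by simp [hx, hy], ?_, fun ψ hψ => ?_⟩
  · field_simp
  · have := hψ.add (u * x ^ 2) (v * y ^ 2)
    rw [hψ.sq _ _ hx, hψ.sq _ _ hy, h, hψ.neg] at this
    rw [this]
    have e : u * x ^ 2 * (v * y ^ 2) * -w = -(u * x ^ 2) * (v * y ^ 2) * w := by ring
    rw [e]; abel

theorem exists_multiset_reduction (s : Multiset F) (hc : 3 ≤ s.card) (hs : (0 : F) ∉ s) :
    ∃ t : Multiset F, t.card + 2 = s.card ∧ (0 : F) ∉ t ∧
      (∃ c : F, c ≠ 0 ∧ s.prod = -t.prod * c ^ 2) ∧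
      ∀ {G : Type} [AddCommGroup G] (ψ : F → G), IsWittFun ψ →
        (s.map ψ).sum = (t.map ψ).sum := by
  obtain ⟨u, v, w, s, rfl⟩ : ∃ u v w s', s = {u, v, w} + s' := by
    induction s using Quotient.inductionOn with
    | h l =>
      rcases l with _ | ⟨u, _ | ⟨v, _ | ⟨w, l⟩⟩⟩
      · simp at hc
      · simp at hc
      · simp at hc
      · exact ⟨u, v, w, l, rfl⟩
  simp only [Multiset.mem_add, Multiset.insert_eq_cons, Multiset.mem_cons, Multiset.mem_singleton,
    not_or] at hs
  obtain ⟨⟨hu, hv, hw⟩, hs⟩ := hs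
  obtain ⟨t, c, ht, hc, h, hψ⟩ := exists_ternary_reduction (Ne.symm hu) (Ne.symm hv) (Ne.symm hw)
  refine ⟨t ::ₘ s, ?_, ?_, ⟨c, hc, ?_⟩, fun ψ hf => ?_⟩
  · simp
  · simp [hs, Ne.symm ht]
  · simp only [Multiset.insert_eq_cons, Multiset.prod_add, Multiset.prod_cons,
      Multiset.prod_singleton]
    linear_combination s.prod * h
  · simp only [Multiset.insert_eq_cons, Multiset.map_add, Multiset.map_cons, Multiset.map_singleton,
      Multiset.sum_add, Multiset.sum_cons, Multiset.sum_singleton, ← hψ ψ hf]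
    abel

theorem multiset_sum_eq_zero {G : Type} [AddCommGroup G] {ψ : F → G} (hψ : IsWittFun ψ) (n : ℕ) :
    ∀ s : Multiset F, s.card = n → (0 : F) ∉ s → (s.map wcl).sum = 0 → (s.map ψ).sum = 0 := by
  induction n using Nat.strong_induction_on with
  | h n ih =>
    intro s hn hs h
    obtain ⟨m, a, ha0, ha, hN⟩ := multiset_sum_wcl_eq_zero_iff s hs
    rw [hN] at h
    have hdet : (diagonal a).det ≠ 0 := by
      rw [det_diagonal]; exact Finset.prod_ne_zero_iff.2 fun i _ => ha0 i
    obtain ⟨k, hk⟩ := h.exists_card_eq hdet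
    have hmn : m = n := by rw [← hn, ← ha]; simp
    subst hmn
    rcases m with _ | _ | _ | m
    · rw [Multiset.card_eq_zero.1 hn]; simp
    · simp at hk; omega
    · obtain ⟨x, hx0, hx⟩ := h.exists_isotropic (by simp)
      rw [← ha]
      simp [Matrix.mulVec, dotProduct, diagonal, Fin.sum_univ_two] at hx
      have e0 : x 0 ≠ 0 := by
        intro h0
        have h1 : x 1 = 0 := by simpa [h0, ha0 1] using hx
        apply hx0; ext i; fin_cases i <;> simp [h0, h1]
      have e1 : x 1 ≠ 0 := by
        intro h0
        have h1 : x 0 = 0 := by simpa [h0, ha0 0] using hx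
        exact e0 h1
      have e3 : a 0 * x 0 ^ 2 = -(a 1 * x 1 ^ 2) := by linear_combination hx
      have e4 := hψ.sq (a 0) (x 0) e0
      rw [e3, hψ.neg, hψ.sq _ _ e1] at e4
      rw [Multiset.map_map]
      change ∑ i, ψ (a i) = 0
      rw [Fin.sum_univ_two, ← e4]; simp
    · obtain ⟨t, ht, ht0, -, hψt⟩ := exists_multiset_reduction s (by omega) hs
      rw [hψt _ hψ]
      rw [← hN, hψt _ isWittFun_wcl] at h
      exact ih _ (by omega) t rfl ht0 h

/-- Every function on a finite field satisfying the Witt relations factors through the Witt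
group. -/
theorem IsWittFun.sum_eq_zero {G : Type} [AddCommGroup G] {ψ : F → G} (hψ : IsWittFun ψ)
    {ι : Type*} [Fintype ι] [DecidableEq ι] {a : ι → F} (ha : ∀ i, a i ≠ 0)
    (h : Neutral (diagonal a)) : ∑ i, ψ (a i) = 0 := by
  have h1 := multiset_sum_eq_zero hψ _ (Finset.univ.val.map a) rfl (by simpa using ha) (by
    rw [Multiset.map_map]
    exact (sum_wcl_eq_zero_iff ha).2 h)
  rwa [Multiset.map_map] at h1

theorem multiset_sum_wcl_eq_zero (n : ℕ) : ∀ s : Multiset F, s.card = 2 * n → (0 : F) ∉ s →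
    IsSquare ((-1) ^ n * s.prod) → (s.map wcl).sum = 0 := by
  induction n with
  | zero => intro s hs _ _; rw [Multiset.card_eq_zero.1 hs]; simp
  | succ n ih =>
    intro s hs h0 hsq
    rcases n with _ | n
    · obtain ⟨u, v, rfl⟩ := Multiset.card_eq_two.1 hs
      obtain ⟨c, hc⟩ := hsq
      simp only [Multiset.insert_eq_cons, Multiset.mem_cons, Multiset.mem_singleton, not_or] at h0
      simp only [Multiset.insert_eq_cons, Multiset.prod_cons, Multiset.prod_singleton] at hc
      have hc0 : c ≠ 0 := by
        rintro rfl
        rw [zero_mul, mul_eq_zero, mul_eq_zero] at hc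
        rcases hc with hc | hc | hc
        · simp at hc
        · exact h0.1 hc.symm
        · exact h0.2 hc.symm
      have h1 := isWittFun_wcl.sq v u (Ne.symm h0.1)
      have h2 := isWittFun_wcl.sq (-u) c hc0
      have h3 : v * u ^ 2 = -u * c ^ 2 := by linear_combination -u * hc
      rw [h3, h2, wcl_neg] at h1
      simp [← h1]
    · obtain ⟨t, ht, ht0, ⟨c, hc, hprod⟩, hψt⟩ := exists_multiset_reduction s (by omega) h0
      rw [hψt _ isWittFun_wcl]
      refine ih t (by omega) ht0 ?_
      obtain ⟨d, hd⟩ := hsq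
      refine ⟨d / c, ?_⟩
      field_simp
      rw [hprod] at hd
      linear_combination hd

theorem neutral_of_isSquare [Invertible (2 : F)] {ι : Type*} [Fintype ι] [DecidableEq ι]
    {G : Matrix ι ι F} (hG : G.IsSymm) (hd : G.det ≠ 0) {n : ℕ} (hn : Fintype.card ι = 2 * n)
    (hsq : IsSquare ((-1) ^ n * G.det)) : Neutral G := by
  obtain ⟨a, ha⟩ := exists_cong_diagonal hG
  have hda := ha.isUnit_det (isUnit_iff_ne_zero.2 hd)
  rw [det_diagonal, isUnit_iff_ne_zero, Finset.prod_ne_zero_iff] at hda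
  have h0 : ∀ i, a i ≠ 0 := fun i => hda i (Finset.mem_univ i)
  refine Neutral.cong ?_ ha.symm
  rw [← sum_wcl_eq_zero_iff h0]
  have h1 := multiset_sum_wcl_eq_zero n (Finset.univ.val.map a) (by simpa using hn)
    (by simpa using h0) ?_
  · rwa [Multiset.map_map] at h1
  · obtain ⟨P, S, -, -, hP⟩ := ha
    have := congrArg det hP
    rw [det_mul, det_mul, det_transpose, det_diagonal] at this
    change IsSquare ((-1) ^ n * ∏ i, a i)
    obtain ⟨d, hd⟩ := hsq
    exact ⟨d * P.det, by rw [← this]; linear_combination P.det ^ 2 * hd⟩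

end FiniteField

section Saturation

variable {ι : Type*} [Fintype ι] [DecidableEq ι]

theorem exists_nat_mul_eq_intCast (x : ι → ℚ) :
    ∃ N : ℤ, N ≠ 0 ∧ ∃ y : ι → ℤ, ∀ i, N * x i = y i := by
  refine ⟨∏ i, (x i).den, Finset.prod_ne_zero_iff.2 fun i _ => by simp, ?_⟩
  have : ∀ i, ∃ y : ℤ, ((∏ i, ((x i).den : ℤ) : ℤ) : ℚ) * x i = y := by
    intro i
    refine ⟨(∏ j ∈ Finset.univ.erase i, ((x j).den : ℤ)) * (x i).num, ?_⟩
    rw [← Finset.mul_prod_erase _ _ (Finset.mem_univ i)]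
    push_cast
    have := Rat.mul_den_eq_num (x i)
    rw [← this]; ring
  choose y hy using this
  exact ⟨y, hy⟩

/-- A submodule with torsion-free quotient splits. -/
theorem exists_retraction {M : Type*} [AddCommGroup M] [Module.Finite ℤ M] (Λ : Submodule ℤ M)
    (h : ∀ (n : ℤ) (x : M), n ≠ 0 → n • x ∈ Λ → x ∈ Λ) :
    ∃ g : M →ₗ[ℤ] Λ, ∀ x : Λ, g x = x := by
  have htf : Module.IsTorsionFree ℤ (M ⧸ Λ) := by
    refine Module.IsTorsionFree.of_smul_eq_zero ?_
    intro n x hx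
    obtain ⟨x, rfl⟩ := Λ.mkQ_surjective x
    by_cases hn : n = 0
    · exact Or.inl hn
    · right
      rw [← map_smul, Submodule.mkQ_apply, Submodule.Quotient.mk_eq_zero] at hx
      rw [Submodule.mkQ_apply, Submodule.Quotient.mk_eq_zero]
      exact h n x hn hx
  obtain ⟨s, hs⟩ := Module.projective_lifting_property Λ.mkQ LinearMap.id Λ.mkQ_surjective
  refine ⟨LinearMap.codRestrict Λ (LinearMap.id - s ∘ₗ Λ.mkQ) fun x => ?_, fun x => ?_⟩
  · rw [← Submodule.Quotient.mk_eq_zero, ← Submodule.mkQ_apply]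
    have := LinearMap.congr_fun hs (Λ.mkQ x)
    simp only [LinearMap.comp_apply, LinearMap.id_apply] at this
    simp only [LinearMap.sub_apply, LinearMap.comp_apply, LinearMap.id_apply, map_sub, this,
      sub_self]
  · ext
    have : Λ.mkQ x = 0 := by simp
    simp [this]

/-- A form over `ℤ` which is neutral over `ℚ` is neutral over `ℤ`. -/
theorem Neutral.of_rat {G : Matrix ι ι ℤ} (h : Neutral (G.map (Int.cast : ℤ → ℚ))) :
    Neutral G := by
  obtain ⟨W, hW, hc⟩ := h.exists_submodule
  let φ : (ι → ℤ) →ₗ[ℤ] (ι → ℚ) := (Int.castAddHom ℚ).toIntLinearMap.compLeft ι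
  have hφ : ∀ x i, φ x i = (x i : ℚ) := fun x i => rfl
  let Λ : Submodule ℤ (ι → ℤ) := (W.restrictScalars ℤ).comap φ
  have hΛ : ∀ x, x ∈ Λ ↔ φ x ∈ W := fun x => Iff.rfl
  obtain ⟨g, hg⟩ := exists_retraction Λ (by
    intro n x hn hx
    rw [hΛ] at hx ⊢
    have : φ (n • x) = (n : ℚ) • φ x := by
      ext i; simp [hφ]
    rw [this] at hx
    exact (W.smul_mem_iff (Int.cast_ne_zero.2 hn)).1 hx)
  let b := Module.Free.chooseBasis ℤ Λ
  refine Neutral.of_fintype (κ := Module.Free.ChooseBasisIndex ℤ Λ)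
    (Matrix.of fun i j => (b j : ι → ℤ) i) (LinearMap.toMatrix' (b.equivFun.toLinearMap ∘ₗ g))
    ?_ ?_ ?_
  · have : (Matrix.of (fun i j => (b j : ι → ℤ) i)) =
        LinearMap.toMatrix' (Λ.subtype ∘ₗ b.equivFun.symm.toLinearMap) := by
      ext i j
      simp [LinearMap.toMatrix'_apply]
    rw [this, ← LinearMap.toMatrix'_comp]
    have e : (b.equivFun.toLinearMap ∘ₗ g) ∘ₗ (Λ.subtype ∘ₗ b.equivFun.symm.toLinearMap) =
        LinearMap.id := by
      ext i j
      simp [hg, Pi.single_apply, eq_comm]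
    rw [e]; simp
  · ext i j
    have := hW _ (b i).2 _ (b j).2
    simp only [Matrix.zero_apply]
    rw [← Int.cast_inj (α := ℚ), Int.cast_zero, ← this, Matrix.mul_assoc]
    simp [Matrix.mul_apply, dotProduct, Matrix.mulVec, hφ]
  · refine hc.trans (Nat.mul_le_mul_left 2 ?_)
    have hle : W ≤ Submodule.span ℚ (Set.range fun j => φ (b j)) := by
      intro x hx
      obtain ⟨N, hN, y, hy⟩ := exists_nat_mul_eq_intCast x
      have hyx : φ y = (N : ℚ) • x := by ext i; simp [hφ, hy]
      have hyΛ : y ∈ Λ := by rw [hΛ, hyx]; exact W.smul_mem _ hx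
      rw [← Submodule.smul_mem_iff _ (Int.cast_ne_zero.2 hN : (N : ℚ) ≠ 0), ← hyx]
      have h1 := b.sum_repr ⟨y, hyΛ⟩
      have h2 : y = ∑ j, b.repr ⟨y, hyΛ⟩ j • (b j : ι → ℤ) := by
        have h2 := congrArg Subtype.val h1
        rw [AddSubmonoidClass.coe_finsetSum] at h2
        exact h2.symm
      rw [h2, map_sum]
      refine Submodule.sum_mem _ fun j _ => ?_
      have h3 : φ (b.repr ⟨y, hyΛ⟩ j • (b j : ι → ℤ)) =
          ((b.repr ⟨y, hyΛ⟩ j : ℤ) : ℚ) • φ (b j) := by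
        ext i; simp [hφ]
      rw [h3]
      exact Submodule.smul_mem _ _ (Submodule.subset_span ⟨j, rfl⟩)
    exact (Submodule.finrank_mono hle).trans (finrank_range_le_card _)

end Saturation

section Residue

variable {μ κ : Type*} [Fintype μ] [Fintype κ] [DecidableEq μ] [DecidableEq κ]

theorem intCast_mulVec {q : ℕ} {ι : Type*} (P : Matrix ι κ ℤ) (x : κ → ℤ) (i : ι) :
    ((P *ᵥ x) i : ZMod q) = ((P.map (Int.castRingHom (ZMod q))) *ᵥ fun j => (x j : ZMod q)) i := by
  simp [Matrix.mulVec, dotProduct]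

theorem exists_lagrangian_residue {q : ℕ} [Fact q.Prime] {A : Matrix μ μ ℤ} (B : Matrix μ κ ℤ)
    (C : Matrix κ κ ℤ) (hq : ¬ (q : ℤ) ∣ A.det)
    (h : Neutral ((fromBlocks A ((q : ℤ) • B) ((q : ℤ) • Bᵀ) ((q : ℤ) • C)).map
      (Int.cast : ℤ → ℚ))) :
    ∃ I : Submodule (ZMod q) (κ → ZMod q), Fintype.card κ ≤ 2 * Module.finrank (ZMod q) I ∧
      ∃ (fx : I → μ → ℤ) (fy : I → κ → ℤ), (∀ v i, (fy v i : ZMod q) = v.1 i) ∧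
        ∀ v v', q * (fx v ⬝ᵥ A *ᵥ fx v') + q * (fx v ⬝ᵥ B *ᵥ fy v') +
          q * (fx v' ⬝ᵥ B *ᵥ fy v) + fy v ⬝ᵥ C *ᵥ fy v' = 0 := by
  obtain ⟨d, P, S, hSP, hP, hd⟩ := h.of_rat
  set P1 := P.toRows₁ with hP1
  set P2 := P.toRows₂ with hP2
  have hPP : P = fromRows P1 P2 := (fromRows_toRows P).symm
  have hval : ∀ n n' : Fin d → ℤ, (P1 *ᵥ n) ⬝ᵥ A *ᵥ (P1 *ᵥ n') +
      q * ((P1 *ᵥ n) ⬝ᵥ B *ᵥ (P2 *ᵥ n')) + q * ((P1 *ᵥ n') ⬝ᵥ B *ᵥ (P2 *ᵥ n)) +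
      q * ((P2 *ᵥ n) ⬝ᵥ C *ᵥ (P2 *ᵥ n')) = 0 := by
    intro n n'
    have h1 : (P *ᵥ n) ⬝ᵥ (fromBlocks A ((q : ℤ) • B) ((q : ℤ) • Bᵀ) ((q : ℤ) • C)) *ᵥ P *ᵥ n' =
        n ⬝ᵥ (Pᵀ * (fromBlocks A ((q : ℤ) • B) ((q : ℤ) • Bᵀ) ((q : ℤ) • C)) * P) *ᵥ n' := by
      rw [← vecMul_transpose, ← dotProduct_mulVec, mulVec_mulVec, mulVec_mulVec]
    rw [hP, zero_mulVec, dotProduct_zero, hPP, fromRows_mulVec, fromRows_mulVec,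
      fromBlocks_mulVec] at h1
    simp only [dotProduct_block, Sum.elim_comp_inl, Sum.elim_comp_inr, dotProduct_add,
      smul_mulVec, dotProduct_smul, smul_eq_mul] at h1
    have h2 : P2 *ᵥ n ⬝ᵥ Bᵀ *ᵥ P1 *ᵥ n' = (P1 *ᵥ n') ⬝ᵥ B *ᵥ (P2 *ᵥ n) := by
      rw [mulVec_transpose, dotProduct_comm, ← dotProduct_mulVec]
    rw [h2] at h1
    linear_combination h1
  let f := Int.castRingHom (ZMod q)
  let Q1 := (P1.map f).mulVecLin
  let Q2 := (P2.map f).mulVecLin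
  have hinj : ∀ n, Q1 n = 0 → Q2 n = 0 → n = 0 := by
    intro n h1 h2
    have h3 : (P.map f) *ᵥ n = 0 := by
      rw [hPP, fromRows_map, fromRows_mulVec]
      ext (i | i)
      · exact congrFun h1 i
      · exact congrFun h2 i
    have h4 : (S.map f) * (P.map f) = 1 := by
      rw [← Matrix.map_mul, hSP]; simp
    have h5 := congrArg (fun x => (S.map f) *ᵥ x) h3
    simpa [mulVec_mulVec, h4] using h5
  have hlift : ∀ n : Fin d → ZMod q, ∃ m : Fin d → ℤ, ∀ i, (m i : ZMod q) = n i := by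
    intro n
    choose m hm using fun i => ZMod.intCast_surjective (n i)
    exact ⟨m, hm⟩
  have hrank : 2 * Module.finrank (ZMod q) (LinearMap.range Q1) ≤ Fintype.card μ := by
    refine two_mul_finrank_le (G := A.map f) ?_ ?_
    · rw [← RingHom.mapMatrix_apply, ← RingHom.map_det]
      simpa [f, ZMod.intCast_zmod_eq_zero_iff_dvd] using
        (ZMod.intCast_zmod_eq_zero_iff_dvd A.det q).not.2 hq
    · rintro _ ⟨n, rfl⟩ _ ⟨n', rfl⟩
      obtain ⟨m, hm⟩ := hlift n
      obtain ⟨m', hm'⟩ := hlift n'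
      have h1 := congrArg (Int.cast : ℤ → ZMod q) (hval m m')
      simp only [Int.cast_add, Int.cast_mul, Int.cast_natCast, CharP.cast_eq_zero, zero_mul,
        add_zero, Int.cast_zero] at h1
      have e1 : (Q1 n) = fun i => ((P1 *ᵥ m) i : ZMod q) := by
        ext i; rw [intCast_mulVec]; simp only [hm]; rfl
      have e2 : (Q1 n') = fun i => ((P1 *ᵥ m') i : ZMod q) := by
        ext i; rw [intCast_mulVec]; simp only [hm']; rfl
      have e3 : A.map f *ᵥ (fun i => ((P1 *ᵥ m') i : ZMod q)) =
          fun i => ((A *ᵥ (P1 *ᵥ m')) i : ZMod q) := by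
        ext i; rw [intCast_mulVec]
      rw [e1, e2, e3, ← h1]
      simp [dotProduct]
  have hker := LinearMap.finrank_range_add_finrank_ker Q1
  rw [Module.finrank_pi, Fintype.card_fin] at hker
  let N := LinearMap.ker Q1
  refine ⟨N.map Q2, ?_, ?_⟩
  · have h1 : Module.finrank (ZMod q) (N.map Q2) = Module.finrank (ZMod q) N := by
      rw [← LinearMap.range_domRestrict]
      refine LinearMap.finrank_range_of_inj ?_
      rw [← LinearMap.ker_eq_bot, LinearMap.ker_eq_bot']
      rintro ⟨n, hn⟩ h
      ext1
      exact hinj n hn h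
    rw [h1]
    rw [Fintype.card_sum] at hd
    change _ ≤ 2 * Module.finrank (ZMod q) (LinearMap.ker Q1)
    omega
  · have hex : ∀ v : N.map Q2, ∃ (x : μ → ℤ) (m : Fin d → ℤ), P1 *ᵥ m = (q : ℤ) • x ∧
        ∀ i, ((P2 *ᵥ m) i : ZMod q) = v.1 i := by
      rintro ⟨_, n, hn, rfl⟩
      obtain ⟨m, hm⟩ := hlift n
      have h1 : ∀ i, (q : ℤ) ∣ (P1 *ᵥ m) i := by
        intro i
        rw [← ZMod.intCast_zmod_eq_zero_iff_dvd, intCast_mulVec]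
        simp only [hm]
        exact congrFun hn i
      choose x hx using h1
      refine ⟨x, m, ?_, fun i => ?_⟩
      · ext i; simp [hx]
      · rw [intCast_mulVec]
        simp only [hm]; rfl
    choose fx fm hfx hfm using hex
    refine ⟨fx, fun v => P2 *ᵥ fm v, hfm, fun v v' => ?_⟩
    have h1 := hval (fm v) (fm v')
    rw [hfx, hfx] at h1
    simp only [mulVec_smul, smul_dotProduct, dotProduct_smul, smul_eq_mul] at h1
    have hq0 : (q : ℤ) ≠ 0 := by exact_mod_cast (Fact.out : q.Prime).ne_zero
    apply mul_left_cancel₀ hq0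
    linear_combination h1

theorem neutral_residue {q : ℕ} [Fact q.Prime] {A : Matrix μ μ ℤ} (B : Matrix μ κ ℤ)
    (C : Matrix κ κ ℤ) (hq : ¬ (q : ℤ) ∣ A.det)
    (h : Neutral ((fromBlocks A ((q : ℤ) • B) ((q : ℤ) • Bᵀ) ((q : ℤ) • C)).map
      (Int.cast : ℤ → ℚ))) : Neutral (C.map (Int.cast : ℤ → ZMod q)) := by
  obtain ⟨I, hI, fx, fy, hf, h0⟩ := exists_lagrangian_residue B C hq h
  refine neutral_of_submodule I (fun v hv v' hv' => ?_) hI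
  have h1 := congrArg (Int.cast : ℤ → ZMod q) (h0 ⟨v, hv⟩ ⟨v', hv'⟩)
  simp only [Int.cast_add, Int.cast_mul, Int.cast_natCast, CharP.cast_eq_zero, zero_mul,
    zero_add, Int.cast_zero] at h1
  have e1 : v = fun i => (fy ⟨v, hv⟩ i : ZMod q) := by ext i; rw [hf]
  have e2 : v' = fun i => (fy ⟨v', hv'⟩ i : ZMod q) := by ext i; rw [hf]
  have e3 : C.map (Int.cast : ℤ → ZMod q) *ᵥ (fun i => (fy ⟨v', hv'⟩ i : ZMod q)) =
      fun i => ((C *ᵥ fy ⟨v', hv'⟩) i : ZMod q) := by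
    ext i; rw [intCast_mulVec]; rfl
  conv_lhs => rw [e1, e2]
  rw [e3, ← h1]
  simp [dotProduct]

end Residue

section HasRes

variable {ι κ ν τ : Type*} [Fintype ι] [Fintype κ] [DecidableEq ι] [DecidableEq κ]
  [Fintype ν] [Fintype τ] [DecidableEq ν] [DecidableEq τ]

/-- The rational form `X` has the residue form `C` modulo `q`. -/
def HasRes (q : ℕ) (X : Matrix ι ι ℚ) (C : Matrix κ κ ℤ) : Prop :=
  ∃ (μ : Type) (_ : Fintype μ) (_ : DecidableEq μ) (A : Matrix μ μ ℤ) (B : Matrix μ κ ℤ),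
    A.IsSymm ∧ C.IsSymm ∧ ¬ (q : ℤ) ∣ A.det ∧ ¬ (q : ℤ) ∣ C.det ∧
    Cong X ((fromBlocks A ((q : ℤ) • B) ((q : ℤ) • Bᵀ) ((q : ℤ) • C)).map (Int.cast : ℤ → ℚ))

theorem HasRes.cong {q : ℕ} {X : Matrix ι ι ℚ} {Y : Matrix ν ν ℚ} {C : Matrix κ κ ℤ}
    (h : HasRes q X C) (h' : Cong X Y) : HasRes q Y C := by
  obtain ⟨μ, _, _, A, B, hA, hC, hdA, hdC, hX⟩ := h
  exact ⟨μ, _, _, A, B, hA, hC, hdA, hdC, h'.symm.trans hX⟩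

theorem det_neg_dvd_iff {q : ℤ} (A : Matrix ι ι ℤ) : q ∣ (-A).det ↔ q ∣ A.det := by
  rw [det_neg]
  rcases neg_one_pow_eq_or ℤ (Fintype.card ι) with h | h <;> simp [h]

theorem HasRes.neg {q : ℕ} {X : Matrix ι ι ℚ} {C : Matrix κ κ ℤ}
    (h : HasRes q X C) : HasRes q (-X) (-C) := by
  obtain ⟨μ, _, _, A, B, hA, hC, hdA, hdC, hX⟩ := h
  refine ⟨μ, _, _, -A, -B, hA.neg, hC.neg, (det_neg_dvd_iff A).not.2 hdA,
    (det_neg_dvd_iff C).not.2 hdC, ?_⟩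
  convert hX.neg using 1
  ext (i | i) (j | j) <;> simp

theorem HasRes.add {q : ℕ} (hq : q.Prime) {X : Matrix ι ι ℚ} {C : Matrix κ κ ℤ} {Y : Matrix ν ν ℚ}
    {D : Matrix τ τ ℤ} (h : HasRes q X C) (h' : HasRes q Y D) :
    HasRes q (orthSum X Y) (orthSum C D) := by
  obtain ⟨μ, _, _, A, B, hA, hC, hdA, hdC, hX⟩ := h
  obtain ⟨μ', _, _, A', B', hA', hC', hdA', hdC', hX'⟩ := h'
  have hq' : Prime (q : ℤ) := Nat.prime_iff_prime_int.1 hq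
  refine ⟨μ ⊕ μ', inferInstance, inferInstance, orthSum A A', fromBlocks B 0 0 B',
    orthSum_isSymm hA hA', orthSum_isSymm hC hC', ?_, ?_, ?_⟩
  · rw [orthSum_det, hq'.dvd_mul]; tauto
  · rw [orthSum_det, hq'.dvd_mul]; tauto
  · refine (Cong.add hX hX').trans ?_
    have := Cong.of_equiv (Equiv.sumSumSumComm μ μ' κ τ)
      (orthSum ((fromBlocks A ((q : ℤ) • B) ((q : ℤ) • Bᵀ) ((q : ℤ) • C)).map (Int.cast : ℤ → ℚ))
        ((fromBlocks A' ((q : ℤ) • B') ((q : ℤ) • B'ᵀ) ((q : ℤ) • D)).map (Int.cast : ℤ → ℚ)))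
    convert this using 1
    ext ((i | i) | (i | i)) ((j | j) | (j | j)) <;>
      simp [orthSum, -natCast_zsmul, -nsmul_eq_mul, -zsmul_eq_mul]

theorem HasRes.neutral {q : ℕ} [Fact q.Prime] {X : Matrix ι ι ℚ} {C : Matrix κ κ ℤ}
    (h : HasRes q X C) (hX : Neutral X) : Neutral (C.map (Int.cast : ℤ → ZMod q)) := by
  obtain ⟨μ, _, _, A, B, hA, hC, hdA, hdC, hc⟩ := h
  exact neutral_residue B C hdA (hX.cong hc)

theorem hasRes_of_not_dvd {q : ℕ} (hq : q.Prime) {X : Matrix κ κ ℤ} {μ : Type} [Fintype μ]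
    [DecidableEq μ] (e : μ ≃ κ) (hX : X.IsSymm) (hd : ¬ (q : ℤ) ∣ X.det) :
    HasRes q (X.map (Int.cast : ℤ → ℚ)) (0 : Matrix (Fin 0) (Fin 0) ℤ) := by
  refine ⟨μ, inferInstance, inferInstance, X.submatrix e e, 0, hX.submatrix e,
    by ext i; exact i.elim0, by rwa [det_submatrix_equiv_self], ?_, ?_⟩
  · rw [det_fin_zero]
    exact fun h => hq.one_lt.ne' (by exact_mod_cast Int.eq_one_of_dvd_one (by positivity) h)
  · refine (Cong.of_equiv ((Equiv.sumEmpty μ (Fin 0)).trans e) _).trans ?_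
    have : (X.map (Int.cast : ℤ → ℚ)).submatrix ((Equiv.sumEmpty μ (Fin 0)).trans e)
        ((Equiv.sumEmpty μ (Fin 0)).trans e) = (fromBlocks (X.submatrix e e) ((q : ℤ) • 0)
          ((q : ℤ) • (0 : Matrix μ (Fin 0) ℤ)ᵀ) ((q : ℤ) • (0 : Matrix (Fin 0) (Fin 0) ℤ))).map
          (Int.cast : ℤ → ℚ) := by
      ext (i | i) (j | j)
      · simp
      · exact j.elim0
      · exact i.elim0
      · exact i.elim0
    rw [this]
    exact Cong.refl _

theorem hasRes_block {q : ℕ} {μ : Type} [Fintype μ] [DecidableEq μ] {A : Matrix μ μ ℤ}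
    {C : Matrix κ κ ℤ} (hA : A.IsSymm) (hC : C.IsSymm)
    (hdA : ¬ (q : ℤ) ∣ A.det) (hdC : ¬ (q : ℤ) ∣ C.det) :
    HasRes q ((orthSum A ((q : ℤ) • C)).map (Int.cast : ℤ → ℚ)) C := by
  refine ⟨μ, inferInstance, inferInstance, A, 0, hA, hC, hdA, hdC, ?_⟩
  simpa [orthSum] using Cong.refl _

/-- Some residue form of `X` at `q` is neutral. -/
def ResTrivial (q : ℕ) (X : Matrix ι ι ℚ) : Prop :=
  ∃ (κ : Type) (_ : Fintype κ) (_ : DecidableEq κ) (C : Matrix κ κ ℤ),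
    HasRes q X C ∧ Neutral (C.map (Int.cast : ℤ → ZMod q))

end HasRes

section Smooth

/-- A nonzero integer all of whose prime factors are less than `k`. -/
def Smooth (k : ℕ) (n : ℤ) : Prop := n ≠ 0 ∧ ∀ q : ℕ, q.Prime → (q : ℤ) ∣ n → q < k

theorem Smooth.mul {k : ℕ} {m n : ℤ} (hm : Smooth k m) (hn : Smooth k n) : Smooth k (m * n) :=
  ⟨mul_ne_zero hm.1 hn.1, fun q hq h => by
    rcases (Nat.prime_iff_prime_int.1 hq).dvd_or_dvd h with h | h
    · exact hm.2 q hq h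
    · exact hn.2 q hq h⟩

theorem Smooth.mono {k l : ℕ} (hkl : k ≤ l) {n : ℤ} (hn : Smooth k n) : Smooth l n :=
  ⟨hn.1, fun q hq h => (hn.2 q hq h).trans_le hkl⟩

theorem Smooth.neg {k : ℕ} {n : ℤ} (hn : Smooth k n) : Smooth k (-n) :=
  ⟨neg_ne_zero.2 hn.1, fun q hq h => hn.2 q hq ((dvd_neg).1 h)⟩

theorem smooth_of_natAbs_lt {k : ℕ} {n : ℤ} (h0 : n ≠ 0) (h : n.natAbs < k) : Smooth k n :=
  ⟨h0, fun _ _ hq => (Nat.le_of_dvd (Int.natAbs_pos.2 h0) (Int.natCast_dvd.1 hq)).trans_lt h⟩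

theorem Smooth.not_dvd {q : ℕ} (hq : q.Prime) {n : ℤ} (hn : Smooth q n) : ¬ (q : ℤ) ∣ n :=
  fun h => (hn.2 q hq h).false

/-- The subgroup of the rational Witt group generated by the classes of smooth integers. -/
noncomputable def smoothWitt (k : ℕ) : AddSubgroup (WittGroup ℚ) :=
  AddSubgroup.closure {w | ∃ n : ℤ, Smooth k n ∧ w = wcl (n : ℚ)}

theorem wcl_mem_smoothWitt {k : ℕ} {n : ℤ} (hn : Smooth k n) : wcl (n : ℚ) ∈ smoothWitt k :=
  AddSubgroup.subset_closure ⟨n, hn, rfl⟩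

theorem smoothWitt_mono {k l : ℕ} (h : k ≤ l) : smoothWitt k ≤ smoothWitt l :=
  AddSubgroup.closure_mono fun _ ⟨n, hn, hw⟩ => ⟨n, hn.mono h, hw⟩

theorem exists_mem_smoothWitt (w : WittGroup ℚ) : ∃ k, w ∈ smoothWitt k := by
  obtain ⟨s, rfl⟩ := wittMk_surjective w
  induction s using Multiset.induction_on with
  | empty => exact ⟨0, by rw [map_zero]; exact zero_mem _⟩
  | cons a s ih =>
    obtain ⟨k, hk⟩ := ih
    have h1 : wittMk {a} = wcl (((a : ℚ).num * (a : ℚ).den : ℤ) : ℚ) := by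
      have h2 := isWittFun_wcl.sq (a : ℚ) (a : ℚ).den (by simp)
      have h3 : ((a : ℚ).num : ℚ) = a * (a : ℚ).den := (Rat.mul_den_eq_num _).symm
      have h4 : (((a : ℚ).num * (a : ℚ).den : ℤ) : ℚ) = a * ((a : ℚ).den : ℚ) ^ 2 := by
        push_cast; rw [h3]; ring
      rw [h4, h2, wcl, dif_neg a.ne_zero]
      congr 2
      ext; rfl
    set n : ℤ := (a : ℚ).num * (a : ℚ).den with hn
    have hn0 : n ≠ 0 := by
      rw [hn]; simp
    refine ⟨max k (n.natAbs + 1), ?_⟩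
    rw [← Multiset.singleton_add, map_add, h1]
    exact add_mem (wcl_mem_smoothWitt (smooth_of_natAbs_lt hn0 (by omega)))
      (smoothWitt_mono (le_max_left _ _) hk)

theorem wcl_mul_sq_int (a b : ℤ) (hb : b ≠ 0) : wcl ((a * b ^ 2 : ℤ) : ℚ) = wcl (a : ℚ) := by
  push_cast
  exact isWittFun_wcl.sq _ _ (Int.cast_ne_zero.2 hb)

theorem wcl_add_int (a b : ℤ) : wcl (a : ℚ) + wcl (b : ℚ) =
    wcl ((a + b : ℤ) : ℚ) + wcl ((a * b * (a + b) : ℤ) : ℚ) := by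
  push_cast
  exact isWittFun_wcl.add _ _

theorem exists_smooth_decomposition {q : ℕ} (hq : q.Prime) {n : ℤ} (hn : Smooth (q + 1) n) :
    ∃ u : ℤ, Smooth q u ∧ (wcl (n : ℚ) = wcl (u : ℚ) ∨ wcl (n : ℚ) = wcl ((q * u : ℤ) : ℚ)) := by
  have hq' : Prime (q : ℤ) := Nat.prime_iff_prime_int.1 hq
  obtain ⟨e, u, hnu, hu⟩ : ∃ (e : ℕ) (u : ℤ), n = q ^ e * u ∧ ¬ (q : ℤ) ∣ u :=
    ⟨_, (FiniteMultiplicity.of_prime_left hq' hn.1).exists_eq_pow_mul_and_not_dvd⟩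
  subst hnu
  have hq0 : (q : ℤ) ≠ 0 := hq'.ne_zero
  refine ⟨u, ⟨right_ne_zero_of_mul hn.1, fun r hr h => ?_⟩, ?_⟩
  · refine lt_of_le_of_ne (Nat.lt_succ_iff.1 (hn.2 r hr (h.mul_left _))) ?_
    rintro rfl
    exact hu h
  · obtain ⟨f, rfl | rfl⟩ := Nat.even_or_odd' e
    · left
      rw [← wcl_mul_sq_int u (q ^ f) (pow_ne_zero _ hq0)]
      congr 2; ring
    · right
      rw [← wcl_mul_sq_int (q * u) (q ^ f) (pow_ne_zero _ hq0)]
      congr 2; ring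

theorem exists_smooth_representation {q : ℕ} (hq : q.Prime) {w : WittGroup ℚ}
    (hw : w ∈ smoothWitt (q + 1)) :
    ∃ (α β : Type) (_ : Fintype α) (_ : DecidableEq α) (_ : Fintype β) (_ : DecidableEq β)
      (a : α → ℤ) (b : β → ℤ), (∀ i, Smooth q (a i)) ∧ (∀ i, Smooth q (b i)) ∧
      w = ∑ i, wcl (a i : ℚ) + ∑ i, wcl ((q * b i : ℤ) : ℚ) := by
  induction hw using AddSubgroup.closure_induction with
  | mem x hx =>
    obtain ⟨n, hn, rfl⟩ := hx
    obtain ⟨u, hu, h | h⟩ := exists_smooth_decomposition hq hn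
    · exact ⟨Fin 1, Fin 0, inferInstance, inferInstance, inferInstance, inferInstance,
        fun _ => u, fun _ => u, fun _ => hu, fun _ => hu, by simp [h]⟩
    · exact ⟨Fin 0, Fin 1, inferInstance, inferInstance, inferInstance, inferInstance,
        fun _ => u, fun _ => u, fun _ => hu, fun _ => hu, by simp [h]⟩
  | zero =>
    exact ⟨Fin 0, Fin 0, inferInstance, inferInstance, inferInstance, inferInstance,
        fun _ => 1, fun _ => 1, fun i => i.elim0, fun i => i.elim0, by simp⟩
  | add x y _ _ hx hy =>
    obtain ⟨α, β, _, _, _, _, a, b, ha, hb, rfl⟩ := hx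
    obtain ⟨α', β', _, _, _, _, a', b', ha', hb', rfl⟩ := hy
    refine ⟨α ⊕ α', β ⊕ β', inferInstance, inferInstance, inferInstance, inferInstance,
      Sum.elim a a', Sum.elim b b', ?_, ?_, ?_⟩
    · rintro (i | i)
      · exact ha i
      · exact ha' i
    · rintro (i | i)
      · exact hb i
      · exact hb' i
    · simp only [Fintype.sum_sum_type, Sum.elim_inl, Sum.elim_inr]
      abel
  | neg x _ hx =>
    obtain ⟨α, β, _, _, _, _, a, b, ha, hb, rfl⟩ := hx
    refine ⟨α, β, inferInstance, inferInstance, inferInstance, inferInstance,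
      fun i => -a i, fun i => -b i, fun i => (ha i).neg, fun i => (hb i).neg, ?_⟩
    have h1 : ∀ i, wcl ((-a i : ℤ) : ℚ) = -wcl (a i : ℚ) := fun i => by
      push_cast; exact wcl_neg _
    have h2 : ∀ i, wcl ((q * -b i : ℤ) : ℚ) = -wcl ((q * b i : ℤ) : ℚ) := fun i => by
      rw [mul_neg]; push_cast; exact wcl_neg _
    simp only [h1, h2, Finset.sum_neg_distrib]
    abel

/-- The integers `m` and `n` have the same residue at `q` modulo classes of smooth integers. -/
def ResEquiv (q : ℕ) (m n : ℤ) : Prop :=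
  ∀ t : ℤ, Smooth q t → wcl ((q * (t * m) : ℤ) : ℚ) - wcl ((q * (t * n) : ℤ) : ℚ) ∈ smoothWitt q

theorem ResEquiv.refl (q : ℕ) (m : ℤ) : ResEquiv q m m := fun t _ => by
  rw [sub_self]; exact zero_mem _

theorem ResEquiv.trans {q : ℕ} {m n l : ℤ} (h : ResEquiv q m n) (h' : ResEquiv q n l) :
    ResEquiv q m l := fun t ht => by
  have := add_mem (h t ht) (h' t ht)
  rwa [sub_add_sub_cancel] at this

theorem ResEquiv.mul {q : ℕ} {m n s : ℤ} (h : ResEquiv q m n) (hs : Smooth q s) :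
    ResEquiv q (s * m) (s * n) := fun t ht => by
  rw [← mul_assoc t, ← mul_assoc t]
  exact h _ (ht.mul hs)

theorem ResEquiv.of_eq_add {q : ℕ} (hq : q.Prime) {n k m : ℤ} (hn : Smooth q n) (hk : Smooth q k)
    (hm : Smooth q m) (h : m = n + k * q) : ResEquiv q m n := fun t ht => by
  have hq0 : (q : ℤ) ≠ 0 := by exact_mod_cast hq.ne_zero
  have h1 := wcl_add_int (q * (t * n)) (q * (t * (k * q)))
  have h2 : (q : ℤ) * (t * (k * q)) = t * k * q ^ 2 := by ring
  have h3 : (q : ℤ) * (t * n) + q * (t * (k * q)) = q * (t * m) := by rw [h]; ring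
  have h4 : (q : ℤ) * (t * n) * (q * (t * (k * q))) * (q * (t * m)) =
      (t * n * k * m) * (q ^ 2 * t) ^ 2 := by ring
  rw [h3, h4, wcl_mul_sq_int _ _ (mul_ne_zero (pow_ne_zero _ hq0) ht.1), h2,
    wcl_mul_sq_int _ _ hq0] at h1
  have h5 : wcl ((q * (t * m) : ℤ) : ℚ) - wcl ((q * (t * n) : ℤ) : ℚ) =
      wcl ((t * k : ℤ) : ℚ) - wcl ((t * n * k * m : ℤ) : ℚ) := by
    rw [sub_eq_sub_iff_add_eq_add, ← h1]; abel
  rw [h5]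
  exact sub_mem (wcl_mem_smoothWitt (ht.mul hk))
    (wcl_mem_smoothWitt (((ht.mul hn).mul hk).mul hm))

theorem smooth_emod {q : ℕ} (hq : q.Prime) {u : ℤ} (hu : ¬ (q : ℤ) ∣ u) : Smooth q (u % q) := by
  have h1 := Int.emod_nonneg u (b := (q : ℤ)) (by exact_mod_cast hq.ne_zero)
  have h2 := Int.emod_lt_of_pos u (b := (q : ℤ)) (by exact_mod_cast hq.pos)
  refine smooth_of_natAbs_lt (fun h => hu (Int.dvd_of_emod_eq_zero h)) (by omega)

theorem resEquiv_emod_natCast {q : ℕ} (hq : q.Prime) (u : ℕ) (hu : Smooth q (u : ℤ)) :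
    ResEquiv q u (u % q) := by
  induction u using induction_on_primes with
  | zero => exact absurd rfl hu.1
  | one =>
    have : ((1 : ℕ) : ℤ) % q = 1 := Int.emod_eq_of_lt (by simp) (by exact_mod_cast hq.one_lt)
    rw [this]
    exact ResEquiv.refl _ _
  | prime_mul l a hl ih =>
    have ha : Smooth q (a : ℤ) := ⟨fun h => hu.1 (by push_cast; rw [h]; simp), fun r hr h =>
      hu.2 r hr (by push_cast; exact h.mul_left _)⟩
    have hlq : l < q := hu.2 l hl (by push_cast; exact dvd_mul_right _ _)
    have hl' : Smooth q (l : ℤ) := smooth_of_natAbs_lt (by exact_mod_cast hl.ne_zero) (by simpa)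
    have h1 := (ih ha).mul hl'
    push_cast
    refine h1.trans ?_
    have hq0 : (0 : ℤ) < q := by exact_mod_cast hq.pos
    set n' : ℤ := (a : ℤ) % q with hn'
    have hn's : Smooth q n' := smooth_emod hq (ha.not_dvd hq)
    have h3 : (l : ℤ) * a % q = l * n' % q := by
      rw [hn', Int.mul_emod, Int.mul_emod (l : ℤ) (a % q), Int.emod_emod_of_dvd _ dvd_rfl]
    rw [h3]
    have hm : Smooth q (l * n') := hl'.mul hn's
    have h4 : (l : ℤ) * n' = l * n' % q + (l * n' / q) * q := by
      rw [mul_comm _ (q : ℤ)]; exact (Int.emod_add_mul_ediv _ _).symm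
    by_cases hk : (l : ℤ) * n' / q = 0
    · rw [hk, zero_mul, add_zero] at h4
      rw [← h4]
      exact ResEquiv.refl _ _
    · refine ResEquiv.of_eq_add hq (smooth_emod hq (hm.not_dvd hq))
        (smooth_of_natAbs_lt hk ?_) hm h4
      have hn0 : 0 ≤ n' := Int.emod_nonneg _ hq0.ne'
      have hn1 : n' < q := Int.emod_lt_of_pos _ hq0
      have h5 : 0 ≤ (l : ℤ) * n' / q := Int.ediv_nonneg (by positivity) hq0.le
      have h6 : (l : ℤ) * n' / q < l := by
        apply Int.ediv_lt_of_lt_mul hq0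
        have : (0 : ℤ) < l := by exact_mod_cast hl.pos
        nlinarith
      omega

theorem resEquiv_emod {q : ℕ} (hq : q.Prime) {u : ℤ} (hu : Smooth q u) : ResEquiv q u (u % q) := by
  obtain ⟨v, rfl | rfl⟩ := Int.eq_nat_or_neg u
  · exact resEquiv_emod_natCast hq v hu
  · have hv : Smooth q (v : ℤ) := by simpa using hu.neg
    have h1 : Smooth q (-1) := smooth_of_natAbs_lt (by simp) (by simpa using hq.one_lt)
    have h2 := (resEquiv_emod_natCast hq v hv).mul h1
    rw [neg_one_mul, neg_one_mul] at h2
    refine h2.trans ?_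
    have h3 := smooth_emod hq (hv.not_dvd hq)
    have h4 := smooth_emod hq (hu.not_dvd hq)
    refine ResEquiv.of_eq_add hq h4 h1 h3.neg ?_
    rw [Int.neg_emod, if_neg (hv.not_dvd hq)]
    simp
    ring

theorem ResEquiv.mk_eq {q : ℕ} (hq : q.Prime) {m n : ℤ} (h : ResEquiv q m n) :
    (QuotientAddGroup.mk (wcl ((q * m : ℤ) : ℚ)) : WittGroup ℚ ⧸ smoothWitt q) =
      QuotientAddGroup.mk (wcl ((q * n : ℤ) : ℚ)) := by
  have := h 1 (smooth_of_natAbs_lt one_ne_zero (by simpa using hq.one_lt))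
  rw [one_mul, one_mul] at this
  rw [QuotientAddGroup.eq, ← sub_eq_neg_add, ← neg_sub]
  exact neg_mem this

/-- The inverse residue map at `q`. -/
noncomputable def resLift (q : ℕ) (x : ZMod q) : WittGroup ℚ ⧸ smoothWitt q :=
  QuotientAddGroup.mk (wcl ((q * x.val : ℤ) : ℚ))

theorem resLift_intCast {q : ℕ} (hq : q.Prime) {u : ℤ} (hu : Smooth q u) :
    resLift q (u : ZMod q) = QuotientAddGroup.mk (wcl ((q * u : ℤ) : ℚ)) := by
  have : NeZero q := ⟨hq.ne_zero⟩
  rw [resLift, ZMod.val_intCast]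
  exact ((resEquiv_emod hq hu).mk_eq hq).symm

theorem isWittFun_resLift {q : ℕ} [hq : Fact q.Prime] : IsWittFun (resLift q) := by
  have hq0 : (q : ℤ) ≠ 0 := by exact_mod_cast hq.out.ne_zero
  have hz : resLift q 0 = 0 := by simp [resLift]
  have hrep : ∀ x : ZMod q, x ≠ 0 → ∃ u : ℤ, Smooth q u ∧ (u : ZMod q) = x ∧ 2 * u.natAbs ≤ q := by
    intro x hx
    have h1 := ZMod.natAbs_valMinAbs_le x
    have h2 := ZMod.coe_valMinAbs x
    have h3 : x.valMinAbs ≠ 0 := fun h => hx (by rw [← h2, h]; simp)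
    refine ⟨x.valMinAbs, smooth_of_natAbs_lt h3 ?_, h2, by omega⟩
    have := hq.out.two_le
    omega
  have hneg : ∀ u : ℤ, wcl ((q * -u : ℤ) : ℚ) = -wcl ((q * u : ℤ) : ℚ) := fun u => by
    rw [mul_neg]; push_cast; exact wcl_neg _
  refine ⟨hz, fun a b hb => ?_, fun a b => ?_⟩
  · by_cases ha : a = 0
    · simp [ha]
    obtain ⟨u, hu, rfl, -⟩ := hrep a ha
    obtain ⟨v, hv, rfl, -⟩ := hrep b hb
    have h1 : Smooth q (u * v ^ 2) := by rw [sq]; exact hu.mul (hv.mul hv)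
    have h2 : (u : ZMod q) * (v : ZMod q) ^ 2 = ((u * v ^ 2 : ℤ) : ZMod q) := by push_cast; ring
    rw [h2, resLift_intCast hq.out h1, resLift_intCast hq.out hu, ← mul_assoc,
      wcl_mul_sq_int _ _ hv.1]
  · by_cases ha : a = 0
    · simp [ha, hz]
    by_cases hb : b = 0
    · simp [hb, hz]
    obtain ⟨u, hu, rfl, hu2⟩ := hrep a ha
    obtain ⟨v, hv, rfl, hv2⟩ := hrep b hb
    by_cases hab : (u : ZMod q) + v = 0
    · have h1 : (v : ZMod q) = ((-u : ℤ) : ZMod q) := by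
        push_cast; exact eq_neg_of_add_eq_zero_right hab
      rw [hab, mul_zero, hz, h1, resLift_intCast hq.out hu, resLift_intCast hq.out hu.neg, hneg]
      simp
    · have h1 : ¬ (q : ℤ) ∣ u + v := by
        rw [← ZMod.intCast_zmod_eq_zero_iff_dvd]; push_cast; exact hab
      have h2 : Smooth q (u + v) := by
        refine smooth_of_natAbs_lt (fun h => h1 (by rw [h]; simp)) ?_
        have h3 : (u + v).natAbs ≠ q := fun h => h1 (by rw [← h]; simp)
        omega
      have h3 : Smooth q (u * v * (u + v)) := (hu.mul hv).mul h2
      have e1 : (u : ZMod q) + v = ((u + v : ℤ) : ZMod q) := by push_cast; ring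
      have e2 : (u : ZMod q) * v * ((u + v : ℤ) : ZMod q) = ((u * v * (u + v) : ℤ) : ZMod q) := by
        push_cast; ring
      rw [e1, e2, resLift_intCast hq.out hu, resLift_intCast hq.out hv, resLift_intCast hq.out h2,
        resLift_intCast hq.out h3, ← QuotientAddGroup.mk_add, ← QuotientAddGroup.mk_add,
        wcl_add_int]
      have e3 : (q : ℤ) * u * (q * v) * (q * u + q * v) = (q * (u * v * (u + v))) * q ^ 2 := by ring
      have e4 : (q : ℤ) * u + q * v = q * (u + v) := by ring
      rw [e3, e4, wcl_mul_sq_int _ _ hq0]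

end Smooth

section LocalGlobal

theorem smooth_zero_eq {n : ℤ} (hn : Smooth 0 n) : n = 1 ∨ n = -1 := by
  rw [← Int.natAbs_eq_natAbs_iff (b := 1)]
  by_contra h
  obtain ⟨r, hr, hd⟩ := Nat.exists_prime_and_dvd (n := n.natAbs) (by simpa using h)
  exact absurd (hn.2 r hr (Int.natCast_dvd.2 hd)) (by simp)

theorem exists_zsmul_of_mem_smoothWitt_zero {w : WittGroup ℚ} (hw : w ∈ smoothWitt 0) :
    ∃ s : ℤ, s • wcl (1 : ℚ) = w := by
  have h : smoothWitt 0 ≤ AddSubgroup.zmultiples (wcl (1 : ℚ)) := by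
    rw [smoothWitt, AddSubgroup.closure_le]
    rintro _ ⟨n, hn, rfl⟩
    obtain rfl | rfl := smooth_zero_eq hn
    · exact ⟨1, by simp⟩
    · exact ⟨-1, by simp [wcl_neg]⟩
  exact AddSubgroup.mem_zmultiples_iff.1 (h hw)

variable {ι : Type*} [Fintype ι] [DecidableEq ι] {X : Matrix ι ι ℚ} {w : WittGroup ℚ}

theorem mem_smoothWitt_of_resTrivial {q : ℕ} (hq : q.Prime) (hX : HasClass X w)
    (hr : ResTrivial q X) (hw : w ∈ smoothWitt (q + 1)) : w ∈ smoothWitt q := by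
  have : Fact q.Prime := ⟨hq⟩
  have hq' : Prime (q : ℤ) := Nat.prime_iff_prime_int.1 hq
  obtain ⟨κ, _, _, C, hC, hN⟩ := hr
  obtain ⟨α, β, _, _, _, _, a, b, ha, hb, hwab⟩ := exists_smooth_representation hq hw
  have hda : ¬ (q : ℤ) ∣ (diagonal a).det := by
    rw [det_diagonal, hq'.dvd_finsetProd_iff]
    rintro ⟨i, -, hi⟩
    exact (ha i).not_dvd hq hi
  have hdb : ¬ (q : ℤ) ∣ (diagonal b).det := by
    rw [det_diagonal, hq'.dvd_finsetProd_iff]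
    rintro ⟨i, -, hi⟩
    exact (hb i).not_dvd hq hi
  have hD := hasRes_block (isSymm_diagonal a) (isSymm_diagonal b) hda hdb
  have hDe : (orthSum (diagonal a) ((q : ℤ) • diagonal b)).map (Int.cast : ℤ → ℚ) =
      orthSum (diagonal fun i => (a i : ℚ)) (diagonal fun i => ((q * b i : ℤ) : ℚ)) := by
    ext (i | i) (j | j)
    · by_cases hij : i = j <;> simp [orthSum, hij]
    · simp [orthSum]
    · simp [orthSum]
    · by_cases hij : i = j <;>
        simp [orthSum, -natCast_zsmul, -nsmul_eq_mul, -zsmul_eq_mul, hij]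
  rw [hDe] at hD
  have hq0 : (q : ℚ) ≠ 0 := by exact_mod_cast hq.ne_zero
  have hDc : HasClass (orthSum (diagonal fun i => (a i : ℚ))
      (diagonal fun i => ((q * b i : ℤ) : ℚ))) w := by
    rw [hwab]
    refine (hasClass_diagonal fun i => ?_).add (hasClass_diagonal fun i => ?_)
    · exact_mod_cast (ha i).1
    · push_cast
      exact mul_ne_zero hq0 (by exact_mod_cast (hb i).1)
  have h1 := (hC.add hq hD.neg).neutral ((hX.eq_iff hDc).1 rfl)
  obtain ⟨_, _, _, _, _, _, hCs, _, hCd, _⟩ := hC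
  have hneg : (-diagonal b).map (Int.cast : ℤ → ZMod q) = -diagonal fun i => (b i : ZMod q) := by
    ext i j
    by_cases hij : i = j <;> simp [hij]
  have h1' : Neutral (orthSum (C.map (Int.cast : ℤ → ZMod q))
      (-diagonal fun i => (b i : ZMod q))) := by
    rw [← hneg]
    exact (orthSum_map (Int.castRingHom (ZMod q)) C (-diagonal b)) ▸ h1
  have hb0 : ∀ i, (b i : ZMod q) ≠ 0 := fun i h =>
    (hb i).not_dvd hq ((ZMod.intCast_zmod_eq_zero_iff_dvd _ _).1 h)
  have h2 : Neutral (-diagonal fun i => (b i : ZMod q)) := by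
    refine Neutral.cancel (B := C.map (Int.cast : ℤ → ZMod q)) (isSymm_diagonal _).neg (hCs.map _)
      ?_ ?_ (h1'.cong (cong_orthSum_comm _ _)) hN
    · rw [det_neg, det_diagonal]
      exact mul_ne_zero (pow_ne_zero _ (by simp)) (Finset.prod_ne_zero_iff.2 fun i _ => hb0 i)
    · have : (C.map (Int.cast : ℤ → ZMod q)).det = (C.det : ZMod q) :=
        ((Int.castRingHom (ZMod q)).map_det C).symm
      rw [this]
      exact fun h => hCd ((ZMod.intCast_zmod_eq_zero_iff_dvd _ _).1 h)
  have h3 : Neutral (diagonal fun i => (b i : ZMod q)) := by simpa using h2.neg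
  have h4 := isWittFun_resLift.sum_eq_zero hb0 h3
  rw [hwab]
  refine add_mem (sum_mem fun i _ => wcl_mem_smoothWitt (ha i)) ?_
  rw [← QuotientAddGroup.eq_zero_iff]
  rw [← h4]
  simp_rw [resLift_intCast hq (hb _)]
  exact map_sum (QuotientAddGroup.mk' (smoothWitt q)) _ _

theorem smoothWitt_succ_eq {q : ℕ} (hq : ¬ q.Prime) : smoothWitt (q + 1) ≤ smoothWitt q := by
  refine AddSubgroup.closure_mono ?_
  rintro _ ⟨n, hn, rfl⟩
  refine ⟨n, ⟨hn.1, fun r hr h => ?_⟩, rfl⟩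
  have := hn.2 r hr h
  have : r ≠ q := fun h => hq (h ▸ hr)
  omega

/-- A rational form is neutral if it is so over the reals and all its residues are neutral. -/
theorem neutral_of_resTrivial (hX : X.IsSymm) (hd : X.det ≠ 0)
    (hR : Neutral (X.map (Rat.castHom ℝ))) (h : ∀ q : ℕ, q.Prime → ResTrivial q X) :
    Neutral X := by
  have : Invertible (2 : ℚ) := invertibleOfNonzero two_ne_zero
  obtain ⟨w, hw⟩ := exists_hasClass hX hd
  rw [← hw.eq_zero_iff]
  obtain ⟨k, hk⟩ := exists_mem_smoothWitt w
  have h0 : w ∈ smoothWitt 0 := by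
    induction k with
    | zero => exact hk
    | succ q ih =>
      refine ih ?_
      by_cases hq : q.Prime
      · exact mem_smoothWitt_of_resTrivial hq hw (h q hq) hk
      · exact smoothWitt_succ_eq hq hk
  obtain ⟨s, rfl⟩ := exists_zsmul_of_mem_smoothWitt_zero h0
  obtain ⟨n, ε, hε, hs⟩ : ∃ (n : ℕ) (ε : ℚ), ε ≠ 0 ∧ s • wcl (1 : ℚ) = n • wcl ε := by
    obtain ⟨n, rfl | rfl⟩ := Int.eq_nat_or_neg s
    · exact ⟨n, 1, one_ne_zero, by simp⟩
    · exact ⟨n, -1, by simp, by rw [wcl_neg]; simp⟩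
  have h1 : HasClass (diagonal fun _ : Fin n => ε) (s • wcl (1 : ℚ)) := by
    have := hasClass_diagonal (a := fun _ : Fin n => ε) fun _ => hε
    rwa [Finset.sum_const, Finset.card_univ, Fintype.card_fin, ← hs] at this
  have h2 := ((hw.eq_iff h1).1 rfl).map (Rat.castHom ℝ)
  rw [orthSum_map] at h2
  have hε' : (ε : ℝ) ≠ 0 := by exact_mod_cast hε
  have e : (-diagonal fun _ : Fin n => ε).map (Rat.castHom ℝ) = diagonal fun _ => -(ε : ℝ) := by
    ext i j
    by_cases hij : i = j <;> simp [hij]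
  have h3 : Neutral (diagonal fun _ : Fin n => -(ε : ℝ)) := by
    rw [e] at h2
    refine Neutral.cancel (isSymm_diagonal _) (hX.map _) ?_ ?_ (h2.cong (cong_orthSum_comm _ _)) hR
    · rw [det_diagonal]
      exact Finset.prod_ne_zero_iff.2 fun _ _ => neg_ne_zero.2 hε'
    · have := (Rat.castHom ℝ).map_det X
      rw [RingHom.mapMatrix_apply] at this
      rw [← this]
      simpa using hd
  have hn : n = 0 := by
    by_contra hn
    obtain ⟨x, hx, h⟩ := h3.exists_isotropic (by simpa using Nat.pos_of_ne_zero hn)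
    have h5 : x ⬝ᵥ diagonal (fun _ : Fin n => -(ε : ℝ)) *ᵥ x = -ε * ∑ i, x i ^ 2 := by
      simp only [dotProduct, mulVec_diagonal, Finset.mul_sum]
      exact Finset.sum_congr rfl fun i _ => by ring
    rw [h5] at h
    have h6 := (mul_eq_zero.1 h).resolve_left (neg_ne_zero.2 hε')
    rw [Finset.sum_eq_zero_iff_of_nonneg fun i _ => sq_nonneg _] at h6
    exact hx (funext fun i => by simpa using h6 i (Finset.mem_univ i))
  rw [hs, hn, zero_smul]

end LocalGlobal

section Primes

theorem exists_prime_cast_eq {m p : ℕ} [NeZero m] [NeZero p] (h : m.Coprime p) {a : ZMod m}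
    {b : ZMod p} (ha : IsUnit a) (hb : IsUnit b) (N : ℕ) :
    ∃ q : ℕ, N < q ∧ q.Prime ∧ (q : ZMod m) = a ∧ (q : ZMod p) = b := by
  have : NeZero (m * p) := ⟨mul_ne_zero (NeZero.ne m) (NeZero.ne p)⟩
  let e := ZMod.chineseRemainder h
  have hu : IsUnit (e.symm (a, b)) := by
    have : IsUnit ((a, b) : ZMod m × ZMod p) := Prod.isUnit_iff.2 ⟨ha, hb⟩
    exact this.map e.symm
  obtain ⟨q, hN, hq, h1⟩ := Nat.forall_exists_prime_gt_and_eq_mod hu N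
  have h2 : e (q : ZMod (m * p)) = (a, b) := by rw [h1, e.apply_symm_apply]
  rw [map_natCast] at h2
  exact ⟨q, hN, hq, congrArg Prod.fst h2, congrArg Prod.snd h2⟩

theorem isSquare_mul_of_not_isSquare {p : ℕ} [Fact p.Prime] {a b : ZMod p} (ha : ¬ IsSquare a)
    (hb : ¬ IsSquare b) : IsSquare (a * b) := by
  by_cases h2 : p = 2
  · subst h2
    exact absurd (FiniteField.isSquare_of_char_two (ZMod.ringChar_zmod_n 2) a) ha
  have hc : ringChar (ZMod p) ≠ 2 := by rwa [ZMod.ringChar_zmod_n]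
  have h1 := (quadraticChar_neg_one_iff_not_isSquare).2 ha
  have h3 := (quadraticChar_neg_one_iff_not_isSquare).2 hb
  have ha0 : a ≠ 0 := fun h => ha (h ▸ IsSquare.zero)
  have hb0 : b ≠ 0 := fun h => hb (h ▸ IsSquare.zero)
  rw [← quadraticChar_one_iff_isSquare (mul_ne_zero ha0 hb0), map_mul, h1, h3]
  norm_num

theorem exists_not_isSquare {p : ℕ} [Fact p.Prime] (hp : p ≠ 2) : ∃ a : ZMod p, ¬ IsSquare a :=
  FiniteField.exists_nonsquare (by rwa [ZMod.ringChar_zmod_n])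

/-- There is a prime congruent to `5` modulo `8` which is not a square modulo `p`. -/
theorem exists_prime_five_mod_eight {p : ℕ} [Fact p.Prime] (hp : p ≠ 2) :
    ∃ q : ℕ, q.Prime ∧ q % 8 = 5 ∧ ¬ IsSquare (q : ZMod p) ∧ q ≠ p := by
  obtain ⟨b, hb⟩ := exists_not_isSquare hp
  have hb0 : b ≠ 0 := fun h => hb (h ▸ IsSquare.zero)
  have hcop : Nat.Coprime 8 p := by
    have : Nat.Coprime 2 p := (Nat.coprime_primes Nat.prime_two Fact.out).2 hp.symm
    exact this.pow_left 3
  obtain ⟨q, -, hq, h1, h2⟩ := exists_prime_cast_eq hcop (a := 5) (b := b)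
    (by decide) (isUnit_iff_ne_zero.2 hb0) 0
  refine ⟨q, hq, ?_, h2 ▸ hb, ?_⟩
  · have : ((q : ℕ) : ZMod 8) = ((5 : ℕ) : ZMod 8) := h1
    rw [ZMod.natCast_eq_natCast_iff] at this
    exact this
  · rintro rfl
    exact hb0 (by rw [← h2]; simp)

theorem isSquare_two_mul_of_not_isSquare {p q : ℕ} [Fact p.Prime] [Fact q.Prime] (hp : p ≠ 2)
    (h5 : q % 8 = 5) (hns : ¬ IsSquare (q : ZMod p)) : IsSquare (2 * p : ZMod q) := by
  have hq2 : q ≠ 2 := by rintro rfl; omega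
  apply isSquare_mul_of_not_isSquare
  · rw [ZMod.exists_sq_eq_two_iff hq2]; omega
  · rwa [ZMod.exists_sq_eq_prime_iff_of_mod_four_eq_one (p := q) (q := p) (by omega) hp]

end Primes

section Even

variable {ι : Type} [Fintype ι] [DecidableEq ι]

theorem even_dotProduct_mulVec {X : Matrix ι ι ℤ} (hX : X.IsSymm) (he : ∀ i, Even (X i i))
    (x : ι → ℤ) : Even (x ⬝ᵥ X *ᵥ x) := by
  have h : ∀ s : Finset ι, Even (∑ i ∈ s, ∑ j ∈ s, x i * (X i j * x j)) := by
    intro s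
    induction s using Finset.induction_on with
    | empty => simp
    | insert a s ha ih =>
      rw [Finset.sum_insert ha, Finset.sum_insert ha]
      simp_rw [Finset.sum_insert ha]
      rw [Finset.sum_add_distrib]
      have h1 : ∑ i ∈ s, x i * (X i a * x a) = ∑ j ∈ s, x a * (X a j * x j) :=
        Finset.sum_congr rfl fun i _ => by rw [hX.apply a i]; ring
      rw [h1]
      obtain ⟨c, hc⟩ := he a
      obtain ⟨d, hd⟩ := ih
      rw [hc, hd]
      exact ⟨x a * (c * x a) + ∑ j ∈ s, x a * (X a j * x j) + d, by ring⟩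
  simpa [dotProduct, mulVec, Finset.mul_sum] using h Finset.univ

/-- The binary even form `2 (x² + x y + t y²)`. -/
def binEven (t : ℤ) : Matrix (Fin 2) (Fin 2) ℤ := !![2, 1; 1, 2 * t]

theorem binEven_isSymm (t : ℤ) : (binEven t).IsSymm := by
  ext i j; fin_cases i <;> fin_cases j <;> rfl

theorem binEven_even (t : ℤ) (i : Fin 2) : Even (binEven t i i) := by
  fin_cases i <;> simp [binEven]

theorem binEven_det (t : ℤ) : (binEven t).det = 4 * t - 1 := by
  simp [binEven, det_fin_two]; ring

theorem orthSum_even {κ : Type} {X : Matrix ι ι ℤ} {Y : Matrix κ κ ℤ} [Fintype κ] [DecidableEq κ]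
    (hX : ∀ i, Even (X i i)) (hY : ∀ i, Even (Y i i)) (i) : Even (orthSum X Y i i) := by
  obtain i | i := i
  · exact hX i
  · exact hY i

/-- A `2`-adic obstruction to neutrality. -/
theorem not_neutral_even {X : Matrix ι ι ℤ} (hX : X.IsSymm) (he : ∀ i, Even (X i i))
    (hd : ¬ (2 : ℤ) ∣ X.det) {t : ℤ} (ht : Odd t) :
    ¬ Neutral ((orthSum X ((2 : ℤ) • -binEven t)).map (Int.cast : ℤ → ℚ)) := by
  intro h
  have : Fact (Nat.Prime 2) := ⟨Nat.prime_two⟩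
  have e : orthSum X ((2 : ℤ) • -binEven t) =
      fromBlocks X (((2 : ℕ) : ℤ) • (0 : Matrix ι (Fin 2) ℤ))
        (((2 : ℕ) : ℤ) • (0 : Matrix ι (Fin 2) ℤ)ᵀ) (((2 : ℕ) : ℤ) • -binEven t) := by
    ext (i | i) (j | j) <;> simp [orthSum]
  rw [e] at h
  obtain ⟨I, hI, fx, fy, hf, h0⟩ := exists_lagrangian_residue _ _ (by exact_mod_cast hd) h
  have hI' : 0 < Module.finrank (ZMod 2) I := by rw [Fintype.card_fin] at hI; omega
  have hne : I ≠ ⊥ := by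
    rintro rfl
    simp at hI'
  obtain ⟨v, hv, hv0⟩ := Submodule.exists_mem_ne_zero_of_ne_bot hne
  have h1 := h0 ⟨v, hv⟩ ⟨v, hv⟩
  obtain ⟨k, hk⟩ := even_dotProduct_mulVec hX he (fx ⟨v, hv⟩)
  rw [hk] at h1
  have hy := hf ⟨v, hv⟩
  set y := fy ⟨v, hv⟩ with hydef
  have e2 : y ⬝ᵥ (-binEven t) *ᵥ y = -(2 * (y 0 ^ 2 + y 0 * y 1 + t * y 1 ^ 2)) := by
    simp [binEven, dotProduct, mulVec, Fin.sum_univ_two]; ring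
  rw [e2] at h1
  simp only [zero_mulVec, dotProduct_zero, mul_zero, add_zero] at h1
  obtain ⟨s, rfl⟩ := ht
  have h3 : Even (y 0 ^ 2 + y 0 * y 1 + (2 * s + 1) * y 1 ^ 2) := by
    exact ⟨k, by push_cast at h1; linarith⟩
  have h4 : Even (y 0) ∧ Even (y 1) := by
    simp only [Int.even_add, Int.even_mul, Int.even_pow] at h3
    simp at h3
    tauto
  apply hv0
  ext i
  have : Even (y i) := by fin_cases i; exacts [h4.1, h4.2]
  rw [show v i = (y i : ZMod 2) from (hy i).symm]
  simpa using (ZMod.intCast_zmod_eq_zero_iff_dvd (y i) 2).2 (by exact_mod_cast this.two_dvd)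

theorem cong_binEven (t : ℤ) : Cong ((binEven t).map (Int.cast : ℤ → ℚ))
    (diagonal ![2, 2 * (4 * (t : ℚ) - 1)]) := by
  refine ⟨!![1, -1; 0, 2], !![1, 1 / 2; 0, 1 / 2], ?_, ?_, ?_⟩
  · ext i j; fin_cases i <;> fin_cases j <;> simp [mul_apply, Fin.sum_univ_two]
  · ext i j; fin_cases i <;> fin_cases j <;> simp [mul_apply, Fin.sum_univ_two]
  · ext i j
    fin_cases i <;> fin_cases j <;> simp [mul_apply, Fin.sum_univ_two, binEven]
    ring

theorem hasRes_smul_binEven {q : ℕ} {t c : ℤ} (hqt : (q : ℤ) = 1 - 4 * t)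
    (hc : ¬ (q : ℤ) ∣ 2 * c) : HasRes q ((c • binEven t).map (Int.cast : ℤ → ℚ))
      (diagonal fun _ : Fin 1 => -(2 * c)) := by
  have h1 := hasRes_block (q := q) (A := diagonal fun _ : Fin 1 => 2 * c)
    (C := diagonal fun _ : Fin 1 => -(2 * c)) (isSymm_diagonal _) (isSymm_diagonal _)
    (by simpa using hc) (by simpa using hc)
  refine h1.cong ?_
  obtain ⟨P, S, h2, h3, h4⟩ := cong_binEven t
  have h5 : Cong ((c • binEven t).map (Int.cast : ℤ → ℚ))
      (diagonal ![2 * (c : ℚ), 2 * c * (4 * t - 1)]) := by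
    refine ⟨P, S, h2, h3, ?_⟩
    have : (c • binEven t).map (Int.cast : ℤ → ℚ) =
        (c : ℚ) • (binEven t).map (Int.cast : ℤ → ℚ) := by
      ext i j; simp [-zsmul_eq_mul]
    rw [this, Matrix.mul_smul, Matrix.smul_mul, h4]
    ext i j
    fin_cases i <;> fin_cases j <;> simp <;> ring
  refine Cong.trans ?_ h5.symm
  have h6 := Cong.of_equiv (finSumFinEquiv (m := 1) (n := 1)).symm
    ((orthSum (diagonal fun _ : Fin 1 => 2 * c) ((q : ℤ) • diagonal fun _ : Fin 1 => -(2 * c))).map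
      (Int.cast : ℤ → ℚ))
  convert h6 using 1
  ext i j
  fin_cases i <;> fin_cases j <;> 
    simp [orthSum, finSumFinEquiv, Fin.addCases, -zsmul_eq_mul, -natCast_zsmul, -nsmul_eq_mul]
  have hq' : (q : ℚ) = 1 - 4 * t := by exact_mod_cast hqt
  rw [hq']
  ring

theorem hasRes_zero_of_natAbs_det {X : Matrix ι ι ℤ} (hX : X.IsSymm) {p : ℕ} (hp : p.Prime) {e : ℕ}
    (hd : X.det.natAbs = p ^ e) {q : ℕ} (hq : q.Prime) (hqp : q ≠ p) :
    HasRes q (X.map (Int.cast : ℤ → ℚ)) (0 : Matrix (Fin 0) (Fin 0) ℤ) := by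
  refine hasRes_of_not_dvd hq (Equiv.refl ι) hX fun h => hqp ?_
  rw [Int.natCast_dvd, hd] at h
  exact (Nat.prime_dvd_prime_iff_eq hq hp).1 (hq.dvd_of_dvd_pow h)

theorem neutral_fin_zero {R : Type*} [CommRing R] (M : Matrix (Fin 0) (Fin 0) R) : Neutral M :=
  ⟨0, 0, 0, by ext i; exact i.elim0, by ext i; exact i.elim0, by simp⟩

theorem map_intCast_det {p : ℕ} {κ : Type*} [Fintype κ] [DecidableEq κ] (C : Matrix κ κ ℤ) :
    (C.map (Int.cast : ℤ → ZMod p)).det = (C.det : ZMod p) :=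
  ((Int.castRingHom (ZMod p)).map_det C).symm

/-- Neutrality from a residue form of square signed discriminant. -/
theorem neutral_of_residue_isSquare {X : Matrix ι ι ℤ} (hX : X.IsSymm) {p : ℕ} [Fact p.Prime]
    (hp : p ≠ 2) {e : ℕ} (hd : X.det.natAbs = p ^ e) {κ : Type} [Fintype κ] [DecidableEq κ]
    {C : Matrix κ κ ℤ} (hC : HasRes p (X.map (Int.cast : ℤ → ℚ)) C) {n : ℕ}
    (hn : Fintype.card κ = 2 * n) (hsq : IsSquare ((-1) ^ n * (C.det : ZMod p)))
    (hR : Neutral ((X.map (Int.cast : ℤ → ℚ)).map (Rat.castHom ℝ))) :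
    Neutral (X.map (Int.cast : ℤ → ℚ)) := by
  have hpp : p.Prime := Fact.out
  have : Invertible (2 : ZMod p) := invertibleOfNonzero (by
    have := ZMod.prime_ne_zero p 2 hp
    exact_mod_cast this)
  have hdet : (X.map (Int.cast : ℤ → ℚ)).det = (X.det : ℚ) :=
    ((Int.castRingHom ℚ).map_det X).symm
  refine neutral_of_resTrivial (hX.map _) ?_ hR fun q hq => ?_
  · rw [hdet]
    have : X.det ≠ 0 := by
      rw [← Int.natAbs_ne_zero, hd]
      exact pow_ne_zero _ hpp.ne_zero
    exact_mod_cast this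
  · by_cases hqp : q = p
    · subst hqp
      refine ⟨κ, inferInstance, inferInstance, C, hC, ?_⟩
      obtain ⟨_, _, _, _, _, _, hCs, _, hCd, _⟩ := hC
      refine neutral_of_isSquare (hCs.map _) ?_ hn ?_
      · rw [map_intCast_det]
        exact fun h => hCd ((ZMod.intCast_zmod_eq_zero_iff_dvd _ _).1 h)
      · rwa [map_intCast_det]
    · exact ⟨_, _, _, _, hasRes_zero_of_natAbs_det hX hpp hd hq hqp, neutral_fin_zero _⟩

theorem neutral_real_binEven (t : ℤ) (p : ℕ) :
    Neutral (((orthSum ((p : ℤ) • binEven t) ((2 : ℤ) • -binEven t)).map (Int.cast : ℤ → ℚ)).map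
      (Rat.castHom ℝ)) := by
  have e : ((orthSum ((p : ℤ) • binEven t) ((2 : ℤ) • -binEven t)).map (Int.cast : ℤ → ℚ)).map
      (Rat.castHom ℝ) = orthSum ((p : ℝ) • (binEven t).map (Int.cast : ℤ → ℝ))
        ((2 : ℝ) • -(binEven t).map (Int.cast : ℤ → ℝ)) := by
    ext (i | i) (j | j) <;> simp [orthSum, -zsmul_eq_mul, -natCast_zsmul, -nsmul_eq_mul]
  rw [e]
  set B := (binEven t).map (Int.cast : ℤ → ℝ)
  set c := Real.sqrt (p / 2)
  have hc : c * c = p / 2 := Real.mul_self_sqrt (by positivity)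
  refine Neutral.of_fintype (κ := Fin 2) (fromRows 1 (c • 1)) (fromCols 1 0) ?_ ?_ (by simp)
  · rw [fromCols_mul_fromRows]; simp
  · rw [orthSum, transpose_fromRows, fromCols_mul_fromBlocks, fromCols_mul_fromRows]
    ext i j
    simp
    linear_combination (-2 * B i j) * hc

theorem neutral_of_even {X : Matrix ι ι ℤ} (hX : X.IsSymm) (he : ∀ i, Even (X i i)) {p : ℕ}
    [Fact p.Prime] (hp : p ≠ 2) {e : ℕ} (hd : X.det.natAbs = p ^ e) {κ : Type} [Fintype κ]
    [DecidableEq κ] {C : Matrix κ κ ℤ} (hC : HasRes p (X.map (Int.cast : ℤ → ℚ)) C) {n : ℕ}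
    (hn : Fintype.card κ = 2 * n) (hR : Neutral ((X.map (Int.cast : ℤ → ℚ)).map (Rat.castHom ℝ))) :
    Neutral (X.map (Int.cast : ℤ → ℚ)) := by
  have hpp : p.Prime := Fact.out
  have h2p : Invertible (2 : ZMod p) := invertibleOfNonzero (by
    have := ZMod.prime_ne_zero p 2 hp
    exact_mod_cast this)
  have hpodd : ¬ 2 ∣ p := fun h => hp ((Nat.prime_dvd_prime_iff_eq Nat.prime_two hpp).1 h).symm
  have hXodd : ¬ (2 : ℤ) ∣ X.det := by
    rw [← Nat.cast_ofNat (R := ℤ), Int.natCast_dvd, hd]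
    exact fun h => hpodd (Nat.prime_two.dvd_of_dvd_pow h)
  by_contra hN
  have hns : ¬ IsSquare ((-1) ^ n * (C.det : ZMod p)) := fun h =>
    hN (neutral_of_residue_isSquare hX hp hd hC hn h hR)
  obtain ⟨q₁, hq₁, h5, hq₁p, hne⟩ := exists_prime_five_mod_eight hp
  have : Fact q₁.Prime := ⟨hq₁⟩
  obtain ⟨t, ht, hodd⟩ : ∃ t : ℤ, (q₁ : ℤ) = 1 - 4 * t ∧ Odd t := by
    refine ⟨(1 - q₁) / 4, by omega, ?_⟩
    rw [Int.odd_iff]; omega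
  have h2q : Invertible (2 : ZMod q₁) := invertibleOfNonzero (by
    have := ZMod.prime_ne_zero q₁ 2 (by rintro rfl; omega)
    exact_mod_cast this)
  set B := binEven t
  have hBd : B.det = -(q₁ : ℤ) := by rw [binEven_det, ht]; ring
  have hBs : B.IsSymm := binEven_isSymm t
  have hXB : ¬ (2 : ℤ) ∣ (orthSum X ((p : ℤ) • B)).det := by
    rw [orthSum_det, Int.prime_two.dvd_mul, det_smul, hBd, not_or]
    refine ⟨hXodd, ?_⟩
    rw [Fintype.card_fin]
    intro h
    rcases Int.prime_two.dvd_or_dvd h with h | h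
    · exact hpodd (by exact_mod_cast Int.prime_two.dvd_of_dvd_pow h)
    · rw [dvd_neg] at h; omega
  refine not_neutral_even (X := orthSum X ((p : ℤ) • B)) (orthSum_isSymm hX (hBs.smul _))
    (orthSum_even he fun i => ?_) hXB hodd ?_
  · exact (binEven_even t i).mul_left _
  · set W := orthSum ((p : ℤ) • B) ((2 : ℤ) • -B) with hW
    have hWs : W.IsSymm := orthSum_isSymm (hBs.smul _) (hBs.neg.smul _)
    have hmap : ∀ {α β : Type} [Fintype α] [Fintype β] [DecidableEq α] [DecidableEq β]
        (G : Matrix α α ℤ) (H : Matrix β β ℤ), (orthSum G H).map (Int.cast : ℤ → ℚ) =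
          orthSum (G.map (Int.cast : ℤ → ℚ)) (H.map (Int.cast : ℤ → ℚ)) :=
      fun G H => orthSum_map (Int.castRingHom ℚ) G H
    have hdet : ∀ {α : Type} [Fintype α] [DecidableEq α] (G : Matrix α α ℤ),
        (G.map (Int.cast : ℤ → ℚ)).det = (G.det : ℚ) :=
      fun G => ((Int.castRingHom ℚ).map_det G).symm
    have hWd : W.det = (p : ℤ) ^ 2 * 2 ^ 2 * q₁ ^ 2 := by
      rw [hW, orthSum_det, det_smul, det_smul, det_neg, hBd]
      simp
      ring
    have hX0 : X.det ≠ 0 := fun h => hXodd (h ▸ dvd_zero _)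
    have hp0 : (p : ℤ) ≠ 0 := by exact_mod_cast hpp.ne_zero
    have hq0 : (q₁ : ℤ) ≠ 0 := by exact_mod_cast hq₁.ne_zero
    suffices h : Neutral (orthSum (X.map (Int.cast : ℤ → ℚ)) (W.map (Int.cast : ℤ → ℚ))) by
      rw [hmap, hmap]
      rw [hW, hmap] at h
      exact h.cong (cong_orthSum_assoc _ _ _).symm
    refine neutral_of_resTrivial (orthSum_isSymm (hX.map _) (hWs.map _)) ?_ ?_ fun q hq => ?_
    · rw [orthSum_det, hdet, hdet, hWd]
      have : (X.det : ℚ) ≠ 0 := by exact_mod_cast hX0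
      refine mul_ne_zero this ?_
      have hW0 : (p : ℤ) ^ 2 * 2 ^ 2 * q₁ ^ 2 ≠ 0 := by positivity
      exact Int.cast_ne_zero.2 hW0
    · rw [orthSum_map]
      exact hR.add (neutral_real_binEven t p)
    by_cases hqp : q = p
    · subst hqp
      have hdB : ¬ (q : ℤ) ∣ B.det := by
        rw [hBd, dvd_neg, Int.natCast_dvd_natCast]
        exact fun h => hne ((Nat.prime_dvd_prime_iff_eq hq hq₁).1 h).symm
      have h1 := hasRes_block (q := q) (A := (2 : ℤ) • -B) (C := B) (hBs.neg.smul _) hBs (by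
        rw [det_smul, det_neg, (Nat.prime_iff_prime_int.1 hq).dvd_mul, not_or]
        refine ⟨fun h => hpodd ?_, by simpa using hdB⟩
        have := Int.natCast_dvd_natCast.1 (show (q : ℤ) ∣ ((2 : ℕ) : ℤ) by
          exact_mod_cast (Nat.prime_iff_prime_int.1 hq).dvd_of_dvd_pow h)
        exact absurd ((Nat.prime_dvd_prime_iff_eq hq Nat.prime_two).1 this) hp) hdB
      rw [hmap] at h1
      have h2 := hC.add hq (h1.cong (cong_orthSum_comm _ _))
      rw [← hmap, ← hW] at h2
      refine ⟨_, _, _, _, h2, ?_⟩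
      obtain ⟨_, _, _, _, _, _, hCs, _, hCd, _⟩ := h2
      refine neutral_of_isSquare (hCs.map _) ?_ (n := n + 1) (by simp [hn]; ring) ?_
      · rw [map_intCast_det]
        exact fun h => hCd ((ZMod.intCast_zmod_eq_zero_iff_dvd _ _).1 h)
      · rw [map_intCast_det, orthSum_det, hBd]
        have := isSquare_mul_of_not_isSquare hns hq₁p
        convert this using 1
        push_cast
        ring
    by_cases hqq : q = q₁
    · subst hqq
      have hp' : Prime (q : ℤ) := Nat.prime_iff_prime_int.1 hq
      have hq2 : ¬ (q : ℤ) ∣ 2 := fun h => by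
        have := Int.natCast_dvd_natCast.1 (show (q : ℤ) ∣ ((2 : ℕ) : ℤ) from h)
        have := (Nat.prime_dvd_prime_iff_eq hq Nat.prime_two).1 this
        omega
      have hqp' : ¬ (q : ℤ) ∣ p := fun h =>
        hqp ((Nat.prime_dvd_prime_iff_eq hq hpp).1 (Int.natCast_dvd_natCast.1 h))
      have h1 := hasRes_smul_binEven (q := q) (c := p) ht (by rw [hp'.dvd_mul]; tauto)
      have h2 := hasRes_smul_binEven (q := q) (c := -2) ht (by
        rw [hp'.dvd_mul, dvd_neg]; tauto)
      have e2 : (-2 : ℤ) • binEven t = (2 : ℤ) • -B := by simp [B]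
      rw [e2] at h2
      have h3 := (hasRes_zero_of_natAbs_det hX hpp hd hq hqp).add hq (h1.add hq h2)
      rw [← hmap, ← hW] at h3
      refine ⟨_, _, _, _, h3, ?_⟩
      obtain ⟨_, _, _, _, _, _, hCs, _, hCd, _⟩ := h3
      refine neutral_of_isSquare (hCs.map _) ?_ (n := 1) (by simp) ?_
      · rw [map_intCast_det]
        exact fun h => hCd ((ZMod.intCast_zmod_eq_zero_iff_dvd _ _).1 h)
      · rw [map_intCast_det, orthSum_det, orthSum_det]
        obtain ⟨s, hs⟩ := isSquare_two_mul_of_not_isSquare hp h5 hq₁p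
        refine ⟨2 * s, ?_⟩
        simp
        linear_combination 4 * hs
    by_cases hq2 : q = 2
    · subst hq2
      have : Fact (Nat.Prime 2) := ⟨hq⟩
      have h1 := hasRes_block (q := 2) (A := orthSum X ((p : ℤ) • B)) (C := -B)
        (orthSum_isSymm hX (hBs.smul _)) hBs.neg hXB (by
          rw [det_neg, hBd, Fintype.card_fin]; simp; omega)
      refine ⟨_, _, _, _, h1.cong ?_, ?_⟩
      · rw [← hmap, hW]
        exact (cong_orthSum_assoc X ((p : ℤ) • B) ((2 : ℤ) • -B)).map (Int.castRingHom ℚ)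
      · refine ⟨1, !![1; 0], !![1, 0], ?_, ?_, by simp⟩
        · ext i j; fin_cases i; fin_cases j; simp
        · ext i j
          fin_cases i; fin_cases j
          simp [B, binEven, mul_apply, Fin.sum_univ_two]
          exact CharP.cast_eq_zero (ZMod 2) 2
    · refine ⟨Fin 0, inferInstance, inferInstance, 0, ?_, neutral_fin_zero _⟩
      rw [← hmap]
      refine hasRes_of_not_dvd hq (Equiv.refl _) (orthSum_isSymm hX hWs) ?_
      have hp' : Prime (q : ℤ) := Nat.prime_iff_prime_int.1 hq
      rw [orthSum_det, hWd, hp'.dvd_mul, hp'.dvd_mul, hp'.dvd_mul, Int.natCast_dvd, hd]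
      rintro (h | (h | h) | h)
      · exact hqp ((Nat.prime_dvd_prime_iff_eq hq hpp).1 (hq.dvd_of_dvd_pow h))
      · exact hqp ((Nat.prime_dvd_prime_iff_eq hq hpp).1
          (Int.natCast_dvd_natCast.1 (hp'.dvd_of_dvd_pow h)))
      · have := hp'.dvd_of_dvd_pow h
        exact hq2 ((Nat.prime_dvd_prime_iff_eq hq Nat.prime_two).1
          (Int.natCast_dvd_natCast.1 this))
      · exact hqq ((Nat.prime_dvd_prime_iff_eq hq hq₁).1
          (Int.natCast_dvd_natCast.1 (hp'.dvd_of_dvd_pow h)))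

end Even

section Elementary

theorem natCard_quotient_of_elem {r q a : ℕ} [NeZero q] {M : Matrix (Fin r) (Fin r) ℤ}
    (h : Nonempty (((Fin r → ℤ) ⧸ LinearMap.range M.mulVecLin) ≃ₗ[ℤ] (Fin a → ZMod q))) :
    Nat.card ((Fin r → ℤ) ⧸ LinearMap.range M.mulVecLin) = q ^ a := by
  rw [Nat.card_congr h.some.toEquiv]; simp

theorem natAbs_det_of_elem {r q a : ℕ} [NeZero q] {M : Matrix (Fin r) (Fin r) ℤ} (hd : M.det ≠ 0)
    (h : Nonempty (((Fin r → ℤ) ⧸ LinearMap.range M.mulVecLin) ≃ₗ[ℤ] (Fin a → ZMod q))) :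
    M.det.natAbs = q ^ a := by
  have hinj : Function.Injective M.mulVecLin := by
    rw [Matrix.coe_mulVecLin]; exact Matrix.mulVec_injective_of_det_ne_zero hd
  let e := LinearEquiv.ofInjective M.mulVecLin hinj
  have h1 := Submodule.natAbs_det_equiv (LinearMap.range M.mulVecLin) e
  have h2 : (LinearMap.range M.mulVecLin).subtype ∘ₗ e = M.mulVecLin := by
    ext; simp [e]
  have h3 := natCard_quotient_of_elem h
  rw [← h3, ← h1]
  change _ = Int.natAbs (LinearMap.det ((LinearMap.range M.mulVecLin).subtype ∘ₗ (e : _ →ₗ[ℤ] _)))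
  rw [h2, ← Matrix.toLin'_apply', LinearMap.det_toLin']

theorem exists_mul_eq_of_elem {r q a : ℕ} {M : Matrix (Fin r) (Fin r) ℤ}
    (h : Nonempty (((Fin r → ℤ) ⧸ LinearMap.range M.mulVecLin) ≃ₗ[ℤ] (Fin a → ZMod q))) :
    ∃ N : Matrix (Fin r) (Fin r) ℤ, M * N = (q : ℤ) • 1 := by
  obtain ⟨f⟩ := h
  have h1 : ∀ v : Fin r → ℤ, ∃ w, M *ᵥ w = (q : ℤ) • v := fun v => by
    have : (LinearMap.range M.mulVecLin).mkQ ((q : ℤ) • v) = 0 := by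
      apply f.injective
      rw [map_smul, map_smul, map_zero]
      ext i; simp
    rw [Submodule.mkQ_apply, Submodule.Quotient.mk_eq_zero] at this
    obtain ⟨w, hw⟩ := this
    exact ⟨w, by simpa using hw⟩
  choose g hg using h1
  refine ⟨(Matrix.of fun j => g (Pi.single j 1))ᵀ, ?_⟩
  ext i j
  have := congrFun (hg (Pi.single j 1)) i
  rw [mul_apply]
  rw [mulVec, dotProduct] at this
  simpa [one_apply, Pi.single_apply] using this

theorem finrank_ker_of_elem {r q a : ℕ} [Fact q.Prime] {M : Matrix (Fin r) (Fin r) ℤ}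
    (h : Nonempty (((Fin r → ℤ) ⧸ LinearMap.range M.mulVecLin) ≃ₗ[ℤ] (Fin a → ZMod q))) :
    Module.finrank (ZMod q)
      (LinearMap.ker (M.map (Int.castRingHom (ZMod q))).mulVecLin) = a := by
  obtain ⟨N, hN⟩ := exists_mul_eq_of_elem h
  set Mb := M.map (Int.castRingHom (ZMod q)) with hMb
  let c : (Fin r → ℤ) →ₗ[ℤ] (Fin r → ZMod q) :=
    ((Int.castAddHom (ZMod q)).compLeft (Fin r)).toIntLinearMap
  have hc : ∀ v i, c v i = ((v i : ℤ) : ZMod q) := fun v i => rfl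
  have hcs : Function.Surjective c := fun v => by
    choose g hg using fun i => ZMod.intCast_surjective (v i)
    exact ⟨g, funext hg⟩
  have hcM : ∀ v, c (M *ᵥ v) = Mb *ᵥ c v := fun v => by
    ext i
    simp [hc, hMb, mulVec, dotProduct]
  let φ : (Fin r → ℤ) →ₗ[ℤ] ((Fin r → ZMod q) ⧸ LinearMap.range Mb.mulVecLin) :=
    ((LinearMap.range Mb.mulVecLin).mkQ.toAddMonoidHom.toIntLinearMap) ∘ₗ c
  have hφ : ∀ v, φ v = (LinearMap.range Mb.mulVecLin).mkQ (c v) := fun v => rfl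
  have hφs : Function.Surjective φ := (Submodule.mkQ_surjective _).comp hcs
  have hk : LinearMap.ker φ = LinearMap.range M.mulVecLin := by
    ext v
    rw [LinearMap.mem_ker, hφ, Submodule.mkQ_apply, Submodule.Quotient.mk_eq_zero]
    constructor
    · rintro ⟨w, hw⟩
      obtain ⟨w, rfl⟩ := hcs w
      rw [mulVecLin_apply, ← hcM] at hw
      have : ∀ i, ∃ t, v i - (M *ᵥ w) i = q * t := fun i => by
        have := congrFun hw i
        rw [hc, hc] at this
        exact (ZMod.intCast_eq_intCast_iff_dvd_sub _ _ _).1 this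
      choose t ht using this
      refine ⟨w + N *ᵥ t, ?_⟩
      rw [mulVecLin_apply, mulVec_add, mulVec_mulVec, hN]
      ext i
      have := ht i
      simp [-zsmul_eq_mul]
      linarith
    · rintro ⟨w, rfl⟩
      exact ⟨c w, by rw [mulVecLin_apply, mulVecLin_apply, hcM]⟩
  have h1 : Nat.card ((Fin r → ZMod q) ⧸ LinearMap.range Mb.mulVecLin) = q ^ a := by
    rw [← natCard_quotient_of_elem h, ← hk]
    exact (Nat.card_congr (φ.quotKerEquivOfSurjective hφs).toEquiv).symm
  rw [Module.natCard_eq_pow_finrank (K := ZMod q), Nat.card_zmod] at h1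
  have h2 := Nat.pow_right_injective (Fact.out : q.Prime).two_le h1
  have h3 := Submodule.finrank_quotient_add_finrank (LinearMap.range Mb.mulVecLin)
  have h4 := LinearMap.finrank_range_add_finrank_ker Mb.mulVecLin
  omega

theorem exists_hasRes_of_ker {q : ℕ} [Fact q.Prime] {μ κ : Type} [Fintype μ] [Fintype κ]
    [DecidableEq μ] [DecidableEq κ]
    {M : Matrix (μ ⊕ κ) (μ ⊕ κ) ℤ} (hs : M.IsSymm)
    (hd : M.det.natAbs = q ^ Fintype.card κ) (P : Matrix (μ ⊕ κ) (μ ⊕ κ) ℤ)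
    (hP : ¬ (q : ℤ) ∣ P.det) (hk : ∀ i j, (q : ℤ) ∣ (M * P) i (Sum.inr j)) :
    ∃ C : Matrix κ κ ℤ, HasRes q (M.map (Int.cast : ℤ → ℚ)) C := by
  have hq : q.Prime := Fact.out
  have hq' : Prime (q : ℤ) := Nat.prime_iff_prime_int.1 hq
  set T := Pᵀ * M * P with hT
  have hTs : T.IsSymm := by
    rw [IsSymm, hT, transpose_mul, transpose_mul, transpose_transpose, hs.eq, Matrix.mul_assoc]
  have hTk : ∀ i j, (q : ℤ) ∣ T i (Sum.inr j) := fun i j => by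
    rw [hT, Matrix.mul_assoc, mul_apply]
    exact Finset.dvd_sum fun k _ => (hk k j).mul_left _
  choose u hu using hTk
  let A : Matrix μ μ ℤ := T.toBlocks₁₁
  let B : Matrix μ κ ℤ := Matrix.of fun i j => u (Sum.inl i) j
  let C : Matrix κ κ ℤ := Matrix.of fun i j => u (Sum.inr i) j
  have hTe : T = fromBlocks A ((q : ℤ) • B) ((q : ℤ) • Bᵀ) ((q : ℤ) • C) := by
    ext (i | i) (j | j)
    · rfl
    · simp [B, hu, -zsmul_eq_mul]
    · rw [← hTs.apply]; simp [B, hu, -zsmul_eq_mul]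
    · simp [C, hu, -zsmul_eq_mul]
  have hCs : C.IsSymm := by
    ext i j
    have := hTs.apply (Sum.inr i) (Sum.inr j)
    rw [hu, hu] at this
    exact mul_left_cancel₀ hq'.ne_zero this
  have hAs : A.IsSymm := by
    ext i j; exact hTs.apply _ _
  let U : Matrix (μ ⊕ κ) (μ ⊕ κ) ℤ := fromBlocks A B ((q : ℤ) • Bᵀ) C
  have hTU : T = U * fromBlocks 1 0 0 ((q : ℤ) • (1 : Matrix κ κ ℤ)) := by
    rw [hTe, fromBlocks_multiply]
    simp only [Matrix.mul_one, Matrix.mul_zero, add_zero, zero_add, Matrix.mul_smul]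
  have hdet : T.det.natAbs = U.det.natAbs * q ^ Fintype.card κ := by
    rw [hTU, det_mul, det_fromBlocks_zero₂₁, det_smul]; simp [Int.natAbs_mul]
  have hdet' : T.det.natAbs = P.det.natAbs ^ 2 * q ^ Fintype.card κ := by
    rw [hT, det_mul, det_mul, det_transpose, Int.natAbs_mul, Int.natAbs_mul, hd]; ring
  have hUP : U.det.natAbs = P.det.natAbs ^ 2 :=
    Nat.eq_of_mul_eq_mul_right (pow_pos hq.pos _) (hdet.symm.trans hdet')
  have hU : ¬ (q : ℤ) ∣ U.det := by
    rw [Int.natCast_dvd, hUP]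
    intro h
    exact hP (Int.natCast_dvd.2 (hq.dvd_of_dvd_pow h))
  have hUAC : ¬ (q : ℤ) ∣ A.det * C.det := by
    intro h
    apply hU
    rw [← ZMod.intCast_zmod_eq_zero_iff_dvd, Int.cast_mul] at h
    rw [← ZMod.intCast_zmod_eq_zero_iff_dvd]
    rw [← h]
    have e1 : ∀ {α : Type _} [Fintype α] [DecidableEq α] (X : Matrix α α ℤ),
        ((X.det : ℤ) : ZMod q) = (X.map (Int.castRingHom (ZMod q))).det := fun X =>
      (Int.castRingHom (ZMod q)).map_det X
    have e2 : U.map (Int.castRingHom (ZMod q)) = fromBlocks (A.map (Int.castRingHom (ZMod q)))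
        (B.map (Int.castRingHom (ZMod q))) 0 (C.map (Int.castRingHom (ZMod q))) := by
      ext (i | i) (j | j) <;> simp [U]
    calc ((U.det : ℤ) : ZMod q) = (U.map (Int.castRingHom (ZMod q))).det := e1 U
      _ = _ := by
        rw [e2, det_fromBlocks_zero₂₁]
        rw [e1 A, e1 C]
  refine ⟨C, μ, inferInstance, inferInstance, A, B, hAs, hCs, ?_, ?_, ?_⟩
  · exact fun h => hUAC (h.mul_right _)
  · exact fun h => hUAC (h.mul_left _)
  · rw [← hTe]
    let PQ := P.map (Int.castRingHom ℚ)
    have hPQ : IsUnit PQ.det := by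
      rw [isUnit_iff_ne_zero]
      have : PQ.det = (P.det : ℚ) := ((Int.castRingHom ℚ).map_det P).symm
      rw [this]
      intro h
      apply hP
      rw [Int.cast_eq_zero] at h
      simp [h]
    refine ⟨PQ, PQ⁻¹, mul_nonsing_inv _ hPQ, nonsing_inv_mul _ hPQ, ?_⟩
    have : (T.map (Int.castRingHom ℚ)) = PQᵀ * (M.map (Int.castRingHom ℚ)) * PQ := by
      rw [hT, Matrix.map_mul, Matrix.map_mul, transpose_map]
    exact this.symm

theorem exists_hasRes_of_elem {r q a : ℕ} [Fact q.Prime] {M : Matrix (Fin r) (Fin r) ℤ}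
    (hs : M.IsSymm) (hd : M.det ≠ 0)
    (h : Nonempty (((Fin r → ℤ) ⧸ LinearMap.range M.mulVecLin) ≃ₗ[ℤ] (Fin a → ZMod q))) :
    ∃ C : Matrix (Fin a) (Fin a) ℤ, HasRes q (M.map (Int.cast : ℤ → ℚ)) C := by
  have hk := finrank_ker_of_elem h
  set W := LinearMap.ker (M.map (Int.castRingHom (ZMod q))).mulVecLin with hW
  obtain ⟨W', hWW⟩ := W.exists_isCompl
  let bW := Module.finBasisOfFinrankEq (ZMod q) W hk
  let bW' := Module.finBasis (ZMod q) W'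
  let b := (bW'.prod bW).map (Submodule.prodEquivOfIsCompl W' W hWW.symm)
  have hbk : ∀ j, (M.map (Int.castRingHom (ZMod q))) *ᵥ (b (Sum.inr j)) = 0 := fun j => by
    have : b (Sum.inr j) = (bW j : Fin r → ZMod q) := by
      simp only [b, Module.Basis.map_apply, Submodule.coe_prodEquivOfIsCompl']
      simp
    rw [this]
    exact LinearMap.mem_ker.1 (bW j).2
  let e : (Fin (Module.finrank (ZMod q) W') ⊕ Fin a) ≃ Fin r :=
    b.indexEquiv (Pi.basisFun (ZMod q) (Fin r))
  have hM := Cong.of_equiv e M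
  have hbd : IsUnit (((Pi.basisFun (ZMod q) (Fin r)).reindex e.symm).toMatrix b).det := by
    have := Module.Basis.isUnit_det ((Pi.basisFun (ZMod q) (Fin r)).reindex e.symm) b
    rwa [Module.Basis.det_apply] at this
  choose P hP using fun i j => ZMod.intCast_surjective
    (((Pi.basisFun (ZMod q) (Fin r)).reindex e.symm).toMatrix b i j)
  have hPe : ∀ i j, ((P i j : ℤ) : ZMod q) = b j (e i) := fun i j => by
    rw [hP]; simp [Module.Basis.toMatrix_apply]
  obtain ⟨C, hC⟩ := exists_hasRes_of_ker (M := M.submatrix e e) (hs.submatrix e)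
    (q := q) (by rw [det_submatrix_equiv_self, natAbs_det_of_elem hd h]; simp) (Matrix.of P) (by
      rw [← ZMod.intCast_zmod_eq_zero_iff_dvd, ← map_intCast_det]
      have : (Matrix.of P).map (Int.cast : ℤ → ZMod q) =
        ((Pi.basisFun (ZMod q) (Fin r)).reindex e.symm).toMatrix b := by
        ext i j; exact hP i j
      rw [this]; exact hbd.ne_zero) (by
      intro i j
      rw [← ZMod.intCast_zmod_eq_zero_iff_dvd, mul_apply, ]
      have := congrFun (hbk j) (e i)
      rw [mulVec, dotProduct, ← e.sum_comp] at this
      push_cast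
      simpa [hPe] using this)
  exact ⟨C, hC.cong ((hM.map (Int.castRingHom ℚ)).symm)⟩

end Elementary

section Isotropy

/-- The real hyperbolic form plus a definite form of corank two. -/
theorem neutral_real_hyperbolic {r : ℕ} {M : Matrix (Fin r) (Fin r) ℤ}
    (hh : ∃ P : Matrix (Fin r) (Fin r) ℝ, IsUnit P.det ∧ Pᵀ * (M.map (Int.cast : ℤ → ℝ)) * P =
      Matrix.diagonal (fun i : Fin r => if (i : ℕ) = 0 then (1 : ℝ) else -1))
    {κ : Type} [Fintype κ] [DecidableEq κ] {W : Matrix κ κ ℤ}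
    (hW : Cong (1 : Matrix κ κ ℝ) (W.map (Int.cast : ℤ → ℝ))) (hr : r = 2 + Fintype.card κ) :
    Neutral (((orthSum M W).map (Int.cast : ℤ → ℚ)).map (Rat.castHom ℝ)) := by
  obtain ⟨P, hP, hPM⟩ := hh
  have h1 : Cong (M.map (Int.cast : ℤ → ℝ)) _ :=
    ⟨P, P⁻¹, mul_nonsing_inv _ hP, nonsing_inv_mul _ hP, hPM⟩
  let e : Fin 2 ⊕ κ ≃ Fin r :=
    ((Equiv.sumCongr (Equiv.refl _) (Fintype.equivFin κ)).trans finSumFinEquiv).trans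
      (finCongr hr.symm)
  have h2 := h1.trans (Cong.of_equiv e _)
  have h3 : (Matrix.diagonal (fun i : Fin r => if (i : ℕ) = 0 then (1 : ℝ) else -1)).submatrix e e =
      orthSum (diagonal ![1, -1]) (-(1 : Matrix κ κ ℝ)) := by
    have : orthSum (diagonal ![1, -1]) (-(1 : Matrix κ κ ℝ)) =
        diagonal (Sum.elim ![1, -1] (fun _ => (-1 : ℝ))) := by
      rw [← orthSum_diagonal]; congr 1; ext i j; by_cases h : i = j <;> simp [h]
    rw [this, submatrix_diagonal_equiv]
    congr 1
    ext (i | i)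
    · fin_cases i <;> simp [e]
    · simp [e]
  rw [h3] at h2
  have h4 := Cong.add h2 hW.symm
  have h5 : Neutral (diagonal ![(1 : ℝ), -1]) := by
    refine ⟨1, !![1; 1], !![1, 0], ?_, ?_, by simp⟩
    · ext i j; fin_cases i; fin_cases j; simp
    · ext i j; fin_cases i; fin_cases j; simp [mul_apply, Fin.sum_univ_two]
  have h6 : Neutral (orthSum (-(1 : Matrix κ κ ℝ)) 1) :=
    (neutral_orthSum_neg (1 : Matrix κ κ ℝ)).cong (cong_orthSum_comm _ _)
  have h7 := ((h5.add h6).cong (cong_orthSum_assoc _ _ _).symm).cong h4.symm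
  convert h7 using 1
  ext (i | i) (j | j) <;> simp [orthSum]

theorem exists_isotropic_of_neutral_orthSum {K : Type*} [Field K] {ι κ : Type*} [Fintype ι]
    [Fintype κ] [DecidableEq ι] [DecidableEq κ] {X : Matrix ι ι K} {W : Matrix κ κ K}
    (h : Neutral (orthSum X W)) (hc : Fintype.card ι = 2 + Fintype.card κ) :
    ∃ v ≠ 0, v ⬝ᵥ X *ᵥ v = 0 := by
  obtain ⟨d, P, S, hSP, hP, hd⟩ := h
  rw [Fintype.card_sum, hc] at hd
  let Q : Matrix κ (Fin d) K := P.submatrix Sum.inr id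
  have : ∃ c : Fin d → K, c ≠ 0 ∧ Q *ᵥ c = 0 := by
    by_contra! hcon
    have hinj : Function.Injective Q.mulVecLin := by
      rw [← LinearMap.ker_eq_bot, LinearMap.ker_eq_bot']
      intro c hc
      by_contra h0
      exact hcon c h0 hc
    have := LinearMap.finrank_le_finrank_of_injective hinj
    simp at this
    omega
  obtain ⟨c, hc0, hQ⟩ := this
  have hPc : P *ᵥ c = Sum.elim (fun i => (P *ᵥ c) (Sum.inl i)) 0 := by
    ext (i | i)
    · rfl
    · exact congrFun hQ i
  refine ⟨fun i => (P *ᵥ c) (Sum.inl i), fun h0 => hc0 ?_, ?_⟩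
  · have h1 : P *ᵥ c = 0 := by rw [hPc, h0]; ext (i | i) <;> rfl
    have h2 := congrArg (S *ᵥ ·) h1
    simpa [mulVec_mulVec, hSP] using h2
  · have h1 : (P *ᵥ c) ⬝ᵥ (orthSum X W) *ᵥ (P *ᵥ c) = 0 := by
      have : c ⬝ᵥ ((Pᵀ * orthSum X W * P) *ᵥ c) = 0 := by rw [hP]; simp
      rw [← this, ← mulVec_mulVec, ← mulVec_mulVec, dotProduct_mulVec c, vecMul_transpose]
    rw [hPc, orthSum, fromBlocks_mulVec] at h1
    simpa [dotProduct, Fintype.sum_sum_type] using h1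

theorem two_dvd_det_of_odd_card {r : ℕ} (hr : Odd r) {M : Matrix (Fin r) (Fin r) ℤ}
    (hs : M.IsSymm) (he : ∀ i, Even (M i i)) : (2 : ℤ) ∣ M.det := by
  let A : Matrix (Fin r) (Fin r) ℤ := Matrix.of fun i j =>
    if i < j then M i j else if j < i then -M i j else 0
  have hA : Aᵀ = -A := by
    ext i j
    simp only [A, transpose_apply, of_apply, neg_apply]
    have := hs.apply i j
    rcases lt_trichotomy i j with h | h | h
    · simp [h, h.not_gt, this]
    · simp [h]
    · simp [h, h.not_gt, this]
  have hdA : A.det = 0 := by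
    have h := congrArg det hA
    rw [det_transpose, det_neg, Fintype.card_fin, hr.neg_one_pow] at h
    linarith
  have hMA : M.map (Int.cast : ℤ → ZMod 2) = A.map (Int.cast : ℤ → ZMod 2) := by
    ext i j
    have h2 : ∀ x : ZMod 2, -x = x := by decide
    simp only [A, map_apply, of_apply]
    rcases lt_trichotomy i j with h | h | h
    · simp [h]
    · subst h
      simpa using (ZMod.intCast_zmod_eq_zero_iff_dvd _ 2).2 (he i).two_dvd
    · simp [h, h.not_gt, h2]
  have := map_intCast_det (p := 2) M
  rw [hMA, map_intCast_det, hdA, Int.cast_zero] at this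
  exact_mod_cast (ZMod.intCast_zmod_eq_zero_iff_dvd _ 2).1 this.symm

theorem exists_det_eq_sq_add {M : Matrix (Fin 4) (Fin 4) ℤ}
    (hs : M.IsSymm) (he : ∀ i, Even (M i i)) : ∃ s k : ℤ, M.det = s ^ 2 + 4 * k := by
  choose d hd using he
  have h10 := hs.apply 0 1
  have h20 := hs.apply 0 2
  have h30 := hs.apply 0 3
  have h21 := hs.apply 1 2
  have h31 := hs.apply 1 3
  have h32 := hs.apply 2 3
  refine ⟨M 0 1 * M 2 3 + M 0 2 * M 1 3 + M 0 3 * M 1 2,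
    -(M 0 1 * M 2 3 * (M 0 2 * M 1 3) + M 0 1 * M 2 3 * (M 0 3 * M 1 2)
        + M 0 2 * M 1 3 * (M 0 3 * M 1 2))
      + d 0 * M 1 2 * M 2 3 * M 1 3 + d 1 * M 0 2 * M 2 3 * M 0 3 + d 2 * M 0 1 * M 1 3 * M 0 3
      + d 3 * M 0 1 * M 1 2 * M 0 2
      - (M 0 1 ^ 2 * d 2 * d 3 + M 0 2 ^ 2 * d 1 * d 3 + M 0 3 ^ 2 * d 1 * d 2
        + M 1 2 ^ 2 * d 0 * d 3 + M 1 3 ^ 2 * d 0 * d 2 + M 2 3 ^ 2 * d 0 * d 1)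
      + 4 * d 0 * d 1 * d 2 * d 3, ?_⟩
  rw [det_succ_row_zero]
  simp only [Fin.sum_univ_four, det_fin_three, submatrix_apply]
  simp [Fin.succAbove, Fin.lt_def, hd, h10, h20, h30, h21, h31, h32]
  ring

theorem cong_one_orthSum {κ μ : Type} [Fintype κ] [DecidableEq κ] [Fintype μ] [DecidableEq μ]
    {W : Matrix κ κ ℤ} {U : Matrix μ μ ℤ} (hW : Cong (1 : Matrix κ κ ℝ) (W.map (Int.cast : ℤ → ℝ)))
    (hU : Cong (1 : Matrix μ μ ℝ) (U.map (Int.cast : ℤ → ℝ))) :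
    Cong (1 : Matrix (κ ⊕ μ) (κ ⊕ μ) ℝ) ((orthSum W U).map (Int.cast : ℤ → ℝ)) := by
  convert Cong.add hW hU using 1
  · rw [orthSum, fromBlocks_one]
  · exact orthSum_map (Int.castRingHom ℝ) W U

theorem cong_one_smul {κ : Type} [Fintype κ] [DecidableEq κ]
    {W : Matrix κ κ ℤ} (hW : Cong (1 : Matrix κ κ ℝ) (W.map (Int.cast : ℤ → ℝ))) {n : ℤ}
    (hn : 0 < n) :
    Cong (1 : Matrix κ κ ℝ) ((n • W).map (Int.cast : ℤ → ℝ)) := by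
  obtain ⟨P, S, h1, h2, h3⟩ := hW
  have hn' : (0 : ℝ) < n := by exact_mod_cast hn
  have hs : √(n : ℝ) ≠ 0 := (Real.sqrt_pos.2 hn').ne'
  refine ⟨√(n : ℝ) • P, (√(n : ℝ))⁻¹ • S, ?_, ?_, ?_⟩
  · rw [Matrix.smul_mul, Matrix.mul_smul, smul_smul, h1, mul_inv_cancel₀ hs, one_smul]
  · rw [Matrix.smul_mul, Matrix.mul_smul, smul_smul, h2, inv_mul_cancel₀ hs, one_smul]
  · rw [transpose_smul, Matrix.smul_mul, Matrix.smul_mul, Matrix.mul_smul, smul_smul, h3,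
      Real.mul_self_sqrt hn'.le]
    ext i j; simp [-zsmul_eq_mul]

theorem cong_one_one {κ : Type} [Fintype κ] [DecidableEq κ] :
    Cong (1 : Matrix κ κ ℝ) ((1 : Matrix κ κ ℤ).map (Int.cast : ℤ → ℝ)) := by
  rw [Matrix.map_one _ Int.cast_zero Int.cast_one]
  exact Cong.refl _

theorem cong_one_binEven {t : ℤ} (ht : 0 < t) :
    Cong (1 : Matrix (Fin 2) (Fin 2) ℝ) ((binEven t).map (Int.cast : ℤ → ℝ)) := by
  have h2 : (0 : ℝ) < 2 := by norm_num
  have ht1 : (1 : ℝ) ≤ t := by exact_mod_cast ht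
  have ht' : (0 : ℝ) < 2 * t - 1 / 2 := by linarith
  obtain ⟨x, hx0, hx⟩ : ∃ x : ℝ, x ≠ 0 ∧ x * x = 2 :=
    ⟨√2, (Real.sqrt_pos.2 h2).ne', Real.mul_self_sqrt h2.le⟩
  obtain ⟨y, hy0, hy⟩ : ∃ y : ℝ, y ≠ 0 ∧ y * y = 2 * t - 1 / 2 :=
    ⟨_, (Real.sqrt_pos.2 ht').ne', Real.mul_self_sqrt ht'.le⟩
  have hu : IsUnit (!![x, x / 2; 0, y]).det := by
    rw [det_fin_two_of, isUnit_iff_ne_zero]; simpa using ⟨hx0, hy0⟩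
  refine ⟨!![x, x / 2; 0, y], (!![x, x / 2; 0, y])⁻¹, mul_nonsing_inv _ hu,
    nonsing_inv_mul _ hu, ?_⟩
  ext i j
  fin_cases i <;> fin_cases j <;> simp [mul_apply, Fin.sum_univ_two, binEven]
  · linarith
  · linarith
  · linarith
  · linear_combination hy + hx / 4

end Isotropy

section Isotropy

variable {r p a : ℕ} [Fact p.Prime] {M : Matrix (Fin r) (Fin r) ℤ}

theorem exists_isotropic_of_neutral_intCast {κ : Type} [Fintype κ] [DecidableEq κ]
    {W : Matrix κ κ ℤ} (hr : r = 2 + Fintype.card κ)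
    (h : Neutral ((orthSum M W).map (Int.cast : ℤ → ℚ))) :
    ∃ v : Fin r → ℚ, v ≠ 0 ∧ v ⬝ᵥ (M.map (Int.cast : ℤ → ℚ)) *ᵥ v = 0 := by
  have e : (orthSum M W).map (Int.cast : ℤ → ℚ) =
      orthSum (M.map (Int.cast : ℤ → ℚ)) (W.map (Int.cast : ℤ → ℚ)) :=
    orthSum_map (Int.castRingHom ℚ) M W
  rw [e] at h
  exact exists_isotropic_of_neutral_orthSum h (by simpa using hr)

theorem isSymm_intCast_smul_one {κ : Type} [DecidableEq κ] (c : ℤ) :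
    (c • (1 : Matrix κ κ ℤ)).IsSymm := isSymm_one.smul c

theorem exists_isotropic_of_isSquare (hp : p ≠ 2) (hs : M.IsSymm)
    (hh : ∃ P : Matrix (Fin r) (Fin r) ℝ, IsUnit P.det ∧ Pᵀ * (M.map (Int.cast : ℤ → ℝ)) * P =
      Matrix.diagonal (fun i : Fin r => if (i : ℕ) = 0 then (1 : ℝ) else -1))
    (hd : M.det.natAbs = p ^ a) {C : Matrix (Fin a) (Fin a) ℤ}
    (hC : HasRes p (M.map (Int.cast : ℤ → ℚ)) C) {m n k : ℕ} (hr : r = 2 + (m + n))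
    (hk : a + n = 2 * k) (hsq : IsSquare ((-1) ^ k * (C.det : ZMod p))) :
    ∃ v : Fin r → ℚ, v ≠ 0 ∧ v ⬝ᵥ (M.map (Int.cast : ℤ → ℚ)) *ᵥ v = 0 := by
  have hpp : p.Prime := Fact.out
  have hp1 : ¬ (p : ℤ) ∣ 1 := fun h => hpp.one_lt.ne'
    (by exact_mod_cast Int.eq_one_of_dvd_one (by positivity) h)
  let W : Matrix (Fin m ⊕ Fin n) (Fin m ⊕ Fin n) ℤ := orthSum 1 ((p : ℤ) • 1)
  have hWs : W.IsSymm := orthSum_isSymm isSymm_one (isSymm_intCast_smul_one _)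
  have hW : HasRes p (W.map (Int.cast : ℤ → ℚ)) (1 : Matrix (Fin n) (Fin n) ℤ) :=
    hasRes_block isSymm_one isSymm_one (by simpa using hp1) (by simpa using hp1)
  have hCW := hC.add hpp hW
  have e : (orthSum M W).map (Int.cast : ℤ → ℚ) =
      orthSum (M.map (Int.cast : ℤ → ℚ)) (W.map (Int.cast : ℤ → ℚ)) :=
    orthSum_map (Int.castRingHom ℚ) M W
  rw [← e] at hCW
  refine exists_isotropic_of_neutral_intCast (W := W) (by simpa using hr) ?_
  refine neutral_of_residue_isSquare (orthSum_isSymm hs hWs) hp (e := a + n) ?_ hCW (n := k)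
    (by simpa using hk) ?_ ?_
  · rw [orthSum_det, Int.natAbs_mul, hd, orthSum_det, det_smul, det_one, det_one]
    simp [Int.natAbs_pow, pow_add]
  · rw [orthSum_det, det_one, mul_one]; exact hsq
  · refine neutral_real_hyperbolic hh (cong_one_orthSum cong_one_one
      (cong_one_smul cong_one_one (by exact_mod_cast hpp.pos))) (by simpa using hr)

theorem exists_prime_three_mod_four (hp : p % 4 = 1) :
    ∃ q : ℕ, q.Prime ∧ q ≠ p ∧ q ≠ 2 ∧ ¬ IsSquare (q : ZMod p) ∧ IsSquare (-(p : ZMod q)) := by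
  have hp2 : p ≠ 2 := by rintro rfl; omega
  obtain ⟨b, hb⟩ := exists_not_isSquare hp2
  have hb0 : b ≠ 0 := fun h => hb (h ▸ IsSquare.zero)
  have hcop : Nat.Coprime 4 p := by
    have : Nat.Coprime 2 p := (Nat.coprime_primes Nat.prime_two Fact.out).2 hp2.symm
    exact this.pow_left 2
  have : NeZero p := ⟨(Fact.out : p.Prime).ne_zero⟩
  obtain ⟨q, _, hq, h4, hqb⟩ := exists_prime_cast_eq hcop (a := 3) (b := b) (by decide)
    (isUnit_iff_ne_zero.2 hb0) 0
  have h4' : q % 4 = 3 := by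
    have : ((q : ℕ) : ZMod 4) = ((3 : ℕ) : ZMod 4) := by exact_mod_cast h4
    exact (ZMod.natCast_eq_natCast_iff' _ _ _).1 this
  have : Fact q.Prime := ⟨hq⟩
  have hqp : q ≠ p := by rintro rfl; omega
  have hns : ¬ IsSquare (q : ZMod p) := by rwa [hqb]
  refine ⟨q, hq, hqp, by rintro rfl; omega, hns, ?_⟩
  rw [← neg_one_mul]
  apply isSquare_mul_of_not_isSquare
  · rw [ZMod.exists_sq_eq_neg_one_iff]; omega
  · rwa [← ZMod.exists_sq_eq_prime_iff_of_mod_four_eq_one hp (by rintro rfl; omega)]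

theorem exists_isotropic_of_not_isSquare (hp : p % 4 = 1) (hs : M.IsSymm)
    (hh : ∃ P : Matrix (Fin r) (Fin r) ℝ, IsUnit P.det ∧ Pᵀ * (M.map (Int.cast : ℤ → ℝ)) * P =
      Matrix.diagonal (fun i : Fin r => if (i : ℕ) = 0 then (1 : ℝ) else -1))
    (hd : M.det.natAbs = p ^ a) {C : Matrix (Fin a) (Fin a) ℤ}
    (hC : HasRes p (M.map (Int.cast : ℤ → ℚ)) C) {m n k : ℕ} (hr : r = 2 + ((m + n) + 2))
    (hk : a + (n + 1) = 2 * k) (hsq : ¬ IsSquare ((-1) ^ k * (C.det : ZMod p))) :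
    ∃ v : Fin r → ℚ, v ≠ 0 ∧ v ⬝ᵥ (M.map (Int.cast : ℤ → ℚ)) *ᵥ v = 0 := by
  have hpp : p.Prime := Fact.out
  have hp2 : p ≠ 2 := by rintro rfl; omega
  have h2p : Invertible (2 : ZMod p) := invertibleOfNonzero (by
    intro h
    have : (p : ℤ) ∣ 2 := (ZMod.intCast_zmod_eq_zero_iff_dvd 2 p).1 (by exact_mod_cast h)
    exact hp2 ((Nat.prime_dvd_prime_iff_eq hpp Nat.prime_two).1 (by exact_mod_cast this)))
  have hp1 : ∀ {l : ℕ}, l.Prime → ¬ (l : ℤ) ∣ 1 := fun {l} hl h => hl.one_lt.ne'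
    (by exact_mod_cast Int.eq_one_of_dvd_one (by positivity) h)
  obtain ⟨q, hq, hqp, hq2, hns, hqs⟩ := exists_prime_three_mod_four hp
  have : Fact q.Prime := ⟨hq⟩
  have hpq : ∀ {l l' : ℕ}, l.Prime → l'.Prime → l ≠ l' → ∀ n : ℕ, ¬ (l : ℤ) ∣ (l' : ℤ) ^ n :=
    fun {l l'} hl hl' hne n h => hne ((Nat.prime_dvd_prime_iff_eq hl hl').1
      (Int.natCast_dvd_natCast.1 ((Nat.prime_iff_prime_int.1 hl).dvd_of_dvd_pow h)))
  let W₁ : Matrix (Fin m ⊕ Fin n) (Fin m ⊕ Fin n) ℤ := orthSum 1 ((p : ℤ) • 1)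
  let W₂ : Matrix (Fin 1 ⊕ Fin 1) (Fin 1 ⊕ Fin 1) ℤ := orthSum 1 ((p : ℤ) • 1)
  let W := orthSum W₁ ((q : ℤ) • W₂)
  have hW₁ : W₁.IsSymm := orthSum_isSymm isSymm_one (isSymm_intCast_smul_one _)
  have hW₂ : W₂.IsSymm := orthSum_isSymm isSymm_one (isSymm_intCast_smul_one _)
  have hWs : W.IsSymm := orthSum_isSymm hW₁ (hW₂.smul _)
  have hd₁ : W₁.det = p ^ n := by
    simp only [W₁, orthSum_det, det_smul, det_one]; simp
  have hd₂ : W₂.det = p := by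
    simp only [W₂, orthSum_det, det_smul, det_one]; simp
  have hdW : W.det = p ^ n * (q ^ 2 * p) := by
    simp only [W, orthSum_det, hd₁, hd₂, det_smul]; simp
  have hmap : ∀ {α β : Type} [Fintype α] [Fintype β] [DecidableEq α] [DecidableEq β]
      (G : Matrix α α ℤ) (H : Matrix β β ℤ), (orthSum G H).map (Int.cast : ℤ → ℚ) =
        orthSum (G.map (Int.cast : ℤ → ℚ)) (H.map (Int.cast : ℤ → ℚ)) :=
    fun G H => orthSum_map (Int.castRingHom ℚ) G H
  have hX0 : (orthSum M W).det ≠ 0 := by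
    rw [orthSum_det, hdW]
    have h1 : M.det ≠ 0 := by
      rw [← Int.natAbs_ne_zero, hd]; exact (pow_pos hpp.pos _).ne'
    have h2 : (p : ℤ) ≠ 0 := by exact_mod_cast hpp.ne_zero
    have h3 : (q : ℤ) ≠ 0 := by exact_mod_cast hq.ne_zero
    positivity
  have hWp : HasRes p (W.map (Int.cast : ℤ → ℚ))
      (orthSum (1 : Matrix (Fin n) (Fin n) ℤ) ((q : ℤ) • (1 : Matrix (Fin 1) (Fin 1) ℤ))) := by
    rw [hmap]
    refine HasRes.add hpp (hasRes_block isSymm_one isSymm_one (by simpa using hp1 hpp)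
      (by simpa using hp1 hpp)) ?_
    have : (q : ℤ) • W₂ = orthSum ((q : ℤ) • 1) ((p : ℤ) • ((q : ℤ) • 1)) := by
      rw [smul_comm (p : ℤ)]
      simp only [W₂, orthSum, fromBlocks_smul, smul_zero]
    rw [this]
    have hq1 : ¬ (p : ℤ) ∣ ((q : ℤ) • (1 : Matrix (Fin 1) (Fin 1) ℤ)).det := by
      rw [det_smul, det_one, mul_one]
      exact hpq hpp hq hqp.symm _
    exact hasRes_block (isSymm_intCast_smul_one _) (isSymm_intCast_smul_one _) hq1 hq1
  refine exists_isotropic_of_neutral_intCast (W := W) (by simpa using hr) ?_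
  refine neutral_of_resTrivial ((orthSum_isSymm hs hWs).map _) ?_ ?_ fun l hl => ?_
  · have : ((orthSum M W).map (Int.cast : ℤ → ℚ)).det = ((orthSum M W).det : ℚ) :=
      ((Int.castRingHom ℚ).map_det _).symm
    rw [this]; exact_mod_cast hX0
  · have hq0 : (0 : ℤ) < q := by exact_mod_cast hq.pos
    have hp0 : (0 : ℤ) < p := by exact_mod_cast hpp.pos
    exact neutral_real_hyperbolic hh (cong_one_orthSum (cong_one_orthSum cong_one_one
      (cong_one_smul cong_one_one hp0)) (cong_one_smul (cong_one_orthSum cong_one_one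
      (cong_one_smul cong_one_one hp0)) hq0)) (by simpa using hr)
  have hl' : Prime (l : ℤ) := Nat.prime_iff_prime_int.1 hl
  by_cases hlp : l = p
  · subst hlp
    have h3 := hC.add hl hWp
    rw [← hmap] at h3
    refine ⟨_, _, _, _, h3, ?_⟩
    obtain ⟨_, _, _, _, _, _, hCs, _, hCd, _⟩ := h3
    refine neutral_of_isSquare (hCs.map _) ?_ (n := k) (by simpa using hk) ?_
    · rw [map_intCast_det]
      exact fun h => hCd ((ZMod.intCast_zmod_eq_zero_iff_dvd _ _).1 h)
    · rw [map_intCast_det, orthSum_det, orthSum_det, det_smul]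
      have := isSquare_mul_of_not_isSquare hsq hns
      simpa [mul_assoc] using this
  have hMl := hasRes_zero_of_natAbs_det hs hpp hd hl hlp
  by_cases hlq : l = q
  · subst hlq
    have h2l : Invertible (2 : ZMod l) := invertibleOfNonzero (by
      intro h
      have : (l : ℤ) ∣ 2 := (ZMod.intCast_zmod_eq_zero_iff_dvd 2 l).1 (by exact_mod_cast h)
      exact hq2 ((Nat.prime_dvd_prime_iff_eq hl Nat.prime_two).1 (by exact_mod_cast this)))
    have h3 := hMl.add hl (hasRes_block (q := l) hW₁ hW₂ (by rw [hd₁]; exact hpq hl hpp hlp _)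
      (by rw [hd₂]; simpa using hpq hl hpp hlp 1))
    rw [← hmap] at h3
    refine ⟨_, _, _, _, h3, ?_⟩
    obtain ⟨_, _, _, _, _, _, hCs, _, hCd, _⟩ := h3
    refine neutral_of_isSquare (hCs.map _) ?_ (n := 1) (by simp) ?_
    · rw [map_intCast_det]
      exact fun h => hCd ((ZMod.intCast_zmod_eq_zero_iff_dvd _ _).1 h)
    · rw [map_intCast_det, orthSum_det, hd₂]
      simpa using hqs
  · refine ⟨Fin 0, inferInstance, inferInstance, 0, ?_, neutral_fin_zero _⟩
    refine hasRes_of_not_dvd hl (Equiv.refl _) (orthSum_isSymm hs hWs) ?_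
    rw [orthSum_det, hdW, hl'.dvd_mul, hl'.dvd_mul, hl'.dvd_mul, Int.natCast_dvd, hd]
    rintro (h | h | h | h)
    · exact hpq hl hpp hlp a (Int.natCast_dvd.2 (by simpa [Int.natAbs_pow] using h))
    · exact hpq hl hpp hlp _ h
    · exact hpq hl hq hlq _ h
    · exact hpq hl hpp hlp 1 (by simpa using h)

theorem hasRes_binEven {t : ℤ} (ht : (p : ℤ) = 4 * t - 1) :
    HasRes p ((binEven t).map (Int.cast : ℤ → ℚ)) (diagonal fun _ : Fin 1 => (2 : ℤ)) := by
  have hpp : p.Prime := Fact.out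
  have hp2 : ¬ (p : ℤ) ∣ 2 := fun h => by
    have := (Nat.prime_dvd_prime_iff_eq hpp Nat.prime_two).1 (by exact_mod_cast h)
    omega
  have h1 := hasRes_block (q := p) (A := diagonal fun _ : Fin 1 => (2 : ℤ))
    (C := diagonal fun _ : Fin 1 => (2 : ℤ)) (isSymm_diagonal _) (isSymm_diagonal _)
    (by simpa using hp2) (by simpa using hp2)
  refine h1.cong ?_
  refine Cong.symm ?_
  have h2 := (cong_binEven t).trans
    (Cong.of_equiv (finSumFinEquiv (m := 1) (n := 1)) (diagonal ![(2 : ℚ), 2 * (4 * (t : ℚ) - 1)]))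
  convert h2 using 1
  have hpt : (p : ℚ) = 4 * t - 1 := by exact_mod_cast ht
  ext (i | i) (j | j) <;> fin_cases i <;> fin_cases j <;>
    simp [orthSum, -zsmul_eq_mul, -natCast_zsmul, -nsmul_eq_mul, finSumFinEquiv, hpt]
  ring

theorem det_map_real_sign
    (hh : ∃ P : Matrix (Fin r) (Fin r) ℝ, IsUnit P.det ∧ Pᵀ * (M.map (Int.cast : ℤ → ℝ)) * P =
      Matrix.diagonal (fun i : Fin r => if (i : ℕ) = 0 then (1 : ℝ) else -1)) (hr : 0 < r) :
    0 < (-1) ^ (r - 1) * M.det := by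
  obtain ⟨P, hP, h⟩ := hh
  obtain ⟨s, rfl⟩ := Nat.exists_eq_succ_of_ne_zero hr.ne'
  have h1 := congrArg det h
  rw [det_mul, det_mul, det_transpose, det_diagonal, Fin.prod_univ_succ] at h1
  have h2 : (M.map (Int.cast : ℤ → ℝ)).det = (M.det : ℝ) := ((Int.castRingHom ℝ).map_det M).symm
  rw [h2] at h1
  simp at h1
  have h3 : ((-1 : ℝ) ^ s * M.det) * P.det ^ 2 = 1 := by
    have : ((-1 : ℝ) ^ s) ^ 2 = 1 := by rw [← pow_mul, mul_comm, pow_mul]; simp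
    linear_combination (-1 : ℝ) ^ s * h1 + this
  have h4 : 0 < (-1 : ℝ) ^ s * M.det := by
    by_contra! h0
    nlinarith [sq_nonneg P.det]
  have h5 : (0 : ℝ) < (((-1) ^ s * M.det : ℤ) : ℝ) := by
    rw [Int.cast_mul]
    simpa only [Int.cast_pow, Int.cast_neg, Int.cast_one] using h4
  simpa using Int.cast_pos.1 h5

theorem exists_isotropic (hr : 3 ≤ r) (hp : p ≠ 2) (hs : M.IsSymm) (he : ∀ i, Even (M i i))
    (hh : ∃ P : Matrix (Fin r) (Fin r) ℝ, IsUnit P.det ∧ Pᵀ * (M.map (Int.cast : ℤ → ℝ)) * P =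
      Matrix.diagonal (fun i : Fin r => if (i : ℕ) = 0 then (1 : ℝ) else -1))
    (hd : M.det.natAbs = p ^ a) {C : Matrix (Fin a) (Fin a) ℤ}
    (hC : HasRes p (M.map (Int.cast : ℤ → ℚ)) C) :
    ∃ v : Fin r → ℚ, v ≠ 0 ∧ v ⬝ᵥ (M.map (Int.cast : ℤ → ℚ)) *ᵥ v = 0 := by
  have hpp : p.Prime := Fact.out
  have hpo : Odd p := hpp.odd_of_ne_two hp
  have hre : ¬ Odd r := fun h => by
    have h1 := two_dvd_det_of_odd_card h hs he
    have h2 : Odd M.det.natAbs := hd ▸ hpo.pow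
    rw [Int.natAbs_odd] at h2
    exact (Int.not_even_iff_odd.2 h2) (even_iff_two_dvd.2 h1)
  have h4 : r = 4 ∨ 6 ≤ r := by
    rcases Nat.even_or_odd' r with ⟨k, rfl | rfl⟩
    · omega
    · exact absurd ⟨k, rfl⟩ hre
  have hp4 : p % 4 = 1 ∨ p % 4 = 3 := by rcases hpo with ⟨k, rfl⟩; omega
  rcases h4 with rfl | h6
  · obtain ⟨s, k, hsk⟩ := exists_det_eq_sq_add hs he
    have hsgn := det_map_real_sign hh (by norm_num)
    have hdet : M.det = -(p : ℤ) ^ a := by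
      have : (M.det.natAbs : ℤ) = (p : ℤ) ^ a := by rw [hd]; push_cast; rfl
      rw [← this]
      norm_num at hsgn
      omega
    have hs4 : s ^ 2 % 4 = 0 ∨ s ^ 2 % 4 = 1 := by
      rcases Int.even_or_odd' s with ⟨c, rfl | rfl⟩
      · left; ring_nf; omega
      · right; ring_nf; omega
    have hpa : ((p : ℤ) ^ a) % 4 = 3 := by
      have : Odd ((p : ℤ) ^ a) := by exact_mod_cast hpo.pow
      obtain ⟨c, hc⟩ := this
      omega
    have hp3 : p % 4 = 3 := by
      rcases hp4 with h | h
      · exfalso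
        have : (p : ℤ) ≡ 1 [ZMOD 4] := by unfold Int.ModEq; omega
        have h2 := this.pow a
        unfold Int.ModEq at h2
        simp at h2
        omega
      · exact h
    have hao : Odd a := by
      by_contra hae
      obtain ⟨b, rfl⟩ := Nat.not_odd_iff_even.1 hae
      have : (p : ℤ) * p ≡ 1 [ZMOD 4] := by
        have h1 : (p : ℤ) ≡ -1 [ZMOD 4] := by unfold Int.ModEq; omega
        simpa using h1.mul h1
      have h2 := this.pow b
      rw [mul_pow, ← pow_add, one_pow] at h2
      unfold Int.ModEq at h2
      omega
    obtain ⟨t, ht⟩ : ∃ t : ℤ, (p : ℤ) = 4 * t - 1 := ⟨(p + 1) / 4, by omega⟩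
    have ht0 : 0 < t := by have := hpp.pos; omega
    have e : (orthSum M (binEven t)).map (Int.cast : ℤ → ℚ) =
        orthSum (M.map (Int.cast : ℤ → ℚ)) ((binEven t).map (Int.cast : ℤ → ℚ)) :=
      orthSum_map (Int.castRingHom ℚ) M _
    have h3 := hC.add hpp (hasRes_binEven ht)
    rw [← e] at h3
    refine exists_isotropic_of_neutral_intCast (W := binEven t) (by simp) ?_
    obtain ⟨b, rfl⟩ := hao
    refine neutral_of_even (orthSum_isSymm hs (binEven_isSymm t)) (orthSum_even he (binEven_even t))
      hp (e := (2 * b + 1) + 1) ?_ h3 (n := b + 1) (by simp; ring) ?_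
    · rw [orthSum_det, Int.natAbs_mul, hd, binEven_det, ← ht, Int.natAbs_natCast, ← pow_succ]
    · exact neutral_real_hyperbolic hh (cong_one_binEven ht0) (by simp)
  · have hneg : p % 4 = 3 → ∀ k : ℕ, ¬ IsSquare ((-1) ^ k * (C.det : ZMod p)) →
        IsSquare ((-1) ^ (k + 1) * (C.det : ZMod p)) := fun h3 k hk => by
      have : ¬ IsSquare (-1 : ZMod p) := by rw [ZMod.exists_sq_eq_neg_one_iff]; omega
      have := isSquare_mul_of_not_isSquare this hk
      rwa [← mul_assoc, ← pow_succ'] at this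
    rcases Nat.even_or_odd' a with ⟨k, hk | hk⟩
    · by_cases hsq : IsSquare ((-1) ^ k * (C.det : ZMod p))
      · exact exists_isotropic_of_isSquare hp hs hh hd hC (m := r - 2) (n := 0) (by omega)
          (by omega) hsq
      rcases hp4 with h | h
      · have hsq' : ¬ IsSquare ((-1) ^ (k + 1) * (C.det : ZMod p)) := fun hq => hsq (by
          have h1 : IsSquare (-1 : ZMod p) := by rw [ZMod.exists_sq_eq_neg_one_iff]; omega
          have := h1.mul hq
          rw [← mul_assoc, ← pow_succ'] at this
          simpa [pow_succ] using this)
        exact exists_isotropic_of_not_isSquare h hs hh hd hC (m := r - 5) (n := 1) (by omega)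
          (by omega) hsq'
      · exact exists_isotropic_of_isSquare hp hs hh hd hC (m := r - 4) (n := 2) (by omega)
          (by omega) (hneg h k hsq)
    · by_cases hsq : IsSquare ((-1) ^ (k + 1) * (C.det : ZMod p))
      · exact exists_isotropic_of_isSquare hp hs hh hd hC (m := r - 3) (n := 1) (by omega)
          (by omega) hsq
      rcases hp4 with h | h
      · exact exists_isotropic_of_not_isSquare h hs hh hd hC (m := r - 4) (n := 0) (by omega)
          (by omega) hsq
      · exact exists_isotropic_of_isSquare hp hs hh hd hC (m := r - 5) (n := 3) (by omega)
          (by omega) (hneg h _ hsq)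

end Isotropy

section Lagrangian

variable {K V V' : Type*} [Field K] [AddCommGroup V] [Module K V] [AddCommGroup V'] [Module K V']
  [FiniteDimensional K V] [FiniteDimensional K V']
  {B : V →ₗ[K] V →ₗ[K] K} {B' : V' →ₗ[K] V' →ₗ[K] K}

/-- A Lagrangian meeting the first factor trivially is the graph of an isometry. -/
theorem exists_isometry_of_graph (L : Submodule K (V × V'))
    (hL : ∀ x ∈ L, ∀ y ∈ L, B x.1 y.1 = B' x.2 y.2)
    (hd : Module.finrank K V' ≤ Module.finrank K L) (h0 : ∀ x : V, (x, (0 : V')) ∈ L → x = 0) :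
    ∃ f : V' →ₗ[K] V, ∀ x y, B (f x) (f y) = B' x y := by
  let φ : L →ₗ[K] V' := LinearMap.snd K V V' ∘ₗ L.subtype
  have hφ : ∀ x : L, φ x = (x : V × V').2 := fun x => rfl
  have hinj : Function.Injective φ := by
    rw [← LinearMap.ker_eq_bot, LinearMap.ker_eq_bot']
    rintro ⟨⟨x, y⟩, hx⟩ h
    have hy : y = 0 := h
    subst hy
    have := h0 x hx
    subst this
    rfl
  have hrange : LinearMap.range φ = ⊤ := by
    apply Submodule.eq_top_of_finrank_eq
    apply le_antisymm (Submodule.finrank_le _)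
    rwa [LinearMap.finrank_range_of_inj hinj]
  obtain ⟨g, hg⟩ := φ.exists_rightInverse_of_surjective hrange
  have hg' : ∀ x, ((g x : L) : V × V').2 = x := fun x => LinearMap.congr_fun hg x
  refine ⟨LinearMap.fst K V V' ∘ₗ L.subtype ∘ₗ g, fun x y => ?_⟩
  have := hL _ (g x).2 _ (g y).2
  rw [hg', hg'] at this
  exact this

theorem exists_isotropic_dual (hB : ∀ x y, B x y = B y x)
    (hnd : ∀ x, x ≠ 0 → ∃ y, B x y ≠ 0) (h2 : (2 : K) ≠ 0) {v : V} (hv : v ≠ 0) (hvv : B v v = 0) :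
    ∃ w, B v w = 1 ∧ B w w = 0 := by
  obtain ⟨y, hy⟩ := hnd v hv
  refine ⟨(B v y)⁻¹ • y - (((B v y)⁻¹) ^ 2 * B y y / 2) • v, ?_, ?_⟩
  · simp [hvv, hy]
  · simp only [map_sub, map_smul, LinearMap.sub_apply, LinearMap.smul_apply, smul_eq_mul, hvv,
      hB y v]
    field_simp
    ring

/-- An equal-dimensional neutral difference of forms, the first of Witt index at most one, gives an
isometry. -/
theorem exists_isometry_of_lagrangian (hB : ∀ x y, B x y = B y x) (hB' : ∀ x y, B' x y = B' y x)
    (hnd : ∀ x, x ≠ 0 → ∃ y, B x y ≠ 0) (hnd' : ∀ x, x ≠ 0 → ∃ y, B' x y ≠ 0) (h2 : (2 : K) ≠ 0)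
    (hindex : ∀ x y, x ≠ 0 → B x x = 0 → B y y = 0 → B x y = 0 → ∃ c : K, y = c • x)
    (hVV : Module.finrank K V = Module.finrank K V') (L : Submodule K (V × V'))
    (hL : ∀ x ∈ L, ∀ y ∈ L, B x.1 y.1 = B' x.2 y.2)
    (hd : Module.finrank K V' ≤ Module.finrank K L) :
    ∃ f : V' →ₗ[K] V, ∀ x y, B (f x) (f y) = B' x y := by
  by_cases h0 : ∀ x : V, (x, (0 : V')) ∈ L → x = 0
  · exact exists_isometry_of_graph L hL hd h0
  push Not at h0
  obtain ⟨v, hvL, hv⟩ := h0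
  have hvv : B v v = 0 := by simpa using hL _ hvL _ hvL
  have hvx : ∀ x ∈ L, B v x.1 = 0 := fun x hx => by simpa using hL _ hvL _ hx
  obtain ⟨w, hvw, hww⟩ := exists_isotropic_dual hB hnd h2 hv hvv
  have : ∃ v', v' ≠ 0 ∧ ((0 : V), v') ∈ L := by
    by_contra! hcon
    let ψ : L →ₗ[K] V := LinearMap.fst K V V' ∘ₗ L.subtype
    have hinj : Function.Injective ψ := by
      rw [← LinearMap.ker_eq_bot, LinearMap.ker_eq_bot']
      rintro ⟨⟨x, y⟩, hx⟩ h
      have hx0 : x = 0 := h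
      subst hx0
      by_contra hne
      exact hcon y (fun h => hne (by subst h; rfl)) hx
    have hrange : LinearMap.range ψ = ⊤ := by
      apply Submodule.eq_top_of_finrank_eq
      apply le_antisymm (Submodule.finrank_le _)
      rwa [LinearMap.finrank_range_of_inj hinj, hVV]
    obtain ⟨x, hx⟩ := LinearMap.range_eq_top.1 hrange w
    have := hvx _ x.2
    change B v (ψ x) = 0 at this
    rw [hx, hvw] at this
    exact one_ne_zero this
  obtain ⟨v', hv', hvL'⟩ := this
  have hvv' : B' v' v' = 0 := by simpa using (hL _ hvL' _ hvL').symm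
  have hvx' : ∀ x ∈ L, B' v' x.2 = 0 := fun x hx => by simpa using (hL _ hvL' _ hx).symm
  obtain ⟨w', hvw', hww'⟩ := exists_isotropic_dual hB' hnd' h2 hv' hvv'
  let ψ : V × V' →ₗ[K] K := (B w) ∘ₗ LinearMap.fst K V V' - (B' w') ∘ₗ LinearMap.snd K V V'
  have hψ : ∀ x, ψ x = B w x.1 - B' w' x.2 := fun x => rfl
  let L₂ := (L ⊓ LinearMap.ker ψ) ⊔ Submodule.span K {(w, w')}
  have hmem : ∀ x ∈ L₂, ∃ l ∈ L, ψ l = 0 ∧ ∃ c : K, x = l + c • (w, w') := fun x hx => by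
    obtain ⟨l, hl, z, hz, rfl⟩ := Submodule.mem_sup.1 hx
    obtain ⟨c, rfl⟩ := Submodule.mem_span_singleton.1 hz
    exact ⟨l, hl.1, hl.2, c, rfl⟩
  refine exists_isometry_of_graph L₂ ?_ ?_ ?_
  · intro x hx y hy
    obtain ⟨l, hl, hlψ, c, rfl⟩ := hmem x hx
    obtain ⟨m, hm, hmψ, d, rfl⟩ := hmem y hy
    have h1 := hL l hl m hm
    rw [hψ] at hlψ hmψ
    simp only [Prod.fst_add, Prod.snd_add, Prod.smul_fst, Prod.smul_snd, map_add, map_smul,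
      LinearMap.add_apply, LinearMap.smul_apply, smul_eq_mul, hww, hww', hB l.1 w, hB' l.2 w']
    linear_combination h1 + c * hmψ + d * hlψ
  · have h1 : L ≤ (L ⊓ LinearMap.ker ψ) ⊔ Submodule.span K {(v, (0 : V'))} := fun x hx => by
      have h3 : ψ (v, 0) = 1 := by rw [hψ]; simp [hB w v, hvw]
      refine Submodule.mem_sup.2 ⟨x - ψ x • (v, (0 : V')), ⟨L.sub_mem hx (L.smul_mem _ hvL), ?_⟩,
        ψ x • (v, (0 : V')), Submodule.mem_span_singleton.2 ⟨_, rfl⟩, by simp⟩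
      rw [SetLike.mem_coe, LinearMap.mem_ker, map_sub, map_smul, h3]
      simp
    have h3 := (Submodule.finrank_mono h1).trans (Submodule.finrank_add_le_finrank_add_finrank _ _)
    have h4 := finrank_span_singleton (K := K) (v := (v, (0 : V'))) (by simp [hv])
    have h5 : (L ⊓ LinearMap.ker ψ) < L₂ := by
      refine lt_of_le_of_ne le_sup_left fun h => ?_
      have hu : (w, w') ∈ L₂ := Submodule.mem_sup_right (Submodule.mem_span_singleton_self _)
      rw [← h] at hu
      have := hvx _ hu.1
      simp [hvw] at this
    have h6 := Submodule.finrank_lt_finrank_of_lt h5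
    omega
  · intro x hx
    obtain ⟨l, hl, hlψ, c, hxe⟩ := hmem _ hx
    obtain ⟨h1, h3⟩ := Prod.ext_iff.1 hxe
    simp only [Prod.fst_add, Prod.snd_add, Prod.smul_fst, Prod.smul_snd] at h1 h3
    have hc : c = 0 := by
      have h4 := hvx' l hl
      have h5 := congrArg (B' v') h3
      simp [h4, hvw'] at h5
      exact h5.symm
    subst hc
    simp only [zero_smul, add_zero] at h1 h3
    have hl' : l = (x, 0) := Prod.ext h1.symm h3.symm
    rw [hl'] at hl hlψ
    have hxx : B x x = 0 := by simpa using hL _ hl _ hl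
    obtain ⟨d, rfl⟩ := hindex v x hv hvv hxx (hvx _ hl)
    rw [hψ] at hlψ
    simp [hB w v, hvw] at hlψ
    simp [hlψ]

end Lagrangian

section Rational

/-- Totally isotropic subspaces of a hyperbolic form are at most one-dimensional. -/
theorem hyperbolic_index {r : ℕ} {M : Matrix (Fin r) (Fin r) ℤ}
    (hh : ∃ P : Matrix (Fin r) (Fin r) ℝ, IsUnit P.det ∧ Pᵀ * (M.map (Int.cast : ℤ → ℝ)) * P =
      Matrix.diagonal (fun i : Fin r => if (i : ℕ) = 0 then (1 : ℝ) else -1))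
    {x y : Fin r → ℚ} (hx0 : x ≠ 0) (hx : x ⬝ᵥ (M.map (Int.cast : ℤ → ℚ)) *ᵥ x = 0)
    (hy : y ⬝ᵥ (M.map (Int.cast : ℤ → ℚ)) *ᵥ y = 0)
    (hxy : x ⬝ᵥ (M.map (Int.cast : ℤ → ℚ)) *ᵥ y = 0) : ∃ c : ℚ, y = c • x := by
  obtain ⟨P, hP, hPM⟩ := hh
  obtain ⟨i₀, hi₀⟩ := Function.ne_iff.1 hx0
  have hr : 0 < r := i₀.pos
  obtain ⟨s, rfl⟩ := Nat.exists_eq_succ_of_ne_zero hr.ne'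
  let c : (Fin (s + 1) → ℚ) → (Fin (s + 1) → ℝ) := fun v i => (v i : ℝ)
  have hc : ∀ v w : Fin (s + 1) → ℚ, ((v ⬝ᵥ (M.map (Int.cast : ℤ → ℚ)) *ᵥ w : ℚ) : ℝ) =
      c v ⬝ᵥ (M.map (Int.cast : ℤ → ℝ)) *ᵥ c w := fun v w => by
    simp [dotProduct, mulVec, c]
  let T : (Fin (s + 1) → ℚ) → (Fin (s + 1) → ℝ) := fun v => P⁻¹ *ᵥ c v
  have hT : ∀ v, P *ᵥ T v = c v := fun v => by
    simp [T, mulVec_mulVec, mul_nonsing_inv _ hP]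
  have hform : ∀ v w, v ⬝ᵥ (M.map (Int.cast : ℤ → ℚ)) *ᵥ w = 0 →
      T v 0 * T w 0 = ∑ i : Fin s, T v i.succ * T w i.succ := fun v w h => by
    have h1 := hc v w
    rw [h, ← hT v, ← hT w] at h1
    have h2 : (P *ᵥ T v) ⬝ᵥ (M.map (Int.cast : ℤ → ℝ)) *ᵥ (P *ᵥ T w) =
        T v ⬝ᵥ (Pᵀ * (M.map (Int.cast : ℤ → ℝ)) * P) *ᵥ T w := by
      rw [← mulVec_mulVec, ← mulVec_mulVec, dotProduct_mulVec (T v), vecMul_transpose]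
    rw [h2, hPM] at h1
    simp [dotProduct, Fin.sum_univ_succ, mulVec_diagonal] at h1
    linarith
  have h1 := hform x x hx
  have h2 := hform y y hy
  have h3 := hform x y hxy
  have key : ∀ i, T y 0 * T x i = T x 0 * T y i := by
    have hsum : ∑ i : Fin s, (T y 0 * T x i.succ - T x 0 * T y i.succ) ^ 2 = 0 := by
      have : ∀ i : Fin s, (T y 0 * T x i.succ - T x 0 * T y i.succ) ^ 2 =
          T y 0 ^ 2 * (T x i.succ * T x i.succ) - 2 * T y 0 * T x 0 * (T x i.succ * T y i.succ)
          + T x 0 ^ 2 * (T y i.succ * T y i.succ) := fun i => by ring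
      simp only [this, Finset.sum_add_distrib, Finset.sum_sub_distrib, ← Finset.mul_sum]
      rw [← h1, ← h2, ← h3]; ring
    intro i
    refine Fin.cases (mul_comm _ _) (fun i => ?_) i
    have := (Finset.sum_eq_zero_iff_of_nonneg (fun i _ => sq_nonneg _)).1 hsum i (Finset.mem_univ _)
    nlinarith [pow_eq_zero_iff (two_ne_zero) |>.1 this]
  have hx00 : T x 0 ≠ 0 := fun h => by
    rw [h] at h1
    have hTx : T x = 0 := by
      ext i
      refine Fin.cases h (fun i => ?_) i
      have := (Finset.sum_eq_zero_iff_of_nonneg (fun i _ => mul_self_nonneg _)).1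
        (h1.symm.trans (by simp)) i (Finset.mem_univ _)
      exact mul_self_eq_zero.1 this
    have h4 := hT x
    rw [hTx, mulVec_zero] at h4
    exact hi₀ (by simpa [c] using (congrFun h4 i₀).symm)
  have hcc : ∀ i, T y 0 * (x i : ℝ) = T x 0 * (y i : ℝ) := fun i => by
    have e1 : T y 0 • T x = T x 0 • T y := funext key
    have e2 := congrArg (P *ᵥ ·) e1
    simp only [mulVec_smul, hT] at e2
    exact congrFun e2 i
  refine ⟨y i₀ / x i₀, ?_⟩
  ext j
  have hxi : x i₀ ≠ 0 := hi₀
  rw [Pi.smul_apply, smul_eq_mul, div_mul_eq_mul_div, eq_div_iff hxi]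
  have : (T x 0) * ((y j : ℝ) * x i₀ - y i₀ * x j) = 0 := by
    linear_combination (-(x i₀ : ℝ)) * hcc j + (x j : ℝ) * hcc i₀
  have h5 := (mul_eq_zero.1 this).resolve_left hx00
  have h6 : ((y j * x i₀ - y i₀ * x j : ℚ) : ℝ) = 0 := by push_cast; exact h5
  linarith [Rat.cast_eq_zero.1 h6]

theorem exists_rational_cong {r p a : ℕ} [Fact p.Prime] (hp : p ≠ 2)
    {M M' : Matrix (Fin r) (Fin r) ℤ} (hs : M.IsSymm) (hs' : M'.IsSymm)
    (he : ∀ i, Even (M i i)) (he' : ∀ i, Even (M' i i))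
    (hh : ∃ P : Matrix (Fin r) (Fin r) ℝ, IsUnit P.det ∧ Pᵀ * (M.map (Int.cast : ℤ → ℝ)) * P =
      Matrix.diagonal (fun i : Fin r => if (i : ℕ) = 0 then (1 : ℝ) else -1))
    (hh' : ∃ P : Matrix (Fin r) (Fin r) ℝ, IsUnit P.det ∧ Pᵀ * (M'.map (Int.cast : ℤ → ℝ)) * P =
      Matrix.diagonal (fun i : Fin r => if (i : ℕ) = 0 then (1 : ℝ) else -1))
    (hd : M.det.natAbs = p ^ a) (hd' : M'.det.natAbs = p ^ a) {C C' : Matrix (Fin a) (Fin a) ℤ}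
    (hC : HasRes p (M.map (Int.cast : ℤ → ℚ)) C) (hC' : HasRes p (M'.map (Int.cast : ℤ → ℚ)) C') :
    ∃ P : Matrix (Fin r) (Fin r) ℚ,
      Pᵀ * (M.map (Int.cast : ℤ → ℚ)) * P = M'.map (Int.cast : ℤ → ℚ) := by
  have hpp : p.Prime := Fact.out
  have hmap : ∀ (G H : Matrix (Fin r) (Fin r) ℤ), (orthSum G H).map (Int.cast : ℤ → ℚ) =
        orthSum (G.map (Int.cast : ℤ → ℚ)) (H.map (Int.cast : ℤ → ℚ)) :=
    fun G H => orthSum_map (Int.castRingHom ℚ) G H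
  have hneg : (-M').map (Int.cast : ℤ → ℚ) = -(M'.map (Int.cast : ℤ → ℚ)) := by ext; simp
  have hres := hC.add hpp hC'.neg
  rw [← hneg, ← hmap] at hres
  have hreal : Neutral (((orthSum M (-M')).map (Int.cast : ℤ → ℚ)).map (Rat.castHom ℝ)) := by
    obtain ⟨P, hP, hPM⟩ := hh
    obtain ⟨Q, hQ, hQM⟩ := hh'
    have h1 : Cong (M.map (Int.cast : ℤ → ℝ)) _ :=
      ⟨P, P⁻¹, mul_nonsing_inv _ hP, nonsing_inv_mul _ hP, hPM⟩
    have h2 : Cong (M'.map (Int.cast : ℤ → ℝ)) _ :=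
      ⟨Q, Q⁻¹, mul_nonsing_inv _ hQ, nonsing_inv_mul _ hQ, hQM⟩
    have := (neutral_orthSum_neg _).cong (Cong.add (h1.trans h2.symm).symm
      (Cong.refl (-(M'.map (Int.cast : ℤ → ℝ)))))
    convert this using 1
    ext (i | i) (j | j) <;> simp [orthSum]
  have hN := neutral_of_even (orthSum_isSymm hs hs'.neg)
    (orthSum_even he fun i => by simpa using he' i) hp (e := a + a) (by
      rw [orthSum_det, Int.natAbs_mul, det_neg, Int.natAbs_mul, hd, hd', pow_add]
      simp [Int.natAbs_pow]) hres (n := a) (by simp; ring) hreal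
  rw [hmap, hneg] at hN
  obtain ⟨W, hW, hWd⟩ := hN.exists_submodule
  let e : (Fin r ⊕ Fin r → ℚ) ≃ₗ[ℚ] (Fin r → ℚ) × (Fin r → ℚ) :=
    LinearEquiv.sumArrowLequivProdArrow (Fin r) (Fin r) ℚ ℚ
  have hdet : ∀ G : Matrix (Fin r) (Fin r) ℤ, G.det.natAbs = p ^ a →
      (G.map (Int.cast : ℤ → ℚ)).det ≠ 0 := fun G hG => by
    have : (G.map (Int.cast : ℤ → ℚ)).det = (G.det : ℚ) := ((Int.castRingHom ℚ).map_det G).symm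
    rw [this, Int.cast_ne_zero, ← Int.natAbs_ne_zero, hG]
    exact (pow_pos hpp.pos _).ne'
  have hnd : ∀ G : Matrix (Fin r) (Fin r) ℤ, G.det.natAbs = p ^ a → ∀ x, x ≠ 0 →
      ∃ y, Matrix.toBilin' (G.map (Int.cast : ℤ → ℚ)) x y ≠ 0 := fun G hG x hx => by
    by_contra! hcon
    refine hx (Matrix.eq_zero_of_vecMul_eq_zero (hdet G hG) ?_)
    ext j
    have := hcon (Pi.single j 1)
    rw [Matrix.toBilin'_apply', dotProduct_mulVec] at this
    simpa using this
  have hsymm : ∀ G : Matrix (Fin r) (Fin r) ℤ, G.IsSymm → ∀ x y,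
      Matrix.toBilin' (G.map (Int.cast : ℤ → ℚ)) x y =
        Matrix.toBilin' (G.map (Int.cast : ℤ → ℚ)) y x := fun G hG x y => by
    rw [Matrix.toBilin'_apply', Matrix.toBilin'_apply', dotProduct_mulVec, dotProduct_comm,
      ← mulVec_transpose, (hG.map _).eq]
  obtain ⟨f, hf⟩ := exists_isometry_of_lagrangian
    (B := Matrix.toBilin' (M.map (Int.cast : ℤ → ℚ)))
    (B' := Matrix.toBilin' (M'.map (Int.cast : ℤ → ℚ))) (hsymm M hs) (hsymm M' hs')
    (hnd M hd) (hnd M' hd') two_ne_zero (fun x y hx0 hx hy hxy => by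
      rw [Matrix.toBilin'_apply'] at hx hy hxy
      exact hyperbolic_index hh hx0 hx hy hxy) rfl (W.map (e : _ →ₗ[ℚ] _)) (by
      rintro _ ⟨x, hx, rfl⟩ _ ⟨y, hy, rfl⟩
      have := hW x hx y hy
      rw [Matrix.toBilin'_apply', Matrix.toBilin'_apply']
      simp only [orthSum, dotProduct, mulVec, Fintype.sum_sum_type, fromBlocks_apply₁₁,
        fromBlocks_apply₁₂, fromBlocks_apply₂₁, fromBlocks_apply₂₂, Matrix.zero_apply, zero_mul,
        Finset.sum_const_zero, add_zero, zero_add, Matrix.neg_apply, neg_mul,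
        Finset.sum_neg_distrib, mul_neg] at this
      simp only [dotProduct, mulVec]
      exact eq_of_sub_eq_zero (by rw [sub_eq_add_neg]; exact this)) (by
      rw [LinearEquiv.finrank_map_eq]
      simp at hWd ⊢
      omega)
  refine ⟨LinearMap.toMatrix' f, ?_⟩
  apply Matrix.toBilin'.injective
  refine LinearMap.ext₂ fun x y => ?_
  rw [← hf, Matrix.toBilin'_apply', Matrix.toBilin'_apply', ← mulVec_mulVec, ← mulVec_mulVec,
    dotProduct_mulVec x, vecMul_transpose]
  simp only [LinearMap.toMatrix'_mulVec]

end Rational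

section Lattice

/-- The integers, as a subring of `ℚ`. -/
abbrev ints : Subring ℚ := (Int.castRingHom ℚ).range

lemma mem_ints {x : ℚ} : x ∈ ints ↔ ∃ n : ℤ, (n : ℚ) = x := by
  simp [ints, RingHom.mem_range]

lemma intCast_mem_ints (n : ℤ) : (n : ℚ) ∈ ints := mem_ints.2 ⟨n, rfl⟩

lemma natCast_mem_ints (n : ℕ) : (n : ℚ) ∈ ints := mem_ints.2 ⟨n, by simp⟩

lemma intCast_div_mem_ints {n : ℤ} {q : ℕ} (hq : q ≠ 0) :
    (n : ℚ) / q ∈ ints ↔ (q : ℤ) ∣ n := by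
  have hq' : (q : ℚ) ≠ 0 := by exact_mod_cast hq
  rw [mem_ints]
  constructor
  · rintro ⟨m, hm⟩
    refine ⟨m, ?_⟩
    rw [eq_div_iff hq'] at hm
    have : m * (q : ℤ) = n := by exact_mod_cast hm
    rw [← this, mul_comm]
  · rintro ⟨m, rfl⟩
    refine ⟨m, ?_⟩
    push_cast
    field_simp

lemma exists_bezout {q : ℕ} (hq : q.Prime) {a : ℚ} (ha : a ∈ ints) (haq : a / q ∉ ints) :
    ∃ u ∈ ints, ∃ v ∈ ints, u * a + v * q = 1 := by
  obtain ⟨n, rfl⟩ := mem_ints.1 ha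
  rw [intCast_div_mem_ints hq.ne_zero] at haq
  have h1 : IsCoprime (q : ℤ) n := (Prime.coprime_iff_not_dvd (Nat.prime_iff_prime_int.1 hq)).2 haq
  obtain ⟨v, u, h⟩ := h1
  refine ⟨u, intCast_mem_ints u, v, intCast_mem_ints v, ?_⟩
  have : ((v * q + u * n : ℤ) : ℚ) = 1 := by rw [h]; simp
  push_cast at this
  linarith

lemma div_mem_of_mul_div_mem {q : ℕ} (hq : q.Prime) {a b : ℚ} (ha : a ∈ ints) (haq : a / q ∉ ints)
    (hb : b ∈ ints) (hab : a * b / q ∈ ints) : b / q ∈ ints := by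
  obtain ⟨u, hu, v, hv, h⟩ := exists_bezout hq ha haq
  have hq' : (q : ℚ) ≠ 0 := by exact_mod_cast hq.ne_zero
  have : b / q = u * (a * b / q) + v * b := by
    field_simp
    linear_combination (-b) * h
  rw [this]
  exact add_mem (mul_mem hu hab) (mul_mem hv hb)

variable {V : Type*} [AddCommGroup V] [Module ℚ V] {B : LinearMap.BilinForm ℚ V}

lemma ints_smul_mem {L : AddSubgroup V} {a : ℚ} {x : V} (ha : a ∈ ints) (hx : x ∈ L) :
    a • x ∈ L := by
  obtain ⟨n, rfl⟩ := mem_ints.1 ha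
  rw [Int.cast_smul_eq_zsmul]
  exact zsmul_mem hx n

/-- `h` is an isometry of `B` that carries `L` onto `L'`. -/
structure IsLatticeIso (B : LinearMap.BilinForm ℚ V) (L L' : AddSubgroup V) (h : V ≃ₗ[ℚ] V) :
    Prop where
  form : ∀ x y, B (h x) (h y) = B x y
  mem : ∀ x, h x ∈ L' ↔ x ∈ L

lemma IsLatticeIso.refl (L : AddSubgroup V) : IsLatticeIso B L L (LinearEquiv.refl ℚ V) :=
  ⟨fun _ _ => rfl, fun _ => Iff.rfl⟩

lemma IsLatticeIso.trans {L L' L'' : AddSubgroup V} {g h : V ≃ₗ[ℚ] V}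
    (hg : IsLatticeIso B L L' g) (hh : IsLatticeIso B L' L'' h) :
    IsLatticeIso B L L'' (g.trans h) :=
  ⟨fun x y => by simp [hg.form, hh.form], fun x => by simp [hg.mem, hh.mem]⟩

lemma IsLatticeIso.symm {L L' : AddSubgroup V} {g : V ≃ₗ[ℚ] V} (hg : IsLatticeIso B L L' g) :
    IsLatticeIso B L' L g.symm :=
  ⟨fun x y => by rw [← hg.form]; simp, fun x => by rw [← hg.mem]; simp⟩

/-- The dual of a lattice. -/
def dualLattice (B : LinearMap.BilinForm ℚ V) (L : AddSubgroup V) : AddSubgroup V where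
  carrier := {x | ∀ y ∈ L, B x y ∈ ints}
  add_mem' := fun hx hy z hz => by
    rw [map_add, LinearMap.add_apply]
    exact add_mem (hx z hz) (hy z hz)
  zero_mem' := fun z _ => by simp
  neg_mem' := fun hx z hz => by
    rw [map_neg, LinearMap.neg_apply]
    exact neg_mem (hx z hz)

/-- All values of the quadratic form `x ↦ B x x / 2` on `L` are integers. -/
def EvenLattice (B : LinearMap.BilinForm ℚ V) (L : AddSubgroup V) : Prop :=
  ∀ x ∈ L, B x x / 2 ∈ ints

lemma EvenLattice.form_mem {L : AddSubgroup V} (hB : ∀ x y, B x y = B y x)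
    (hL : EvenLattice B L) {x y : V} (hx : x ∈ L) (hy : y ∈ L) : B x y ∈ ints := by
  have : B x y = B (x + y) (x + y) / 2 - B x x / 2 - B y y / 2 := by
    simp only [map_add, LinearMap.add_apply, hB y x]
    ring
  rw [this]
  exact sub_mem (sub_mem (hL _ (add_mem hx hy)) (hL _ hx)) (hL _ hy)

/-- A pair of isotropic vectors of `L` with product `1`. -/
structure IsHyperbolicPair (B : LinearMap.BilinForm ℚ V) (L : AddSubgroup V) (e f : V) :
    Prop where
  left_mem : e ∈ L
  right_mem : f ∈ L
  left_self : B e e = 0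
  right_self : B f f = 0
  apply : B e f = 1

lemma IsHyperbolicPair.map {L L' : AddSubgroup V} {e f : V} (h : IsHyperbolicPair B L e f)
    {g : V ≃ₗ[ℚ] V} (hg : IsLatticeIso B L L' g) : IsHyperbolicPair B L' (g e) (g f) :=
  ⟨(hg.mem _).2 h.1, (hg.mem _).2 h.2, by rw [hg.form, h.3], by rw [hg.form, h.4],
    by rw [hg.form, h.5]⟩

/-- The Eichler transformation attached to `e` and `m`. -/
def eichlerMap (B : LinearMap.BilinForm ℚ V) (e m : V) : V →ₗ[ℚ] V :=
  LinearMap.id + (B e).smulRight m - (B m).smulRight e - (B e).smulRight ((B m m / 2) • e)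

lemma eichlerMap_apply (e m v : V) :
    eichlerMap B e m v = v + B e v • m - B m v • e - B e v • (B m m / 2) • e := rfl

lemma eichlerMap_neg_eichlerMap {e m : V} (hB : ∀ x y, B x y = B y x) (he : B e e = 0)
    (hem : B e m = 0) (v : V) : eichlerMap B e (-m) (eichlerMap B e m v) = v := by
  have hme : B m e = 0 := by rw [hB, hem]
  simp only [eichlerMap_apply, map_add, map_sub, map_smul, map_neg, LinearMap.neg_apply, he, hem,
    hme]
  module

/-- The Eichler transformation as an automorphism. -/
def eichler {e m : V} (hB : ∀ x y, B x y = B y x) (he : B e e = 0) (hem : B e m = 0) :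
    V ≃ₗ[ℚ] V :=
  LinearEquiv.ofLinearMap (eichlerMap B e m) (eichlerMap B e (-m))
    (LinearMap.ext fun v => by
      have := eichlerMap_neg_eichlerMap (m := -m) hB he (by simp [hem]) v
      rwa [neg_neg] at this)
    (LinearMap.ext fun v => eichlerMap_neg_eichlerMap hB he hem v)

lemma eichlerMap_mem {L : AddSubgroup V} (hB : ∀ x y, B x y = B y x) (hL : EvenLattice B L)
    {e m v : V} (he : e ∈ L) (hm : m ∈ L) (hv : v ∈ L) : eichlerMap B e m v ∈ L := by
  rw [eichlerMap_apply]
  exact sub_mem (sub_mem (add_mem hv (ints_smul_mem (hL.form_mem hB he hv) hm))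
    (ints_smul_mem (hL.form_mem hB hm hv) he))
    (ints_smul_mem (hL.form_mem hB he hv) (ints_smul_mem (hL m hm) he))

lemma isLatticeIso_eichler {L : AddSubgroup V} (hB : ∀ x y, B x y = B y x)
    (hL : EvenLattice B L) {e m : V} (he : e ∈ L) (hm : m ∈ L) (hee : B e e = 0)
    (hem : B e m = 0) : IsLatticeIso B L L (eichler hB hee hem) := by
  have hme : B m e = 0 := by rw [hB, hem]
  refine ⟨fun x y => ?_, fun x => ⟨fun h => ?_, fun h => eichlerMap_mem hB hL he hm h⟩⟩
  · change B (eichlerMap B e m x) (eichlerMap B e m y) = B x y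
    simp only [eichlerMap_apply, map_add, map_sub, map_smul, LinearMap.add_apply,
      LinearMap.sub_apply, LinearMap.smul_apply, smul_eq_mul, hee, hem, hme, hB x e, hB x m]
    ring
  · have := eichlerMap_mem hB hL he (neg_mem hm) h
    rwa [show eichler hB hee hem x = eichlerMap B e m x from rfl,
      eichlerMap_neg_eichlerMap hB hee hem] at this

lemma exists_isLatticeIso_swap {L : AddSubgroup V} (hB : ∀ x y, B x y = B y x)
    (hL : EvenLattice B L) {e f : V} (h : IsHyperbolicPair B L e f) :
    ∃ g, IsLatticeIso B L L g ∧ g e = f ∧ g f = e := by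
  obtain ⟨he, hf, hee, hff, hef⟩ := h
  have hfe : B f e = 1 := by rw [hB, hef]
  let s : V →ₗ[ℚ] V := LinearMap.id + (B (e - f)).smulRight (e - f)
  have hs : ∀ v, s v = v + B (e - f) v • (e - f) := fun v => rfl
  have hinv : Function.Involutive s := fun v => by
    simp only [hs, map_add, map_sub, map_smul, LinearMap.sub_apply, hee, hff, hef, hfe,
      smul_eq_mul]
    module
  have hmem : ∀ v ∈ L, s v ∈ L := fun v hv =>
    add_mem hv (ints_smul_mem (hL.form_mem hB (sub_mem he hf) hv) (sub_mem he hf))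
  refine ⟨LinearEquiv.ofInvolutive s hinv, ⟨fun x y => ?_, fun x => ⟨fun h => ?_, hmem x⟩⟩, ?_, ?_⟩
  · change B (s x) (s y) = B x y
    simp only [hs, map_add, map_sub, map_smul, LinearMap.add_apply, LinearMap.sub_apply,
      LinearMap.smul_apply, smul_eq_mul, hee, hff, hef, hfe, hB x e, hB x f]
    ring
  · have := hmem _ h
    rwa [show (LinearEquiv.ofInvolutive s hinv) x = s x from rfl, hinv] at this
  · change s e = f
    simp only [hs, LinearMap.sub_apply, map_sub, hee, hfe]
    module
  · change s f = e
    simp only [hs, LinearMap.sub_apply, map_sub, hff, hef]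
    module

/-- Transitivity of the orthogonal group of `L` on the nonzero singular vectors of `L / q L`. -/
def TransitiveAt (B : LinearMap.BilinForm ℚ V) (L : AddSubgroup V) (q : ℕ) (e z : V) : Prop :=
  ∃ g, IsLatticeIso B L L g ∧ ∃ c ∈ ints, c / q ∉ ints ∧ ∃ l ∈ L, g z = c • e + (q : ℚ) • l

lemma TransitiveAt.of_apply {L : AddSubgroup V} {q : ℕ} {e z : V} {g : V ≃ₗ[ℚ] V}
    (hg : IsLatticeIso B L L g) (h : TransitiveAt B L q e (g z)) : TransitiveAt B L q e z := by
  obtain ⟨g', hg', h⟩ := h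
  exact ⟨g.trans g', hg.trans hg', h⟩

lemma transitiveAt_of_right {L : AddSubgroup V} (hB : ∀ x y, B x y = B y x)
    (hL : EvenLattice B L) {e f : V} (h : IsHyperbolicPair B L e f) {q : ℕ} (hq : q.Prime)
    {z : V} (hz : z ∈ L) (hQ : B z z / 2 / q ∈ ints) (hf : B f z / q ∉ ints) :
    TransitiveAt B L q e z := by
  have hq' : (q : ℚ) ≠ 0 := by exact_mod_cast hq.ne_zero
  have hfe : B f e = 1 := by rw [hB, h.apply]
  have hα := hL.form_mem hB h.right_mem hz
  have hβ := hL.form_mem hB h.left_mem hz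
  obtain ⟨u, hu, v, hv, huv⟩ := exists_bezout hq hα hf
  set α := B f z with hαdef
  set β := B e z with hβdef
  set k : V := z - α • e - β • f with hk
  have hkL : k ∈ L := sub_mem (sub_mem hz (ints_smul_mem hα h.left_mem))
    (ints_smul_mem hβ h.right_mem)
  have hek : B e k = 0 := by
    simp [hk, h.left_self, h.apply, ← hβdef]
  have hfk : B f k = 0 := by
    simp [hk, h.right_self, hfe, ← hαdef]
  have hfm : B f (-u • k) = 0 := by simp [hfk]
  have hmL : -u • k ∈ L := ints_smul_mem (neg_mem hu) hkL
  have hzk : z = k + α • e + β • f := by rw [hk]; abel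
  have hke : B k e = 0 := by rw [hB, hek]
  have hkf : B k f = 0 := by rw [hB, hfk]
  have hkz : B k z = B k k := by
    rw [hzk]
    simp [hke, hkf]
  have hzz : B z z = B k k + 2 * α * β := by
    rw [hzk]
    simp [hke, hkf, hek, hfk, h.left_self, h.right_self, h.apply, hfe]
    ring
  have hκ := hL k hkL
  have hβ' : (β + u * B k k - α * (u * u * (B k k / 2))) / q ∈ ints := by
    refine div_mem_of_mul_div_mem hq hα hf (sub_mem (add_mem hβ (mul_mem hu
      (hL.form_mem hB hkL hkL))) (mul_mem hα (mul_mem (mul_mem hu hu) hκ))) ?_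
    have : α * (β + u * B k k - α * (u * u * (B k k / 2))) / q =
        B z z / 2 / q - v * v * (B k k / 2) * q := by
      field_simp
      rw [hzz]
      linear_combination (-B k k * (u * α - 1 - v * q)) * huv
    rw [this]
    exact sub_mem hQ (mul_mem (mul_mem (mul_mem hv hv) hκ) (natCast_mem_ints q))
  refine ⟨_, isLatticeIso_eichler hB hL h.right_mem hmL h.right_self hfm, α, hα, hf,
    v • k + ((β + u * B k k - α * (u * u * (B k k / 2))) / q) • f,
    add_mem (ints_smul_mem hv hkL) (ints_smul_mem hβ' h.right_mem), ?_⟩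
  change eichlerMap B f (-u • k) z = _
  have h1 : v * q = 1 - u * α := by linear_combination huv
  rw [eichlerMap_apply, smul_add, smul_smul (q : ℚ), smul_smul (q : ℚ), mul_div_cancel₀ _ hq',
    mul_comm (q : ℚ), h1]
  simp only [map_smul, LinearMap.smul_apply, smul_eq_mul, hkz, ← hαdef]
  nth_rw 1 [hzk]
  module

lemma transitiveAt {L : AddSubgroup V} (hB : ∀ x y, B x y = B y x)
    (hL : EvenLattice B L) {e f : V} (h : IsHyperbolicPair B L e f) {q : ℕ} (hq : q.Prime)
    {z : V} (hz : z ∈ L) (hQ : B z z / 2 / q ∈ ints) {y : V} (hy : y ∈ L)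
    (hzy : B z y / q ∉ ints) : TransitiveAt B L q e z := by
  by_cases hf : B f z / q ∉ ints
  · exact transitiveAt_of_right hB hL h hq hz hQ hf
  push Not at hf
  have hfe : B f e = 1 := by rw [hB, h.apply]
  by_cases he : B e z / q ∉ ints
  · obtain ⟨g, hg, hge, hgf⟩ := exists_isLatticeIso_swap hB hL h
    refine TransitiveAt.of_apply hg (transitiveAt_of_right hB hL h hq ((hg.mem z).2 hz) ?_ ?_)
    · rwa [hg.form]
    · rwa [← hge, hg.form]
  push Not at he
  set m : V := y - B f y • e - B e y • f with hm
  have hmL : m ∈ L := sub_mem (sub_mem hy (ints_smul_mem (hL.form_mem hB h.right_mem hy)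
    h.left_mem)) (ints_smul_mem (hL.form_mem hB h.left_mem hy) h.right_mem)
  have hem : B e m = 0 := by simp [hm, h.left_self, h.apply]
  have hfm : B f m = 0 := by simp [hm, h.right_self, hfe]
  have hE := isLatticeIso_eichler hB hL h.left_mem hmL h.left_self hem
  refine TransitiveAt.of_apply hE (transitiveAt_of_right hB hL h hq ((hE.mem z).2 hz) ?_ ?_)
  · rwa [hE.form]
  · change B f (eichlerMap B e m z) / q ∉ ints
    intro hcon
    apply hzy
    have h1 : B z y / q = B f z / q - B e z / q * (B m m / 2) - B f (eichlerMap B e m z) / q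
        + B f y * (B e z / q) + B e y * (B f z / q) := by
      simp only [eichlerMap_apply, map_add, map_sub, map_smul, smul_eq_mul, hfm, hfe]
      have : B m z = B z y - B f y * B e z - B e y * B f z := by
        simp only [hm, map_sub, map_smul, LinearMap.sub_apply, LinearMap.smul_apply, smul_eq_mul,
          hB y z]
      rw [this]
      ring
    rw [h1]
    exact add_mem (add_mem (sub_mem (sub_mem hf (mul_mem he (hL m hmL))) hcon)
      (mul_mem (hL.form_mem hB h.right_mem hy) he)) (mul_mem (hL.form_mem hB h.left_mem hy) hf)

end Lattice

section Neighbors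

variable {V : Type*} [AddCommGroup V] [Module ℚ V] {B : LinearMap.BilinForm ℚ V}

/-- The isometry that scales `e` by `t` and `f` by `t⁻¹`. -/
def scalingMap (B : LinearMap.BilinForm ℚ V) (e f : V) (t : ℚ) : V →ₗ[ℚ] V :=
  LinearMap.id + (B f).smulRight ((t - 1) • e) + (B e).smulRight ((t⁻¹ - 1) • f)

lemma scalingMap_apply (e f v : V) (t : ℚ) :
    scalingMap B e f t v = v + B f v • (t - 1) • e + B e v • (t⁻¹ - 1) • f := rfl

lemma scalingMap_inv_scalingMap {e f : V} (hB : ∀ x y, B x y = B y x) (hee : B e e = 0)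
    (hff : B f f = 0) (hef : B e f = 1) {t : ℚ} (ht : t ≠ 0) (v : V) :
    scalingMap B e f t⁻¹ (scalingMap B e f t v) = v := by
  have hfe : B f e = 1 := by rw [hB, hef]
  simp only [scalingMap_apply, map_add, map_smul, hee, hff, hef, hfe, inv_inv]
  match_scalars <;> field_simp <;> ring

lemma exists_scaling {e f : V} (hB : ∀ x y, B x y = B y x) (hee : B e e = 0)
    (hff : B f f = 0) (hef : B e f = 1) {t : ℚ} (ht : t ≠ 0) :
    ∃ g : V ≃ₗ[ℚ] V, (∀ x y, B (g x) (g y) = B x y) ∧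
      ∀ v, g v = v + B f v • (t - 1) • e + B e v • (t⁻¹ - 1) • f := by
  have hfe : B f e = 1 := by rw [hB, hef]
  refine ⟨LinearEquiv.ofLinearMap (scalingMap B e f t) (scalingMap B e f t⁻¹)
    (LinearMap.ext fun v => ?_)
    (LinearMap.ext fun v => scalingMap_inv_scalingMap hB hee hff hef ht v), fun x y => ?_,
    fun v => rfl⟩
  · have := scalingMap_inv_scalingMap hB hee hff hef (inv_ne_zero ht) v
    rwa [inv_inv] at this
  · change B (scalingMap B e f t x) (scalingMap B e f t y) = B x y
    simp only [scalingMap_apply, map_add, map_smul, LinearMap.add_apply,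
      LinearMap.smul_apply, smul_eq_mul, hee, hff, hef, hfe, hB x e, hB x f]
    field_simp
    ring

/-- An even lattice that is not contained in a larger even lattice. -/
structure IsMaximalEven (B : LinearMap.BilinForm ℚ V) (L : AddSubgroup V) : Prop where
  even : EvenLattice B L
  mem : ∀ x ∈ dualLattice B L, B x x / 2 ∈ ints → x ∈ L

lemma EvenLattice.of_isLatticeIso {L L' : AddSubgroup V} {g : V ≃ₗ[ℚ] V}
    (hg : IsLatticeIso B L L' g) (h : EvenLattice B L') : EvenLattice B L := fun x hx => by
  rw [← hg.form]
  exact h _ ((hg.mem x).2 hx)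

lemma IsLatticeIso.mem_dualLattice {L L' : AddSubgroup V} {g : V ≃ₗ[ℚ] V}
    (hg : IsLatticeIso B L L' g) (x : V) : g x ∈ dualLattice B L' ↔ x ∈ dualLattice B L := by
  constructor
  · intro h y hy
    rw [← hg.form]
    exact h _ ((hg.mem y).2 hy)
  · intro h y hy
    have := h _ ((hg.symm.mem y).2 hy)
    rw [← hg.form] at this
    simpa using this

lemma IsMaximalEven.of_isLatticeIso {L L' : AddSubgroup V} {g : V ≃ₗ[ℚ] V}
    (hg : IsLatticeIso B L L' g) (h : IsMaximalEven B L') : IsMaximalEven B L :=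
  ⟨h.even.of_isLatticeIso hg, fun x hx hxx => (hg.mem x).1
    (h.mem _ ((hg.mem_dualLattice x).2 hx) (by rwa [hg.form]))⟩

lemma exists_prime_smul_mem {H K : AddSubgroup V} (h0 : H.relIndex K ≠ 0) (h1 : H.relIndex K ≠ 1) :
    ∃ q : ℕ, q.Prime ∧ ∃ x ∈ K, x ∉ H ∧ q • x ∈ H := by
  have hne : ¬ K ≤ H := fun h => h1 (AddSubgroup.relIndex_eq_one.2 h)
  obtain ⟨x, hxK, hxH⟩ := SetLike.not_le_iff_exists.1 hne
  have hex : ∃ n : ℕ, 0 < n ∧ n • x ∈ H := by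
    refine ⟨H.relIndex K, Nat.pos_of_ne_zero h0, ?_⟩
    have := (H.addSubgroupOf K).nsmul_index_mem ⟨x, hxK⟩
    exact this
  classical
  obtain ⟨hn0, hn⟩ := Nat.find_spec hex
  set n := Nat.find hex
  have hn1 : n ≠ 1 := fun h => hxH (by rw [h, one_smul] at hn; exact hn)
  refine ⟨n.minFac, Nat.minFac_prime hn1, (n / n.minFac) • x, nsmul_mem hxK _, fun hcon => ?_, ?_⟩
  · exact Nat.find_min hex (Nat.div_lt_self hn0 (Nat.minFac_prime hn1).one_lt)
      ⟨Nat.div_pos (Nat.minFac_le hn0) (Nat.minFac_pos n), hcon⟩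
  · rw [smul_smul, Nat.mul_div_cancel' (Nat.minFac_dvd n)]
    exact hn

lemma exists_neighbor {L L' : AddSubgroup V} (hB : ∀ x y, B x y = B y x) {e f : V}
    (h : IsHyperbolicPair B L e f) (hL : IsMaximalEven B L) (hL' : EvenLattice B L') {q : ℕ}
    (hq : q.Prime) {x : V} (hx : x ∈ L') (hxL : x ∉ L) (hqx : q • x ∈ L) :
    ∃ (L₁ : AddSubgroup V) (g : V ≃ₗ[ℚ] V), IsLatticeIso B L₁ L g ∧ L ⊓ L' ≤ L₁ ∧ x ∈ L₁ := by
  have hq' : (q : ℚ) ≠ 0 := by exact_mod_cast hq.ne_zero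
  rw [← Nat.cast_smul_eq_nsmul ℚ] at hqx
  have hnot : ∃ y ∈ L, B x y ∉ ints := by
    by_contra hcon
    push Not at hcon
    exact hxL (hL.mem x hcon (hL' x hx))
  obtain ⟨y, hy, hxy⟩ := hnot
  obtain ⟨k, hk, c, hc, hcq, l, hl, hkz⟩ := transitiveAt hB hL.even h hq hqx
    (by
      have : B ((q : ℚ) • x) ((q : ℚ) • x) / 2 / q = q * (B x x / 2) := by
        simp only [map_smul, LinearMap.smul_apply, smul_eq_mul]
        field_simp
      rw [this]
      exact mul_mem (natCast_mem_ints q) (hL' x hx)) hy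
    (by
      have : B ((q : ℚ) • x) y / q = B x y := by
        simp only [map_smul, LinearMap.smul_apply, smul_eq_mul]
        field_simp
      rwa [this])
  have hkx : k x = (c / q) • e + l := by
    have h1 : (q : ℚ) • k x = (q : ℚ) • ((c / q) • e + l) := by
      rw [← map_smul, hkz, smul_add, smul_smul, mul_div_cancel₀ _ hq']
    exact smul_right_injective V hq' h1
  obtain ⟨s, hsB, hs⟩ := exists_scaling hB h.left_self h.right_self h.apply hq'
  have hs_mem : ∀ w ∈ L, B e w / q ∈ ints → s w ∈ L := fun w hw hew => by
    have : B e w • ((q : ℚ)⁻¹ - 1) • f = (B e w / q - B e w) • f := by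
      rw [smul_smul]; congr 1; ring
    rw [hs, this]
    have h2 : (q : ℚ) - 1 ∈ ints := sub_mem (natCast_mem_ints q) (one_mem _)
    exact add_mem (add_mem hw (ints_smul_mem (hL.even.form_mem hB h.right_mem hw)
      (ints_smul_mem h2 h.left_mem)))
      (ints_smul_mem (sub_mem hew (hL.even.form_mem hB h.left_mem hw)) h.right_mem)
  refine ⟨L.comap ((k.trans s : V ≃ₗ[ℚ] V) : V →+ V), k.trans s,
    ⟨fun a b => by simp [hsB, hk.form], fun a => Iff.rfl⟩, ?_, ?_⟩
  · rintro w ⟨hw, hw'⟩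
    refine hs_mem (k w) ((hk.mem w).2 hw) ?_
    have hkw := (hk.mem w).2 hw
    refine div_mem_of_mul_div_mem hq hc hcq (hL.even.form_mem hB h.left_mem hkw) ?_
    have h1 : c * B e (k w) / q = B x w - B l (k w) := by
      rw [← hk.form x w, hkx]
      simp only [map_add, map_smul, LinearMap.add_apply, LinearMap.smul_apply, smul_eq_mul]
      ring
    rw [h1]
    exact sub_mem (hL'.form_mem hB hx hw') (hL.even.form_mem hB hl hkw)
  · change s (k x) ∈ L
    have hse : s e = (q : ℚ) • e := by
      rw [hs, h.left_self, hB f e, h.apply]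
      module
    have hel : B e l / q ∈ ints := by
      refine div_mem_of_mul_div_mem hq hc hcq (hL.even.form_mem hB h.left_mem hl) ?_
      have h1 : c * B e l / q = B x x / 2 - B l l / 2 := by
        rw [← hk.form x x, hkx]
        simp only [map_add, map_smul, LinearMap.add_apply, LinearMap.smul_apply, smul_eq_mul,
          h.left_self, hB l e]
        ring
      rw [h1]
      exact sub_mem (hL' x hx) (hL.even l hl)
    rw [hkx, map_add, map_smul, hse, smul_smul, div_mul_cancel₀ _ hq']
    exact add_mem (ints_smul_mem hc h.left_mem) (hs_mem l hl hel)

lemma exists_isLatticeIso_of_isMaximalEven (hB : ∀ x y, B x y = B y x) {L' : AddSubgroup V}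
    (hL' : IsMaximalEven B L') (n : ℕ) : ∀ {L : AddSubgroup V} {e f : V},
    IsHyperbolicPair B L e f → IsMaximalEven B L → L.relIndex L' ≠ 0 → L.relIndex L' = n →
    ∃ g, IsLatticeIso B L L' g := by
  induction n using Nat.strong_induction_on with
  | _ n ih =>
  intro L e f h hL h0 hn
  by_cases h1 : L.relIndex L' = 1
  · have hle : L' ≤ L := AddSubgroup.relIndex_eq_one.1 h1
    have : L = L' := le_antisymm (fun x hx => hL'.mem x
      (fun y hy => hL.even.form_mem hB hx (hle hy)) (hL.even x hx)) hle
    exact ⟨LinearEquiv.refl ℚ V, this ▸ IsLatticeIso.refl L⟩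
  obtain ⟨q, hq, x, hx, hxL, hqx⟩ := exists_prime_smul_mem h0 h1
  obtain ⟨L₁, g, hg, hle, hxL₁⟩ := exists_neighbor hB h hL hL'.even hq hx hxL hqx
  have hle' : L ⊓ L' ≤ L₁ ⊓ L' := le_inf hle inf_le_right
  have hmul := AddSubgroup.relIndex_mul_relIndex _ _ _ hle' (inf_le_right : L₁ ⊓ L' ≤ L')
  rw [AddSubgroup.inf_relIndex_right, AddSubgroup.inf_relIndex_right] at hmul
  have hne : (L ⊓ L').relIndex (L₁ ⊓ L') ≠ 1 := fun hcon =>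
    hxL ((AddSubgroup.relIndex_eq_one.1 hcon) ⟨hxL₁, hx⟩).1
  rw [← hmul] at h0
  obtain ⟨h2, h3⟩ := mul_ne_zero_iff.1 h0
  obtain ⟨g', hg'⟩ := ih (L₁.relIndex L') (by
    rw [← hn, ← hmul]
    exact lt_mul_of_one_lt_left (Nat.pos_of_ne_zero h3) (by omega))
    (h.map hg.symm) (hL.of_isLatticeIso hg) h3 rfl
  exact ⟨_, hg.symm.trans hg'⟩

end Neighbors

section Elementary

variable {V : Type*} [AddCommGroup V] [Module ℚ V] {B : LinearMap.BilinForm ℚ V}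

/-- An even lattice of full rank whose discriminant group is killed by `p`. -/
structure IsElementary (B : LinearMap.BilinForm ℚ V) (p : ℕ) (L : AddSubgroup V) : Prop where
  even : EvenLattice B L
  fg : L.FG
  exists_smul_mem : ∀ v, ∃ n : ℕ, n ≠ 0 ∧ n • v ∈ L
  smul_mem : ∀ x ∈ dualLattice B L, (p : ℚ) • x ∈ L
  dual_dual : ∀ x, (∀ y ∈ dualLattice B L, B x y ∈ ints) → x ∈ L

lemma relIndex_eq_prime {H K : AddSubgroup V} {p : ℕ} (hp : p.Prime) {x : V} (hx : x ∈ K)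
    (hxH : x ∉ H) (hpx : p • x ∈ H) (h : ∀ y ∈ K, ∃ j : ℤ, y - j • x ∈ H) :
    H.relIndex K = p := by
  have := Fact.mk hp
  let π := QuotientAddGroup.mk' (H.addSubgroupOf K)
  have hπ : ∀ y : K, π y = 0 ↔ (y : V) ∈ H := fun y =>
    (QuotientAddGroup.eq_zero_iff y).trans AddSubgroup.mem_addSubgroupOf
  have h1 : addOrderOf (π ⟨x, hx⟩) = p := addOrderOf_eq_prime
    (by rw [← map_nsmul, hπ]; exact hpx) (fun h => hxH ((hπ _).1 h))
  rw [← h1, addOrderOf_eq_card_of_forall_mem_zmultiples]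
  · rfl
  · intro y
    obtain ⟨y, rfl⟩ := QuotientAddGroup.mk'_surjective _ y
    obtain ⟨j, hj⟩ := h y y.2
    rw [AddSubgroup.mem_zmultiples_iff]
    refine ⟨j, ?_⟩
    rw [← map_zsmul, eq_comm, ← sub_eq_zero, ← map_sub]
    exact (hπ _).2 hj

lemma relIndex_ne_zero {L K : AddSubgroup V} (hK : K.FG)
    (hL : ∀ v, ∃ n : ℕ, n ≠ 0 ∧ n • v ∈ L) : L.relIndex K ≠ 0 := by
  have : AddGroup.FG K := (AddGroup.fg_iff_addSubgroup_fg K).2 hK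
  have : Finite (K ⧸ L.addSubgroupOf K) := by
    apply AddCommGroup.finite_of_fg_isAddTorsion
    intro y
    obtain ⟨y, rfl⟩ := QuotientAddGroup.mk'_surjective _ y
    obtain ⟨n, hn, h⟩ := hL y
    rw [isOfFinAddOrder_iff_nsmul_eq_zero]
    refine ⟨n, Nat.pos_of_ne_zero hn, ?_⟩
    rw [← map_nsmul]
    exact (QuotientAddGroup.eq_zero_iff _).2 h
  exact AddSubgroup.index_ne_zero_of_finite

lemma IsLatticeIso.relIndex_dualLattice {L L' : AddSubgroup V} {g : V ≃ₗ[ℚ] V}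
    (hg : IsLatticeIso B L L' g) :
    L.relIndex (dualLattice B L) = L'.relIndex (dualLattice B L') := by
  have h1 : L = L'.comap (g : V →+ V) := by ext x; exact (hg.mem x).symm
  have h2 : (dualLattice B L).map (g : V →+ V) = dualLattice B L' := by
    ext x
    constructor
    · rintro ⟨y, hy, rfl⟩
      exact (hg.mem_dualLattice y).2 hy
    · intro hx
      exact ⟨g.symm x, (hg.symm.mem_dualLattice x).2 hx, g.apply_symm_apply x⟩
  rw [← h2, ← AddSubgroup.relIndex_comap, ← h1]

lemma mem_sup_zmultiples {L : AddSubgroup V} {x y : V} :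
    y ∈ L ⊔ AddSubgroup.zmultiples x ↔ ∃ l ∈ L, ∃ j : ℤ, y = l + (j : ℚ) • x := by
  simp only [AddSubgroup.mem_sup, AddSubgroup.mem_zmultiples_iff, Int.cast_smul_eq_zsmul]
  constructor
  · rintro ⟨l, hl, _, ⟨j, rfl⟩, rfl⟩
    exact ⟨l, hl, j, rfl⟩
  · rintro ⟨l, hl, j, rfl⟩
    exact ⟨l, hl, _, ⟨j, rfl⟩, rfl⟩

lemma mem_dualLattice_sup_zmultiples {L : AddSubgroup V} (hB : ∀ x y, B x y = B y x) {x y : V} :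
    y ∈ dualLattice B (L ⊔ AddSubgroup.zmultiples x) ↔ y ∈ dualLattice B L ∧ B x y ∈ ints := by
  constructor
  · refine fun h => ⟨fun l hl => h l (AddSubgroup.mem_sup_left hl), ?_⟩
    rw [hB]
    exact h x (AddSubgroup.mem_sup_right (AddSubgroup.mem_zmultiples x))
  · rintro ⟨h1, h2⟩ z hz
    obtain ⟨l, hl, j, rfl⟩ := mem_sup_zmultiples.1 hz
    rw [map_add, map_smul, smul_eq_mul, hB y x]
    exact add_mem (h1 l hl) (mul_mem (intCast_mem_ints j) h2)

variable {L : AddSubgroup V} {p : ℕ} {x g : V}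

lemma IsElementary.le_dualLattice (hB : ∀ x y, B x y = B y x) (hL : IsElementary B p L) :
    L ≤ dualLattice B L := fun _ hx _ hy => hL.even.form_mem hB hx hy

lemma IsElementary.exists_sub_mem (hB : ∀ x y, B x y = B y x)
    (hL : IsElementary B p L) (hp : p.Prime) (hx : x ∈ dualLattice B L)
    (hg : g ∈ dualLattice B L) (hxg : B x g ∉ ints) {b : ℚ} (hb : p * b ∈ ints) :
    ∃ j : ℤ, b - j * B x g ∈ ints := by
  have hp' : (p : ℚ) ≠ 0 := by exact_mod_cast hp.ne_zero
  have h1 : p * B x g ∈ ints := by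
    have := hg _ (hL.smul_mem x hx)
    rwa [map_smul, smul_eq_mul, hB] at this
  obtain ⟨u, hu, v, hv, huv⟩ := exists_bezout hp h1 (by rwa [mul_div_cancel_left₀ _ hp'])
  obtain ⟨j, hj⟩ := mem_ints.1 (mul_mem hu hb)
  refine ⟨j, ?_⟩
  have : b - j * B x g = v * (p * b) := by
    rw [hj]
    linear_combination (-b) * huv
  rw [this]
  exact mul_mem hv hb

lemma IsElementary.sup_zmultiples (hB : ∀ x y, B x y = B y x) (hL : IsElementary B p L)
    (hp : p.Prime) (hx : x ∈ dualLattice B L) (hxx : B x x / 2 ∈ ints)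
    (hg : g ∈ dualLattice B L) (hxg : B x g ∉ ints) :
    IsElementary B p (L ⊔ AddSubgroup.zmultiples x) where
  even := fun y hy => by
    obtain ⟨l, hl, j, rfl⟩ := mem_sup_zmultiples.1 hy
    have : B (l + (j : ℚ) • x) (l + (j : ℚ) • x) / 2 =
        B l l / 2 + j * B x l + j * j * (B x x / 2) := by
      simp only [map_add, map_smul, LinearMap.add_apply, LinearMap.smul_apply, smul_eq_mul, hB l x]
      ring
    rw [this]
    exact add_mem (add_mem (hL.even l hl) (mul_mem (intCast_mem_ints j) (hx l hl)))
      (mul_mem (mul_mem (intCast_mem_ints j) (intCast_mem_ints j)) hxx)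
  fg := hL.fg.sup (by
    rw [AddSubgroup.zmultiples_eq_closure]
    exact ⟨{x}, by simp⟩)
  exists_smul_mem := fun v => by
    obtain ⟨n, hn, h⟩ := hL.exists_smul_mem v
    exact ⟨n, hn, AddSubgroup.mem_sup_left h⟩
  smul_mem := fun y hy =>
    AddSubgroup.mem_sup_left (hL.smul_mem y ((mem_dualLattice_sup_zmultiples hB).1 hy).1)
  dual_dual := fun w hw => by
    have hpg : (p : ℚ) • g ∈ dualLattice B (L ⊔ AddSubgroup.zmultiples x) := by
      rw [mem_dualLattice_sup_zmultiples hB]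
      refine ⟨hL.le_dualLattice hB (hL.smul_mem g hg), hx _ (hL.smul_mem g hg)⟩
    obtain ⟨j, hj⟩ := hL.exists_sub_mem hB hp hx hg hxg (b := B w g) (by
      have := hw _ hpg
      rwa [map_smul, smul_eq_mul] at this)
    refine mem_sup_zmultiples.2 ⟨w - (j : ℚ) • x, hL.dual_dual _ fun y hy => ?_, j, by abel⟩
    obtain ⟨i, hi⟩ := hL.exists_sub_mem hB hp hx hg hxg (b := B x y) (by
      have := hx _ (hL.smul_mem y hy)
      rwa [map_smul, smul_eq_mul] at this)
    have hyi : B x (y - (i : ℚ) • g) ∈ ints := by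
      rwa [map_sub, map_smul, smul_eq_mul]
    have h1 : y - (i : ℚ) • g ∈ dualLattice B (L ⊔ AddSubgroup.zmultiples x) :=
      (mem_dualLattice_sup_zmultiples hB).2
        ⟨sub_mem hy (ints_smul_mem (intCast_mem_ints i) hg), hyi⟩
    have h2 : B (w - (j : ℚ) • x) y = B w (y - (i : ℚ) • g) - j * B x (y - (i : ℚ) • g)
        + i * (B w g - j * B x g) := by
      simp only [map_sub, map_smul, LinearMap.sub_apply, LinearMap.smul_apply, smul_eq_mul]
      ring
    rw [h2]
    exact add_mem (sub_mem (hw _ h1) (mul_mem (intCast_mem_ints j) hyi))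
      (mul_mem (intCast_mem_ints i) hj)

lemma IsElementary.relIndex_sup_zmultiples (hB : ∀ x y, B x y = B y x) (hL : IsElementary B p L)
    (hp : p.Prime) (hx : x ∈ dualLattice B L) (hxx : B x x / 2 ∈ ints)
    (hg : g ∈ dualLattice B L) (hxg : B x g ∉ ints) :
    L.relIndex (dualLattice B L) =
      p * ((L ⊔ AddSubgroup.zmultiples x).relIndex
        (dualLattice B (L ⊔ AddSubgroup.zmultiples x)) * p) := by
  have h1 := hL.sup_zmultiples hB hp hx hxx hg hxg
  have hle : dualLattice B (L ⊔ AddSubgroup.zmultiples x) ≤ dualLattice B L := fun y hy =>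
    ((mem_dualLattice_sup_zmultiples hB).1 hy).1
  rw [← AddSubgroup.relIndex_mul_relIndex L (L ⊔ AddSubgroup.zmultiples x) _ le_sup_left
    ((h1.le_dualLattice hB).trans hle),
    ← AddSubgroup.relIndex_mul_relIndex (L ⊔ AddSubgroup.zmultiples x) _ _
      (h1.le_dualLattice hB) hle]
  congr 1
  · refine relIndex_eq_prime hp (AddSubgroup.mem_sup_right (AddSubgroup.mem_zmultiples x))
      (fun hxL => hxg ?_) ?_ fun y hy => ?_
    · rw [hB]
      exact hg x hxL
    · rw [← Nat.cast_smul_eq_nsmul ℚ]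
      exact hL.smul_mem x hx
    · obtain ⟨l, hl, j, rfl⟩ := mem_sup_zmultiples.1 hy
      refine ⟨j, ?_⟩
      rwa [Int.cast_smul_eq_zsmul, add_sub_cancel_right]
  · congr 1
    refine relIndex_eq_prime hp hg
      (fun hgL => hxg ((mem_dualLattice_sup_zmultiples hB).1 hgL).2) ?_ fun y hy => ?_
    · rw [← Nat.cast_smul_eq_nsmul ℚ]
      exact (mem_dualLattice_sup_zmultiples hB).2
        ⟨hL.le_dualLattice hB (hL.smul_mem g hg), hx _ (hL.smul_mem g hg)⟩
    · obtain ⟨i, hi⟩ := hL.exists_sub_mem hB hp hx hg hxg (b := B x y) (by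
        have := hx _ (hL.smul_mem y hy)
        rwa [map_smul, smul_eq_mul] at this)
      refine ⟨i, ?_⟩
      rw [← Int.cast_smul_eq_zsmul ℚ]
      refine (mem_dualLattice_sup_zmultiples hB).2
        ⟨sub_mem hy (ints_smul_mem (intCast_mem_ints i) hg), ?_⟩
      rwa [map_sub, map_smul, smul_eq_mul]

lemma IsElementary.mem_iff_of_sup_zmultiples (hB : ∀ x y, B x y = B y x) (hL : IsElementary B p L)
    (hp : p.Prime) (hx : x ∈ dualLattice B L) (hg : g ∈ dualLattice B L) (hxg : B x g ∉ ints)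
    {y : V} : y ∈ L ↔ y ∈ L ⊔ AddSubgroup.zmultiples x ∧ B y g ∈ ints := by
  have hp' : (p : ℚ) ≠ 0 := by exact_mod_cast hp.ne_zero
  constructor
  · exact fun hy => ⟨AddSubgroup.mem_sup_left hy, hB g y ▸ hg y hy⟩
  · rintro ⟨hy, hyg⟩
    obtain ⟨l, hl, j, rfl⟩ := mem_sup_zmultiples.1 hy
    have hpx := hL.smul_mem x hx
    have h1 : p * B x g ∈ ints := by
      have := hg _ hpx
      rwa [map_smul, smul_eq_mul, hB] at this
    have h2 : p * B x g * j / p ∈ ints := by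
      have : p * B x g * j / p = B (l + (j : ℚ) • x) g - B g l := by
        simp only [map_add, map_smul, LinearMap.add_apply, LinearMap.smul_apply, smul_eq_mul,
          hB g l]
        field_simp
        ring
      rw [this]
      exact sub_mem hyg (hg l hl)
    have h3 := div_mem_of_mul_div_mem hp h1 (by rwa [mul_div_cancel_left₀ _ hp'])
      (intCast_mem_ints j) h2
    have h4 : (j : ℚ) • x = ((j : ℚ) / p) • (p : ℚ) • x := by
      rw [smul_smul, div_mul_cancel₀ _ hp']
    rw [h4]
    exact add_mem hl (ints_smul_mem h3 hpx)

end Elementary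

section HyperbolicPairs

variable {V : Type*} [AddCommGroup V] [Module ℚ V] {B : LinearMap.BilinForm ℚ V}
  {L : AddSubgroup V} {p : ℕ}

lemma exists_isHyperbolicPair_of_form_not_mem (hB : ∀ x y, B x y = B y x)
    (hL : EvenLattice B L) (hp : p.Prime) {e w y : V} (he : e ∈ L) (hee : B e e = 0) (hw : w ∈ L)
    (hew : B e w = p) (hy : y ∈ L) (hey : B e y / p ∉ ints) :
    ∃ f, IsHyperbolicPair B L e f := by
  obtain ⟨u, hu, v, hv, huv⟩ := exists_bezout hp (hL.form_mem hB he hy) hey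
  set f₀ : V := u • y + v • w with hf₀
  have hf₀L : f₀ ∈ L := add_mem (ints_smul_mem hu hy) (ints_smul_mem hv hw)
  have hef : B e f₀ = 1 := by
    simp only [hf₀, map_add, map_smul, smul_eq_mul, hew]
    exact huv
  refine ⟨f₀ - (B f₀ f₀ / 2) • e, he, sub_mem hf₀L (ints_smul_mem (hL _ hf₀L) he), hee, ?_, ?_⟩
  · simp only [map_sub, map_smul, LinearMap.sub_apply, LinearMap.smul_apply, smul_eq_mul, hee,
      hB f₀ e, hef]
    ring
  · simp only [map_sub, map_smul, smul_eq_mul, hee, hef]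
    ring

lemma IsElementary.exists_primitive_isotropic (hB : ∀ x y, B x y = B y x)
    (hN : ∀ x, (∀ y, B x y = 0) → x = 0) (hL : IsElementary B p L) {v : V} (hv : v ≠ 0)
    (hvv : B v v = 0) : ∃ e ∈ L, B e e = 0 ∧ ∃ g ∈ dualLattice B L, B e g = 1 := by
  obtain ⟨n, hn, hnv⟩ := hL.exists_smul_mem v
  rw [← Nat.cast_smul_eq_nsmul ℚ] at hnv
  have hn' : (n : ℚ) ≠ 0 := by exact_mod_cast hn
  set w : V := (n : ℚ) • v with hw
  have hw0 : w ≠ 0 := smul_ne_zero hn' hv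
  have hww : B w w = 0 := by simp [hw, hvv]
  have hwint : ∀ g ∈ dualLattice B L, B w g ∈ ints := fun g hg => hB g w ▸ hg w hnv
  obtain ⟨a, ha⟩ := Int.subgroup_cyclic
    (((dualLattice B L).map (B w : V →+ ℚ)).comap (Int.castAddHom ℚ))
  rw [← AddSubgroup.zmultiples_eq_closure] at ha
  have hmem : ∀ m : ℤ, m ∈ AddSubgroup.zmultiples a ↔ ∃ g ∈ dualLattice B L, B w g = m := by
    intro m
    rw [← ha]
    rfl
  have ha0 : a ≠ 0 := by
    rintro rfl
    refine hw0 (hN w fun y => ?_)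
    obtain ⟨k, hk, hky⟩ := hL.exists_smul_mem y
    have hky' := hL.le_dualLattice hB hky
    obtain ⟨m, hm⟩ := mem_ints.1 (hwint _ hky')
    have h1 := (hmem m).2 ⟨_, hky', hm.symm⟩
    rw [AddSubgroup.zmultiples_zero_eq_bot, AddSubgroup.mem_bot] at h1
    rw [h1, map_nsmul, Int.cast_zero, eq_comm, smul_eq_zero] at hm
    exact hm.resolve_left hk
  have ha0' : (a : ℚ) ≠ 0 := by exact_mod_cast ha0
  refine ⟨(a : ℚ)⁻¹ • w, hL.dual_dual _ fun y hy => ?_, by simp [hww], ?_⟩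
  · obtain ⟨m, hm⟩ := mem_ints.1 (hwint y hy)
    obtain ⟨k, hk⟩ := AddSubgroup.mem_zmultiples_iff.1 ((hmem m).2 ⟨y, hy, hm.symm⟩)
    rw [map_smul, LinearMap.smul_apply, ← hm, ← hk, smul_eq_mul, smul_eq_mul, Int.cast_mul,
      mul_comm, mul_inv_cancel_right₀ ha0']
    exact intCast_mem_ints k
  · obtain ⟨g, hg, h⟩ := (hmem a).1 (AddSubgroup.mem_zmultiples a)
    exact ⟨g, hg, by rw [map_smul, LinearMap.smul_apply, h, smul_eq_mul, inv_mul_cancel₀ ha0']⟩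

lemma IsElementary.exists_isHyperbolicPair_of_isMaximalEven (hB : ∀ x y, B x y = B y x)
    (hN : ∀ x, (∀ y, B x y = 0) → x = 0) (hL : IsElementary B p L) (hp : p.Prime) {v : V}
    (hv : v ≠ 0) (hvv : B v v = 0) (hmax : IsMaximalEven B L) :
    ∃ e f, IsHyperbolicPair B L e f := by
  obtain ⟨e, he, hee, g, hg, heg⟩ := hL.exists_primitive_isotropic hB hN hv hvv
  refine ⟨e, ?_⟩
  have hy : ∃ y ∈ L, B e y / p ∉ ints := by
    by_contra hcon
    push Not at hcon
    have h1 : (p : ℚ)⁻¹ • e ∈ L := hmax.mem _ (fun y hy => by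
      rw [map_smul, LinearMap.smul_apply, smul_eq_mul, mul_comm, ← div_eq_mul_inv]
      exact hcon y hy) (by simp [hee])
    have h2 := hg _ h1
    rw [map_smul, hB, heg, smul_eq_mul, mul_one] at h2
    have h3 : ((1 : ℤ) : ℚ) / p ∈ ints := by simpa using h2
    rw [intCast_div_mem_ints hp.ne_zero] at h3
    exact hp.one_lt.ne' (by exact_mod_cast Int.eq_one_of_dvd_one (by positivity) h3)
  obtain ⟨y, hy, hey⟩ := hy
  exact exists_isHyperbolicPair_of_form_not_mem hB hL.even hp he hee (hL.smul_mem g hg)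
    (by rw [map_smul, heg, smul_eq_mul, mul_one]) hy hey

lemma IsElementary.half_form_smul_div_mem (hL : IsElementary B p L) (hp : p.Prime)
    (hp2 : p ≠ 2) {g : V} (hg : g ∈ dualLattice B L) :
    B ((p : ℚ) • g) ((p : ℚ) • g) / 2 / p ∈ ints := by
  have hp' : (p : ℚ) ≠ 0 := by exact_mod_cast hp.ne_zero
  have h1 := hg _ (hL.smul_mem g hg)
  have h2 := hL.even _ (hL.smul_mem g hg)
  have h3 : ((2 : ℤ) : ℚ) / p ∉ ints := by
    rw [intCast_div_mem_ints hp.ne_zero]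
    intro h
    have h4 : p ∣ 2 := by exact_mod_cast h
    exact hp2 ((Nat.prime_dvd_prime_iff_eq hp Nat.prime_two).1 h4)
  refine div_mem_of_mul_div_mem hp (intCast_mem_ints 2) h3 h2 ?_
  have : ((2 : ℤ) : ℚ) * (B ((p : ℚ) • g) ((p : ℚ) • g) / 2) / p = B g ((p : ℚ) • g) := by
    simp only [map_smul, LinearMap.smul_apply, smul_eq_mul]
    push_cast
    field_simp
  rwa [this]

lemma IsElementary.exists_isHyperbolicPair (hB : ∀ x y, B x y = B y x)
    (hN : ∀ x, (∀ y, B x y = 0) → x = 0) (hL : IsElementary B p L) (hp : p.Prime) (hp2 : p ≠ 2)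
    {v : V} (hv : v ≠ 0) (hvv : B v v = 0) {z : V} (hz : z ∈ L) (hQ : B z z / 2 / p ∈ ints)
    {y : V} (hy : y ∈ L) (hzy : B z y / p ∉ ints) :
    ∃ e f, IsHyperbolicPair B L e f := by
  have hp' : (p : ℚ) ≠ 0 := by exact_mod_cast hp.ne_zero
  obtain ⟨e, he, hee, g, hg, heg⟩ := hL.exists_primitive_isotropic hB hN hv hvv
  have hpg := hL.smul_mem g hg
  by_cases hcon : ∃ y ∈ L, B e y / p ∉ ints
  · obtain ⟨y, hy, hey⟩ := hcon
    exact ⟨e, exists_isHyperbolicPair_of_form_not_mem hB hL.even hp he hee hpg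
      (by rw [map_smul, heg, smul_eq_mul, mul_one]) hy hey⟩
  push Not at hcon
  have hgQ := hL.half_form_smul_div_mem hp hp2 hg
  set s : ℚ := B ((p : ℚ) • g) ((p : ℚ) • g) / 2 / p with hs
  have hsg : s = p * B g g / 2 := by
    simp only [hs, map_smul, LinearMap.smul_apply, smul_eq_mul]
    field_simp
  set f : V := (p : ℚ) • g - s • e with hf
  have hfL : f ∈ L := sub_mem hpg (ints_smul_mem hgQ he)
  have hge : B g e = 1 := by rw [hB, heg]
  have hff : B f f = 0 := by
    simp only [hf, map_sub, map_smul, LinearMap.sub_apply, LinearMap.smul_apply, smul_eq_mul, hee,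
      heg, hge, hsg]
    ring
  have hef : B e f = p := by
    simp only [hf, map_sub, map_smul, smul_eq_mul, hee, heg]
    ring
  have hfe : B f e = p := by rw [hB, hef]
  have hfdual : ∀ y ∈ L, B f y / p ∈ ints := fun y hy => by
    have : B f y / p = B g y - s * (B e y / p) := by
      simp only [hf, map_sub, map_smul, LinearMap.sub_apply, LinearMap.smul_apply, smul_eq_mul]
      field_simp
    rw [this]
    exact sub_mem (hg y hy) (mul_mem hgQ (hcon y hy))
  set α : ℚ := B f z / p with hα
  set β : ℚ := B e z / p with hβ
  have hαi : α ∈ ints := hfdual z hz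
  have hβi : β ∈ ints := hcon z hz
  set k : V := z - α • e - β • f with hk
  have hkL : k ∈ L := sub_mem (sub_mem hz (ints_smul_mem hαi he)) (ints_smul_mem hβi hfL)
  have hzk : z = k + α • e + β • f := by rw [hk]; abel
  have hek : B e k = 0 := by
    simp only [hk, map_sub, map_smul, smul_eq_mul, hee, hef, hβ]
    field_simp
    ring
  have hfk : B f k = 0 := by
    simp only [hk, map_sub, map_smul, smul_eq_mul, hff, hfe, hα]
    field_simp
    ring
  have hke : B k e = 0 := by rw [hB, hek]
  have hkf : B k f = 0 := by rw [hB, hfk]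
  have hzz : B z z = B k k + 2 * α * β * p := by
    rw [hzk]
    simp only [map_add, map_smul, LinearMap.add_apply, LinearMap.smul_apply, smul_eq_mul, hek, hke,
      hfk, hkf, hee, hff, hef, hfe]
    ring
  have hkk : B k k / 2 / p ∈ ints := by
    have : B k k / 2 / p = B z z / 2 / p - α * β := by
      rw [hzz]
      field_simp
      ring
    rw [this]
    exact sub_mem hQ (mul_mem hαi hβi)
  have hky : B k y / p ∉ ints := fun h => hzy (by
    have : B z y / p = B k y / p + α * (B e y / p) + β * (B f y / p) := by
      rw [hzk]
      simp only [map_add, map_smul, LinearMap.add_apply, LinearMap.smul_apply, smul_eq_mul]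
      ring
    rw [this]
    exact add_mem (add_mem h (mul_mem hαi (hcon y hy))) (mul_mem hβi (hfdual y hy)))
  refine ⟨e - (B k k / 2 / p) • f + k, exists_isHyperbolicPair_of_form_not_mem hB hL.even hp
    (w := f) (y := y) (add_mem (sub_mem he (ints_smul_mem hkk hfL)) hkL) ?_ hfL ?_ hy fun h =>
      hky ?_⟩
  · simp only [map_add, map_sub, map_smul, LinearMap.add_apply, LinearMap.sub_apply,
      LinearMap.smul_apply, smul_eq_mul, hek, hke, hfk, hkf, hee, hff, hef, hfe]
    field_simp
    ring
  · simp only [map_add, map_sub, map_smul, LinearMap.add_apply, LinearMap.sub_apply,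
      LinearMap.smul_apply, smul_eq_mul, hkf, hff, hef]
    ring
  · have : B k y / p = B (e - (B k k / 2 / p) • f + k) y / p - B e y / p
        + B k k / 2 / p * (B f y / p) := by
      simp only [map_add, map_sub, map_smul, LinearMap.add_apply, LinearMap.sub_apply,
        LinearMap.smul_apply, smul_eq_mul]
      ring
    rw [this]
    exact add_mem (sub_mem h (hcon y hy)) (mul_mem hkk (hfdual y hy))

end HyperbolicPairs

section Uniqueness

variable {V : Type*} [AddCommGroup V] [Module ℚ V] {B : LinearMap.BilinForm ℚ V}
  {L L' : AddSubgroup V} {p : ℕ}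

lemma IsElementary.exists_of_not_isMaximalEven (hL : IsElementary B p L)
    (hmax : ¬ IsMaximalEven B L) :
    ∃ x ∈ dualLattice B L, B x x / 2 ∈ ints ∧ ∃ g ∈ dualLattice B L, B x g ∉ ints := by
  by_contra hcon
  push Not at hcon
  exact hmax ⟨hL.even, fun x hx hxx => hL.dual_dual x (hcon x hx hxx)⟩

lemma IsElementary.relIndex_sup_zmultiples_lt (hB : ∀ x y, B x y = B y x)
    (hL : IsElementary B p L) (hp : p.Prime) {x g : V} (hx : x ∈ dualLattice B L)
    (hxx : B x x / 2 ∈ ints) (hg : g ∈ dualLattice B L) (hxg : B x g ∉ ints)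
    (h0 : L.relIndex (dualLattice B L) ≠ 0) :
    (L ⊔ AddSubgroup.zmultiples x).relIndex (dualLattice B (L ⊔ AddSubgroup.zmultiples x)) ≠ 0 ∧
    (L ⊔ AddSubgroup.zmultiples x).relIndex (dualLattice B (L ⊔ AddSubgroup.zmultiples x)) <
      L.relIndex (dualLattice B L) := by
  have h := hL.relIndex_sup_zmultiples hB hp hx hxx hg hxg
  rw [h] at h0 ⊢
  set d := (L ⊔ AddSubgroup.zmultiples x).relIndex (dualLattice B (L ⊔ AddSubgroup.zmultiples x))
  have hd : d ≠ 0 := by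
    rintro hd
    simp [hd] at h0
  refine ⟨hd, ?_⟩
  have hp1 := hp.one_lt
  have hd1 := Nat.pos_of_ne_zero hd
  nlinarith [Nat.mul_le_mul hp.one_lt.le (Nat.le_refl (d * p))]

lemma IsElementary.exists_isMaximalEven (hB : ∀ x y, B x y = B y x) (hp : p.Prime) (n : ℕ) :
    ∀ {L : AddSubgroup V}, IsElementary B p L → L.relIndex (dualLattice B L) ≠ 0 →
    L.relIndex (dualLattice B L) = n → ∃ M, IsElementary B p M ∧ IsMaximalEven B M ∧
      M.relIndex (dualLattice B M) ≤ n := by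
  induction n using Nat.strong_induction_on with
  | _ n ih =>
  intro L hL h0 hn
  by_cases hmax : IsMaximalEven B L
  · exact ⟨L, hL, hmax, hn.le⟩
  obtain ⟨x, hx, hxx, g, hg, hxg⟩ := hL.exists_of_not_isMaximalEven hmax
  obtain ⟨h1, h2⟩ := hL.relIndex_sup_zmultiples_lt hB hp hx hxx hg hxg h0
  rw [hn] at h2
  obtain ⟨M, hM, hM', hle⟩ := ih _ h2 (hL.sup_zmultiples hB hp hx hxx hg hxg) h1 rfl
  exact ⟨M, hM, hM', hle.trans h2.le⟩

lemma IsElementary.exists_isLatticeIso_of_isMaximalEven (hB : ∀ x y, B x y = B y x)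
    (hN : ∀ x, (∀ y, B x y = 0) → x = 0) (hp : p.Prime) {v : V} (hv : v ≠ 0) (hvv : B v v = 0)
    (hL : IsElementary B p L) (hL' : IsElementary B p L') (hmax : IsMaximalEven B L)
    (hmax' : IsMaximalEven B L') : ∃ g, IsLatticeIso B L L' g := by
  obtain ⟨e, f, h⟩ := hL.exists_isHyperbolicPair_of_isMaximalEven hB hN hp hv hvv hmax
  exact WittLattice.exists_isLatticeIso_of_isMaximalEven hB hmax' _ h hmax
    (relIndex_ne_zero hL'.fg hL.exists_smul_mem) rfl

lemma IsElementary.isMaximalEven_of_relIndex_eq (hB : ∀ x y, B x y = B y x)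
    (hN : ∀ x, (∀ y, B x y = 0) → x = 0) (hp : p.Prime) {v : V} (hv : v ≠ 0) (hvv : B v v = 0)
    (hL : IsElementary B p L) (hL' : IsElementary B p L')
    (h0 : L.relIndex (dualLattice B L) ≠ 0)
    (h : L.relIndex (dualLattice B L) = L'.relIndex (dualLattice B L'))
    (hmax : IsMaximalEven B L) : IsMaximalEven B L' := by
  by_contra hmax'
  obtain ⟨x, hx, hxx, g, hg, hxg⟩ := hL'.exists_of_not_isMaximalEven hmax'
  obtain ⟨h1, h2⟩ := hL'.relIndex_sup_zmultiples_lt hB hp hx hxx hg hxg (h ▸ h0)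
  obtain ⟨M, hM, hM', hle⟩ := IsElementary.exists_isMaximalEven hB hp _
    (hL'.sup_zmultiples hB hp hx hxx hg hxg) h1 rfl
  obtain ⟨k, hk⟩ := hL.exists_isLatticeIso_of_isMaximalEven hB hN hp hv hvv hM hmax hM'
  have := hk.relIndex_dualLattice
  omega

lemma IsElementary.exists_isometry_of_sup_zmultiples (hB : ∀ x y, B x y = B y x)
    (hL : IsElementary B p L) (hp : p.Prime) (hp2 : p ≠ 2) {x g : V} (hx : x ∈ dualLattice B L)
    (hxx : B x x / 2 ∈ ints) (hg : g ∈ dualLattice B L) (hxg : B x g ∉ ints) {e f : V}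
    (h : IsHyperbolicPair B (L ⊔ AddSubgroup.zmultiples x) e f) :
    ∃ k : V ≃ₗ[ℚ] V, (∀ a b, B (k a) (k b) = B a b) ∧
      ∀ w, w ∈ L ↔ k w ∈ L ⊔ AddSubgroup.zmultiples x ∧ B e (k w) / p ∈ ints := by
  have hp' : (p : ℚ) ≠ 0 := by exact_mod_cast hp.ne_zero
  have hL₁ := hL.sup_zmultiples hB hp hx hxx hg hxg
  obtain ⟨k, hk, c, hc, hcp, l, hl, hkz⟩ := transitiveAt hB hL₁.even h hp
    (AddSubgroup.mem_sup_left (hL.smul_mem g hg)) (hL.half_form_smul_div_mem hp hp2 hg)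
    (AddSubgroup.mem_sup_right (AddSubgroup.mem_zmultiples x)) (by
      rw [map_smul, LinearMap.smul_apply, smul_eq_mul, mul_div_cancel_left₀ _ hp', hB]
      exact hxg)
  refine ⟨k, hk.form, fun w => ?_⟩
  rw [hL.mem_iff_of_sup_zmultiples hB hp hx hg hxg, hk.mem]
  refine and_congr_right fun hw => ?_
  have hkw := (hk.mem w).2 hw
  have hlw := hL₁.even.form_mem hB hl hkw
  have hewi := hL₁.even.form_mem hB h.left_mem hkw
  have h1 : B w g = c * B e (k w) / p + B l (k w) := by
    have h2 : p * B g w = c * B e (k w) + p * B l (k w) := by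
      have h3 := congrArg (fun u => B u (k w)) hkz
      simpa [hk.form] using h3
    rw [hB w g]
    field_simp
    linear_combination h2
  rw [h1]
  constructor
  · intro h2
    refine div_mem_of_mul_div_mem hp hc hcp hewi ?_
    rw [← add_sub_cancel_right (c * B e (k w) / p) (B l (k w))]
    exact sub_mem h2 hlw
  · intro h2
    rw [mul_div_assoc]
    exact add_mem (mul_mem hc h2) hlw

lemma IsElementary.exists_isLatticeIso (hB : ∀ x y, B x y = B y x)
    (hN : ∀ x, (∀ y, B x y = 0) → x = 0) (hp : p.Prime) (hp2 : p ≠ 2) {v : V} (hv : v ≠ 0)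
    (hvv : B v v = 0) (n : ℕ) : ∀ {L L' : AddSubgroup V}, IsElementary B p L →
    IsElementary B p L' → L.relIndex (dualLattice B L) ≠ 0 →
    L.relIndex (dualLattice B L) = L'.relIndex (dualLattice B L') →
    L.relIndex (dualLattice B L) = n → ∃ g, IsLatticeIso B L L' g := by
  induction n using Nat.strong_induction_on with
  | _ n ih =>
  intro L L' hL hL' h0 heq hn
  by_cases hmax : IsMaximalEven B L
  · exact hL.exists_isLatticeIso_of_isMaximalEven hB hN hp hv hvv hL' hmax
      (hL.isMaximalEven_of_relIndex_eq hB hN hp hv hvv hL' h0 heq hmax)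
  have hmax' : ¬ IsMaximalEven B L' := fun h =>
    hmax (hL'.isMaximalEven_of_relIndex_eq hB hN hp hv hvv hL (heq ▸ h0) heq.symm h)
  obtain ⟨x, hx, hxx, g, hg, hxg⟩ := hL.exists_of_not_isMaximalEven hmax
  obtain ⟨x', hx', hxx', g', hg', hxg'⟩ := hL'.exists_of_not_isMaximalEven hmax'
  have hL₁ := hL.sup_zmultiples hB hp hx hxx hg hxg
  have hL₁' := hL'.sup_zmultiples hB hp hx' hxx' hg' hxg'
  obtain ⟨h1, h2⟩ := hL.relIndex_sup_zmultiples_lt hB hp hx hxx hg hxg h0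
  have hp' : (p : ℚ) ≠ 0 := by exact_mod_cast hp.ne_zero
  obtain ⟨e, f, hef⟩ := hL₁.exists_isHyperbolicPair hB hN hp hp2 hv hvv
    (AddSubgroup.mem_sup_left (hL.smul_mem g hg)) (hL.half_form_smul_div_mem hp hp2 hg)
    (AddSubgroup.mem_sup_right (AddSubgroup.mem_zmultiples x)) (by
      rw [map_smul, LinearMap.smul_apply, smul_eq_mul, mul_div_cancel_left₀ _ hp', hB]
      exact hxg)
  obtain ⟨φ, hφ⟩ := ih _ (hn ▸ h2) hL₁ hL₁' h1 (by
    rw [hL.relIndex_sup_zmultiples hB hp hx hxx hg hxg,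
      hL'.relIndex_sup_zmultiples hB hp hx' hxx' hg' hxg'] at heq
    exact Nat.eq_of_mul_eq_mul_right hp.pos (Nat.eq_of_mul_eq_mul_left hp.pos heq)) rfl
  obtain ⟨k, hk, hkL⟩ := hL.exists_isometry_of_sup_zmultiples hB hp hp2 hx hxx hg hxg hef
  obtain ⟨k', hk', hkL'⟩ := hL'.exists_isometry_of_sup_zmultiples hB hp hp2 hx' hxx' hg' hxg'
    (hef.map hφ)
  refine ⟨(k.trans φ).trans k'.symm, fun a b => ?_, fun w => ?_⟩
  · rw [← hk']
    simp [hφ.form, hk]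
  · rw [hkL', hkL]
    simp [hφ.form, hφ.mem]

end Uniqueness

section Gram

/-- The lattice `ℤ ^ r` in `ℚ ^ r`. -/
def stdLattice (r : ℕ) : AddSubgroup (Fin r → ℚ) :=
  ((Int.castAddHom ℚ).compLeft (Fin r)).range

lemma mem_stdLattice {r : ℕ} {x : Fin r → ℚ} :
    x ∈ stdLattice r ↔ ∃ n : Fin r → ℤ, (fun i => (n i : ℚ)) = x := Iff.rfl

lemma mem_stdLattice_iff_apply {r : ℕ} {x : Fin r → ℚ} :
    x ∈ stdLattice r ↔ ∀ i, x i ∈ ints := by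
  rw [mem_stdLattice]
  constructor
  · rintro ⟨n, rfl⟩ i
    exact intCast_mem_ints _
  · intro h
    choose n hn using fun i => mem_ints.1 (h i)
    exact ⟨n, funext hn⟩

lemma ratCast_mulVec {r : ℕ} (G : Matrix (Fin r) (Fin r) ℤ) (n : Fin r → ℤ) :
    G.map (Int.cast : ℤ → ℚ) *ᵥ (fun i => (n i : ℚ)) = fun i => ((G *ᵥ n) i : ℚ) := by
  funext i
  simp [mulVec, dotProduct]

lemma map_ratCast_det_ne_zero {r : ℕ} {G : Matrix (Fin r) (Fin r) ℤ} (hd : G.det ≠ 0) :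
    (G.map (Int.cast : ℤ → ℚ)).det ≠ 0 := by
  have h : (G.det : ℚ) = (G.map (Int.cast : ℤ → ℚ)).det := (Int.castRingHom ℚ).map_det G
  rw [← h]
  exact_mod_cast hd

lemma mulVec_mem_stdLattice {r : ℕ} (G : Matrix (Fin r) (Fin r) ℤ) {x : Fin r → ℚ}
    (hx : x ∈ stdLattice r) : G.map (Int.cast : ℤ → ℚ) *ᵥ x ∈ stdLattice r := by
  obtain ⟨n, rfl⟩ := mem_stdLattice.1 hx
  exact mem_stdLattice.2 ⟨_, (ratCast_mulVec G n).symm⟩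

lemma mem_stdLattice_iff_dotProduct {r : ℕ} {x : Fin r → ℚ} :
    x ∈ stdLattice r ↔ ∀ y ∈ stdLattice r, x ⬝ᵥ y ∈ ints := by
  constructor
  · intro hx y hy
    rw [mem_stdLattice_iff_apply] at hx hy
    exact sum_mem fun i _ => mul_mem (hx i) (hy i)
  · intro h
    rw [mem_stdLattice_iff_apply]
    intro i
    have := h (Pi.single i 1) (mem_stdLattice.2 ⟨Pi.single i 1, by
      funext j
      by_cases hij : j = i
      · subst hij; simp
      · simp [hij]⟩)
    simpa using this

variable {V : Type*} [AddCommGroup V] [Module ℚ V] {B : LinearMap.BilinForm ℚ V} {r p a : ℕ}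
  {G : Matrix (Fin r) (Fin r) ℤ} {φ : (Fin r → ℚ) ≃ₗ[ℚ] V}

lemma apply_mem_map_stdLattice {x : Fin r → ℚ} :
    φ x ∈ (stdLattice r).map (φ : (Fin r → ℚ) →+ V) ↔ x ∈ stdLattice r :=
  AddSubgroup.mem_map_iff_mem φ.injective

lemma apply_mem_dualLattice_map (hG : G.IsSymm)
    (hφ : ∀ x y, B (φ x) (φ y) = x ⬝ᵥ G.map (Int.cast : ℤ → ℚ) *ᵥ y) {x : Fin r → ℚ} :
    φ x ∈ dualLattice B ((stdLattice r).map (φ : (Fin r → ℚ) →+ V)) ↔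
      G.map (Int.cast : ℤ → ℚ) *ᵥ x ∈ stdLattice r := by
  have hsymm : ∀ y, x ⬝ᵥ G.map (Int.cast : ℤ → ℚ) *ᵥ y = G.map (Int.cast : ℤ → ℚ) *ᵥ x ⬝ᵥ y := by
    intro y
    rw [dotProduct_mulVec, ← mulVec_transpose, (hG.map _).eq]
  rw [mem_stdLattice_iff_dotProduct]
  constructor
  · intro h y hy
    rw [← hsymm, ← hφ]
    exact h _ (apply_mem_map_stdLattice.2 hy)
  · rintro h _ ⟨y, hy, rfl⟩
    change B (φ x) (φ y) ∈ ints
    rw [hφ, hsymm]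
    exact h y hy

lemma isElementary_map_stdLattice (hG : G.IsSymm) (he : ∀ i, Even (G i i)) (hp : p ≠ 0)
    {N : Matrix (Fin r) (Fin r) ℤ} (hN : G * N = (p : ℤ) • 1)
    (hφ : ∀ x y, B (φ x) (φ y) = x ⬝ᵥ G.map (Int.cast : ℤ → ℚ) *ᵥ y) :
    IsElementary B p ((stdLattice r).map (φ : (Fin r → ℚ) →+ V)) := by
  have hp' : (p : ℚ) ≠ 0 := by exact_mod_cast hp
  have hGN : G.map (Int.cast : ℤ → ℚ) * N.map (Int.cast : ℤ → ℚ) = (p : ℚ) • 1 := by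
    have h1 := congrArg (fun X : Matrix (Fin r) (Fin r) ℤ => X.map (Int.castRingHom ℚ)) hN
    simp only [Matrix.map_mul] at h1
    refine h1.trans ?_
    ext i j
    rw [Matrix.map_apply, Matrix.smul_apply, Matrix.smul_apply, one_apply, one_apply]
    split_ifs <;> simp
  have hGN' : G.map (Int.cast : ℤ → ℚ) * ((p : ℚ)⁻¹ • N.map (Int.cast : ℤ → ℚ)) = 1 := by
    rw [Matrix.mul_smul, hGN, smul_smul, inv_mul_cancel₀ hp', one_smul]
  have hNG' := mul_eq_one_comm.1 hGN'
  refine ⟨?_, ?_, fun v => ?_, fun x hx => ?_, fun x hx => ?_⟩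
  · rintro _ ⟨x, hx, rfl⟩
    obtain ⟨n, rfl⟩ := mem_stdLattice.1 hx
    change B (φ _) (φ _) / 2 ∈ ints
    obtain ⟨m, hm⟩ := even_dotProduct_mulVec hG he n
    have h1 : ((n ⬝ᵥ G *ᵥ n : ℤ) : ℚ) / 2 = m := by
      rw [hm]
      push_cast
      ring
    have h2 : (fun i => (n i : ℚ)) ⬝ᵥ (fun i => ((G *ᵥ n) i : ℚ)) = ((n ⬝ᵥ G *ᵥ n : ℤ) : ℚ) := by
      simp [dotProduct]
    rw [hφ, ratCast_mulVec, h2, h1]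
    exact intCast_mem_ints m
  · rw [← AddGroup.fg_iff_addSubgroup_fg, stdLattice, AddMonoidHom.map_range]
    infer_instance
  · obtain ⟨x, rfl⟩ := φ.surjective v
    refine ⟨∏ i, (x i).den, Finset.prod_ne_zero_iff.2 fun i _ => (x i).den_ne_zero, ?_⟩
    rw [← map_nsmul]
    refine apply_mem_map_stdLattice.2 (mem_stdLattice_iff_apply.2 fun i => ?_)
    rw [← Finset.prod_erase_mul _ _ (Finset.mem_univ i), Pi.smul_apply, mul_smul]
    refine nsmul_mem ?_ _
    rw [nsmul_eq_mul, Rat.den_mul_eq_num]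
    exact intCast_mem_ints _
  · obtain ⟨x, rfl⟩ := φ.surjective x
    rw [apply_mem_dualLattice_map hG hφ] at hx
    rw [← map_smul, apply_mem_map_stdLattice]
    have h1 : (p : ℚ) • x = N.map (Int.cast : ℤ → ℚ) *ᵥ G.map (Int.cast : ℤ → ℚ) *ᵥ x := by
      rw [mulVec_mulVec]
      have h2 : N.map (Int.cast : ℤ → ℚ) * G.map (Int.cast : ℤ → ℚ) = (p : ℚ) • 1 := by
        rw [← hNG', Matrix.smul_mul, smul_smul, mul_inv_cancel₀ hp', one_smul]
      rw [h2, smul_mulVec, one_mulVec]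
    rw [h1]
    exact mulVec_mem_stdLattice N hx
  · obtain ⟨x, rfl⟩ := φ.surjective x
    rw [apply_mem_map_stdLattice, mem_stdLattice_iff_dotProduct]
    intro y hy
    have h1 : G.map (Int.cast : ℤ → ℚ) *ᵥ ((p : ℚ)⁻¹ • N.map (Int.cast : ℤ → ℚ)) *ᵥ y = y := by
      rw [mulVec_mulVec, hGN', one_mulVec]
    rw [← h1, ← hφ]
    refine hx _ ((apply_mem_dualLattice_map hG hφ).2 ?_)
    rwa [h1]

lemma relIndex_map_stdLattice (hG : G.IsSymm) (hd : G.det ≠ 0)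
    (hφ : ∀ x y, B (φ x) (φ y) = x ⬝ᵥ G.map (Int.cast : ℤ → ℚ) *ᵥ y) :
    ((stdLattice r).map (φ : (Fin r → ℚ) →+ V)).relIndex
      (dualLattice B ((stdLattice r).map (φ : (Fin r → ℚ) →+ V))) =
    Nat.card ((Fin r → ℤ) ⧸ LinearMap.range G.mulVecLin) := by
  have hdet : (G.map (Int.cast : ℤ → ℚ)).det ≠ 0 := map_ratCast_det_ne_zero hd
  have hinj : Function.Injective
      ((G.map (Int.cast : ℤ → ℚ)).mulVecLin : (Fin r → ℚ) →+ (Fin r → ℚ)) :=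
    Matrix.mulVec_injective_of_det_ne_zero hdet
  have hc : Function.Injective ((Int.castAddHom ℚ).compLeft (Fin r)) := fun x y h =>
    funext fun i => Int.cast_injective (congrFun h i)
  have h1 : dualLattice B ((stdLattice r).map (φ : (Fin r → ℚ) →+ V)) =
      ((stdLattice r).comap ((G.map (Int.cast : ℤ → ℚ)).mulVecLin : (Fin r → ℚ) →+ (Fin r → ℚ))).map
        (φ : (Fin r → ℚ) →+ V) := by
    ext x
    obtain ⟨x, rfl⟩ := φ.surjective x
    rw [apply_mem_dualLattice_map hG hφ]
    refine Iff.trans ?_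
      (AddSubgroup.mem_map_iff_mem (f := (φ : (Fin r → ℚ) →+ V)) (x := x) φ.injective).symm
    exact Iff.rfl
  have hsurj : Function.Surjective
      ((G.map (Int.cast : ℤ → ℚ)).mulVecLin : (Fin r → ℚ) →+ (Fin r → ℚ)) := fun y =>
    ⟨(G.map (Int.cast : ℤ → ℚ))⁻¹ *ᵥ y, by
      change G.map (Int.cast : ℤ → ℚ) *ᵥ (G.map (Int.cast : ℤ → ℚ))⁻¹ *ᵥ y = y
      rw [mulVec_mulVec, mul_nonsing_inv _ (isUnit_iff_ne_zero.2 hdet), one_mulVec]⟩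
  have h2 : (stdLattice r).map ((G.map (Int.cast : ℤ → ℚ)).mulVecLin : (Fin r → ℚ) →+ (Fin r → ℚ)) =
      (LinearMap.range G.mulVecLin).toAddSubgroup.map ((Int.castAddHom ℚ).compLeft (Fin r)) := by
    ext x
    constructor
    · rintro ⟨_, ⟨n, rfl⟩, rfl⟩
      exact ⟨G *ᵥ n, ⟨n, rfl⟩, (ratCast_mulVec G n).symm⟩
    · rintro ⟨_, ⟨n, rfl⟩, rfl⟩
      exact ⟨_, ⟨n, rfl⟩, ratCast_mulVec G n⟩
  rw [h1, AddSubgroup.relIndex_map_map_of_injective _ _ φ.injective,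
    ← AddSubgroup.relIndex_map_map_of_injective _ _ hinj,
    AddSubgroup.map_comap_eq_self_of_surjective hsurj, h2]
  rw [stdLattice, AddMonoidHom.range_eq_map, AddSubgroup.relIndex_map_map_of_injective _ _ hc,
    AddSubgroup.relIndex_top_right]
  rfl

end Gram

section Main

variable {r p a : ℕ} {M M' : Matrix (Fin r) (Fin r) ℤ}

theorem exists_integral_cong [Fact p.Prime] (hp : p ≠ 2) (hr : 3 ≤ r)
    (hs : M.IsSymm) (hs' : M'.IsSymm)
    (he : ∀ i, Even (M i i)) (he' : ∀ i, Even (M' i i)) (hd : M.det ≠ 0) (hd' : M'.det ≠ 0)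
    (hh : ∃ P : Matrix (Fin r) (Fin r) ℝ, IsUnit P.det ∧ Pᵀ * (M.map (Int.cast : ℤ → ℝ)) * P =
      Matrix.diagonal (fun i : Fin r => if (i : ℕ) = 0 then (1 : ℝ) else -1))
    (hh' : ∃ P : Matrix (Fin r) (Fin r) ℝ, IsUnit P.det ∧ Pᵀ * (M'.map (Int.cast : ℤ → ℝ)) * P =
      Matrix.diagonal (fun i : Fin r => if (i : ℕ) = 0 then (1 : ℝ) else -1))
    (hel : Nonempty (((Fin r → ℤ) ⧸ LinearMap.range M.mulVecLin) ≃ₗ[ℤ] (Fin a → ZMod p)))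
    (hel' : Nonempty (((Fin r → ℤ) ⧸ LinearMap.range M'.mulVecLin) ≃ₗ[ℤ] (Fin a → ZMod p))) :
    ∃ P : Matrix (Fin r) (Fin r) ℤ, IsUnit P.det ∧ Pᵀ * M * P = M' := by
  have hpp : p.Prime := Fact.out
  obtain ⟨C, hC⟩ := exists_hasRes_of_elem hs hd hel
  obtain ⟨C', hC'⟩ := exists_hasRes_of_elem hs' hd' hel'
  have hdp := natAbs_det_of_elem hd hel
  have hdp' := natAbs_det_of_elem hd' hel'
  obtain ⟨N, hN⟩ := exists_mul_eq_of_elem hel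
  obtain ⟨N', hN'⟩ := exists_mul_eq_of_elem hel'
  obtain ⟨v, hv, hvv⟩ := exists_isotropic hr hp hs he hh hdp hC
  obtain ⟨P, hP⟩ := exists_rational_cong hp hs hs' he he' hh hh' hdp hdp' hC hC'
  have hdet : (M.map (Int.cast : ℤ → ℚ)).det ≠ 0 := map_ratCast_det_ne_zero hd
  have hdet' : (M'.map (Int.cast : ℤ → ℚ)).det ≠ 0 := map_ratCast_det_ne_zero hd'
  have hPdet : IsUnit P.det := isUnit_iff_ne_zero.2 fun h => hdet' (by
    rw [← hP, det_mul, h, mul_zero])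
  let ψ : (Fin r → ℚ) ≃ₗ[ℚ] (Fin r → ℚ) :=
    LinearEquiv.ofLinearMap P.mulVecLin P⁻¹.mulVecLin
      (by rw [← mulVecLin_mul, mul_nonsing_inv _ hPdet, mulVecLin_one])
      (by rw [← mulVecLin_mul, nonsing_inv_mul _ hPdet, mulVecLin_one])
  let B := Matrix.toBilin' (M.map (Int.cast : ℤ → ℚ))
  have hBapply : ∀ x y, B x y = x ⬝ᵥ M.map (Int.cast : ℤ → ℚ) *ᵥ y := Matrix.toBilin'_apply' _
  have hB : ∀ x y, B x y = B y x := fun x y => by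
    rw [hBapply, hBapply, dotProduct_mulVec, dotProduct_comm, ← mulVec_transpose, (hs.map _).eq]
  have hnd : ∀ x, (∀ y, B x y = 0) → x = 0 := fun x hx => by
    have h1 : M.map (Int.cast : ℤ → ℚ) *ᵥ x = 0 := by
      refine dotProduct_eq_zero _ fun w => ?_
      rw [dotProduct_comm, ← hBapply, hB, hx]
    exact Matrix.eq_zero_of_mulVec_eq_zero hdet h1
  have hφ : ∀ x y, B (LinearEquiv.refl ℚ (Fin r → ℚ) x) (LinearEquiv.refl ℚ (Fin r → ℚ) y) =
      x ⬝ᵥ M.map (Int.cast : ℤ → ℚ) *ᵥ y := hBapply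
  have hψ : ∀ x y, B (ψ x) (ψ y) = x ⬝ᵥ M'.map (Int.cast : ℤ → ℚ) *ᵥ y := fun x y => by
    change B (P *ᵥ x) (P *ᵥ y) = _
    rw [hBapply, ← hP, ← mulVec_mulVec, ← mulVec_mulVec, dotProduct_mulVec x, vecMul_transpose]
  have hi := relIndex_map_stdLattice hs hd hφ
  have hi' := relIndex_map_stdLattice hs' hd' hψ
  rw [natCard_quotient_of_elem hel] at hi
  rw [natCard_quotient_of_elem hel'] at hi'
  obtain ⟨g, hg⟩ := IsElementary.exists_isLatticeIso hB hnd hpp hp hv (by rw [hBapply, hvv]) _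
    (isElementary_map_stdLattice hs he hpp.ne_zero hN hφ)
    (isElementary_map_stdLattice hs' he' hpp.ne_zero hN' hψ)
    (by rw [hi]; exact pow_ne_zero _ hpp.ne_zero) (by rw [hi, hi']) rfl
  let h := ψ.trans g.symm
  have hform : ∀ x y, B (h x) (h y) = x ⬝ᵥ M'.map (Int.cast : ℤ → ℚ) *ᵥ y := fun x y => by
    rw [← hψ, ← hg.form]
    simp [h]
  have hmem : ∀ x, h x ∈ stdLattice r ↔ x ∈ stdLattice r := fun x => by
    rw [← apply_mem_map_stdLattice (φ := LinearEquiv.refl ℚ (Fin r → ℚ)), LinearEquiv.refl_apply,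
      ← hg.mem, ← apply_mem_map_stdLattice (φ := ψ)]
    simp [h]
  have hsingle : ∀ i, (Pi.single i 1 : Fin r → ℚ) ∈ stdLattice r := fun i =>
    mem_stdLattice.2 ⟨Pi.single i 1, by
      funext j
      by_cases hij : j = i
      · subst hij; simp
      · simp [hij]⟩
  choose c hc using fun i => mem_stdLattice.1 ((hmem _).2 (hsingle i))
  set Q : Matrix (Fin r) (Fin r) ℤ := Matrix.of fun i j => c j i with hQ
  have hQcol : ∀ j, (Q.map (Int.cast : ℤ → ℚ)) *ᵥ Pi.single j 1 = h (Pi.single j 1) := fun j => by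
    rw [mulVec_single_one, ← hc]
    rfl
  have hQh : ∀ x, (Q.map (Int.cast : ℤ → ℚ)) *ᵥ x = h x := fun x => by
    have : (Q.map (Int.cast : ℤ → ℚ)).mulVecLin = (h : (Fin r → ℚ) →ₗ[ℚ] (Fin r → ℚ)) := by
      refine LinearMap.pi_ext' fun j => LinearMap.ext_ring ?_
      exact hQcol j
    exact LinearMap.congr_fun this x
  refine ⟨Q, ?_, ?_⟩
  · choose d hd using fun i => mem_stdLattice.1 ((hmem (h.symm (Pi.single i 1))).1 (by
      rw [LinearEquiv.apply_symm_apply]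
      exact hsingle i))
    have h1 : Q * Matrix.of (fun i j => d j i) = 1 := by
      ext i j
      have h2 := hQh (fun i => (d j i : ℚ))
      rw [hd, LinearEquiv.apply_symm_apply, ← hd, ratCast_mulVec] at h2
      have h3 := congrFun h2 i
      rw [mul_apply_eq_vecMul, one_apply]
      simp only [Pi.single_apply] at h3
      exact_mod_cast h3
    exact isUnit_det_of_right_inverse h1
  · apply Matrix.map_injective (f := (Int.cast : ℤ → ℚ)) Int.cast_injective
    apply Matrix.toBilin'.injective
    refine LinearMap.ext₂ fun x y => ?_
    rw [Matrix.toBilin'_apply', Matrix.toBilin'_apply', ← hform, ← hQh, ← hQh, hBapply]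
    have h1 : (Qᵀ * M * Q).map (Int.cast : ℤ → ℚ) =
        (Q.map (Int.cast : ℤ → ℚ))ᵀ * M.map (Int.cast : ℤ → ℚ) * Q.map (Int.cast : ℤ → ℚ) := by
      change (Qᵀ * M * Q).map (Int.castRingHom ℚ) = _
      rw [Matrix.map_mul, Matrix.map_mul]
      rfl
    change x ⬝ᵥ (Qᵀ * M * Q).map (Int.cast : ℤ → ℚ) *ᵥ y = _
    rw [h1, ← mulVec_mulVec, ← mulVec_mulVec, dotProduct_mulVec x, vecMul_transpose]

end Main

end WittLattice

/-- The Rudakov–Shafarevich uniqueness theorem: for an odd prime `p` and rank `r ≥ 3`, two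
even hyperbolic `p`-elementary Gram matrices of the same length `a` are `ℤ`-congruent. -/
theorem stmt_11 (p : ℕ) (hp : p.Prime) (hodd : Odd p) (r a : ℕ) (hr : 3 ≤ r)
    (M M' : Matrix (Fin r) (Fin r) ℤ)
    (hs : M.IsSymm) (hs' : M'.IsSymm)
    (he : ∀ i, Even (M i i)) (he' : ∀ i, Even (M' i i))
    (hdet : M.det ≠ 0) (hdet' : M'.det ≠ 0)
    (hh : IsHyperbolicGram M) (hh' : IsHyperbolicGram M')
    (hel : ElemOfLength p a M) (hel' : ElemOfLength p a M') :
    ∃ P : Matrix (Fin r) (Fin r) ℤ, IsUnit P.det ∧ Pᵀ * M * P = M' := by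
  have := Fact.mk hp
  have hp2 : p ≠ 2 := by
    rintro rfl
    exact absurd hodd (by decide)
  exact WittLattice.exists_integral_cong hp2 hr hs hs' he he' hdet hdet' hh hh' hel hel'
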